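/- Suppose Γ ⊂ ℂⁿ is a compact subset of a continuum of finite one-dimensional Hausdorff measure. Then the covering dimension of the polynomially convex hull Γ̂ of Γ is at most 2. -/

import Mathlib

/-! Čech cohomology with integer coefficients, defined via unindexed open covers. -/

namespace CechPaper

variable (X : Type*) [TopologicalSpace X]

/-- An (unindexed) open cover of `X`: a collection of open sets covering `X`. -/
def IsCover (𝒰 : Set (Set X)) : Prop :=
  (∀ U ∈ 𝒰, IsOpen U) ∧ ∀ x : X, ∃ U ∈ 𝒰, x ∈ U

/-- Čech `n`-cochains (with respect to covers by subsets of `X`) with integer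
coefficients: an integer for each `(n+1)`-tuple of sets. -/
abbrev Cochain (n : ℕ) := (Fin (n + 1) → Set X) → ℤ

/-- The Čech coboundary operator. -/
def coboundary {n : ℕ} (c : Cochain X n) : Cochain X (n + 1) := fun σ =>
  ∑ i : Fin (n + 2), (-1 : ℤ) ^ (i : ℕ) * c (σ ∘ i.succAbove)

/-- A tuple of sets is relevant for the cover `𝒰` if all its members belong to `𝒰`
and it is a simplex of the nerve of `𝒰`, i.e. the total intersection is nonempty. -/
def Relevant (𝒰 : Set (Set X)) {m : ℕ} (σ : Fin m → Set X) : Prop :=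
  (∀ j, σ j ∈ 𝒰) ∧ (⋂ j, σ j).Nonempty

/-- `c` is a cocycle on the nerve of the cover `𝒰`. -/
def IsCocycle (𝒰 : Set (Set X)) {n : ℕ} (c : Cochain X n) : Prop :=
  ∀ σ : Fin (n + 2) → Set X, Relevant X 𝒰 σ → coboundary X c σ = 0

/-- A representative of a degree `n+1` Čech cohomology class: an open cover
together with an `(n+1)`-cocycle on its nerve. -/
structure Elem (n : ℕ) where
  cov : Set (Set X)
  isCover : IsCover X cov
  coc : Cochain X (n + 1)
  isCocycle : IsCocycle X cov coc

/-- `𝒲` refines `𝒰` with refinement map `r`. -/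
def RefinesWith (𝒲 𝒰 : Set (Set X)) (r : Set X → Set X) : Prop :=
  ∀ W ∈ 𝒲, r W ∈ 𝒰 ∧ W ⊆ r W

/-- Two cover/cocycle pairs define the same Čech cohomology class iff on some common
refinement the difference of (the restrictions of) the cocycles is a coboundary. -/
def Rel {n : ℕ} (e₁ e₂ : Elem X n) : Prop :=
  ∃ (𝒲 : Set (Set X)) (r₁ r₂ : Set X → Set X) (b : Cochain X n),
    IsCover X 𝒲 ∧ RefinesWith X 𝒲 e₁.cov r₁ ∧ RefinesWith X 𝒲 e₂.cov r₂ ∧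
    ∀ σ : Fin (n + 2) → Set X, Relevant X 𝒲 σ →
      e₁.coc (r₁ ∘ σ) - e₂.coc (r₂ ∘ σ) = coboundary X b σ

/-- The Čech cohomology group `H^{n+1}(X, ℤ)` (as a set: the colimit over all open
covers, directed by refinement, of the cohomology of their nerves). -/
def CechHSucc (n : ℕ) := Quot (Rel X (n := n))

/-- The second Čech cohomology `H²(X, ℤ)` of `X` with integer coefficients. -/
abbrev CechH2 := CechHSucc X 1

/-- The covering dimension of `X` is at most `n`: every open cover admits an open
refinement such that no `n+2` distinct members of it have a common point. -/
def CovDimLE (n : ℕ) : Prop :=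
  ∀ 𝒰 : Set (Set X), IsCover X 𝒰 →
    ∃ 𝒱 : Set (Set X), IsCover X 𝒱 ∧ (∀ V ∈ 𝒱, ∃ U ∈ 𝒰, V ⊆ U) ∧
      ∀ T : Finset (Set X), ↑T ⊆ 𝒱 → (⋂₀ (T : Set (Set X))).Nonempty → T.card ≤ n + 1

end CechPaper

open MeasureTheory

noncomputable instance (n : ℕ) : MeasurableSpace (EuclideanSpace ℂ (Fin n)) := borel _
instance (n : ℕ) : BorelSpace (EuclideanSpace ℂ (Fin n)) := ⟨rfl⟩

/-- The polynomially convex hull of a bounded set `K ⊂ ℂⁿ`: all points at which every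
polynomial in `n` complex variables is bounded by its supremum over `K`. -/
def polyHull {n : ℕ} (K : Set (EuclideanSpace ℂ (Fin n))) : Set (EuclideanSpace ℂ (Fin n)) :=
  {z | ∀ p : MvPolynomial (Fin n) ℂ,
    ‖MvPolynomial.eval (fun i => z i) p‖ ≤
      sSup ((fun w => ‖MvPolynomial.eval (fun i => w i) p‖) '' K)}

open CechPaper

namespace HullDim

open Complex Metric Set in
/-- Two-constants estimate: smallness on a vertical segment propagates to a ball. -/
theorem two_constants {h r R : ℝ} (hh : 0 < h) (hr : 0 < r) (hR : 0 < R)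
    (hRr : h ^ 2 + r ^ 2 < R ^ 2) :
    ∃ θ : ℝ, 0 < θ ∧ θ < 1 ∧ ∀ (f : ℂ → ℂ) (c : ℂ) (M m : ℝ),
      DifferentiableOn ℂ f (ball c R) → (∀ z ∈ ball c R, ‖f z‖ ≤ M) → 0 ≤ m → m ≤ M →
      (∀ y ∈ Icc (-h) h, ‖f (c + y * I)‖ ≤ m) →
      ∀ z ∈ ball c r, ‖f z‖ ≤ M ^ (1 - θ) * m ^ θ := by
  set t : ℝ := √((r ^ 2 + R ^ 2 - h ^ 2) / 2) / h with ht
  have hpos : 0 < (r ^ 2 + R ^ 2 - h ^ 2) / 2 := by nlinarith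
  have ht0 : 0 < t := by positivity
  have ht2 : h ^ 2 * t ^ 2 = (r ^ 2 + R ^ 2 - h ^ 2) / 2 := by
    rw [ht, div_pow, Real.sq_sqrt hpos.le]; field_simp
  set σ := Real.arsinh t with hσ
  set x := Real.arsinh (r / h) with hx
  have hσ0 : 0 < σ := by simpa [hσ] using ht0
  have hx0 : 0 < x := by simpa [hx] using div_pos hr hh
  have hxσ : x < σ := by
    rw [hx, hσ, Real.arsinh_lt_arsinh]
    have : (r / h) ^ 2 < t ^ 2 := by
      rw [div_pow, div_lt_iff₀ (by positivity)]; nlinarith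
    exact lt_of_pow_lt_pow_left₀ 2 ht0.le this
  have hcosh : h * Real.cosh σ < R := by
    refine lt_of_pow_lt_pow_left₀ 2 hR.le ?_
    rw [mul_pow, hσ, Real.cosh_arsinh, Real.sq_sqrt (by positivity)]
    nlinarith
  have key : ∀ a b : ℝ, ‖cosh (a + b * I)‖ ^ 2 = Real.sinh a ^ 2 + Real.cos b ^ 2 := by
    intro a b
    rw [Complex.cosh_add, Complex.cosh_mul_I, Complex.sinh_mul_I, ← ofReal_cosh, ← ofReal_cos,
      ← ofReal_sinh, ← ofReal_sin, Complex.sq_norm, normSq_apply]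
    simp only [add_re, mul_re, ofReal_re, ofReal_im, mul_zero, sub_zero, I_re, I_im, add_im,
      mul_im, zero_mul, add_zero, mul_one, sub_self, zero_add]
    linear_combination Real.cos b ^ 2 * Real.cosh_sq a +
      Real.sinh a ^ 2 * Real.sin_sq_add_cos_sq b
  refine ⟨1 - x / σ, by rw [sub_pos, div_lt_one hσ0]; exact hxσ, by
    rw [sub_lt_self_iff]; positivity, ?_⟩
  intro f c M m hf hM hm hmM hseg z hz
  have hM0 : 0 ≤ M := hm.trans hmM
  have hmaps : ∀ s : ℂ, s.re ∈ Icc 0 σ → c + h * I * cosh s ∈ ball c R := by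
    intro s hs
    have h1 := key s.re s.im
    rw [re_add_im] at h1
    have : ‖cosh s‖ ≤ Real.cosh σ := by
      refine (sq_le_sq₀ (norm_nonneg _) (Real.cosh_pos _).le).1 ?_
      rw [h1]
      have h2 : Real.cosh s.re ≤ Real.cosh σ := by
        rw [Real.cosh_le_cosh, abs_of_nonneg hs.1, abs_of_pos hσ0]; exact hs.2
      nlinarith [Real.cosh_sq s.re, Real.cos_sq_le_one s.im, Real.cosh_pos s.re]
    rw [mem_ball, dist_eq_norm, add_sub_cancel_left]
    simp only [norm_mul, norm_real, norm_I, mul_one, Real.norm_of_nonneg hh.le]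
    exact lt_of_le_of_lt (by gcongr) hcosh
  set g : ℂ → ℂ := fun s => f (c + h * I * cosh s) with hg
  obtain ⟨s₀, hs₀⟩ := Complex.cos_surjective ((z - c) / (h * I))
  have hhI : (h : ℂ) * I ≠ 0 := mul_ne_zero (by exact_mod_cast hh.ne') I_ne_zero
  obtain ⟨s, hs, hsre⟩ : ∃ s : ℂ, c + h * I * cosh s = z ∧ 0 ≤ s.re := by
    have h1 : cosh (s₀ * I) = (z - c) / (h * I) := by rw [Complex.cosh_mul_I, hs₀]
    rcases le_total 0 (s₀ * I).re with h | h
    · exact ⟨s₀ * I, by rw [h1, mul_div_cancel₀ _ hhI]; ring, h⟩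
    · exact ⟨-(s₀ * I), by rw [Complex.cosh_neg, h1, mul_div_cancel₀ _ hhI]; ring, by simpa using h⟩
  have hsx : s.re ≤ x := by
    have h1 := key s.re s.im
    rw [re_add_im] at h1
    have h2 : h * ‖cosh s‖ < r := by
      have := hz
      rw [mem_ball, dist_eq_norm, ← hs, add_sub_cancel_left] at this
      simpa [abs_of_pos hh] using this
    rw [hx, ← Real.sinh_le_sinh, Real.sinh_arsinh, le_div_iff₀ hh, mul_comm]
    refine le_trans ?_ h2.le
    gcongr
    refine (Real.abs_le_sqrt ?_).trans_eq (Real.sqrt_sq (norm_nonneg _)) |> le_of_abs_le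
    rw [h1]; nlinarith [sq_nonneg (Real.cos s.im)]
  have hdiff : DifferentiableOn ℂ g (re ⁻¹' Icc 0 σ) :=
    hf.comp (f := fun s => c + h * I * cosh s) (by fun_prop) fun s hs => hmaps s hs
  have := HadamardThreeLines.norm_le_interp_of_mem_verticalClosedStrip' (f := g) (z := s)
    (a := m) (b := M) hσ0 ⟨hsre, hsx.trans hxσ.le⟩
    (by
      refine DifferentiableOn.diffContOnCl ?_
      refine hdiff.mono ?_
      rw [HadamardThreeLines.verticalStrip]
      refine (closure_minimal (preimage_mono Ioo_subset_Icc_self)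
        (isClosed_Icc.preimage continuous_re)))
    ⟨M, by rintro _ ⟨s, hs, rfl⟩; exact hM _ (hmaps s hs)⟩
    (by
      intro s hs
      have hs0 : s.re = 0 := hs
      have e : cosh s = (Real.cos s.im : ℝ) := by
        rw [← re_add_im s, hs0]; simp [Complex.cosh_mul_I]
      have e2 : c + h * I * cosh s = c + ((h * Real.cos s.im : ℝ) : ℂ) * I := by
        rw [e]; push_cast; ring
      simp only [hg]
      rw [e2]
      refine hseg _ ⟨?_, ?_⟩ <;> nlinarith [Real.neg_one_le_cos s.im, Real.cos_le_one s.im])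
    (by
      intro s hs
      have hs0 : s.re = σ := hs
      exact hM _ (hmaps s ⟨by rw [hs0]; exact hσ0.le, hs0.le⟩))
  simp only [hg, hs, sub_zero] at this
  refine this.trans ?_
  have hle : s.re / σ ≤ x / σ := by gcongr
  rcases hm.eq_or_lt with rfl | hm0
  · rw [Real.zero_rpow, zero_mul]
    · positivity
    · have : x / σ < 1 := by rw [div_lt_one hσ0]; exact hxσ
      linarith
  · have hM1 : 0 < M := hm0.trans_le hmM
    rw [sub_sub_cancel, mul_comm]
    have e1 : m ^ (1 - s.re / σ) = m ^ (1 - x / σ) * m ^ (x / σ - s.re / σ) := by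
      rw [← Real.rpow_add hm0]; ring_nf
    have e2 : M ^ (x / σ) = M ^ (s.re / σ) * M ^ (x / σ - s.re / σ) := by
      rw [← Real.rpow_add hM1]; ring_nf
    rw [e1, e2]
    have : m ^ (x / σ - s.re / σ) ≤ M ^ (x / σ - s.re / σ) :=
      Real.rpow_le_rpow hm hmM (by linarith)
    calc M ^ (s.re / σ) * (m ^ (1 - x / σ) * m ^ (x / σ - s.re / σ))
        ≤ M ^ (s.re / σ) * (m ^ (1 - x / σ) * M ^ (x / σ - s.re / σ)) := by gcongr
      _ = _ := by ring

open Complex Metric Set in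
theorem norm_one_sub_le_of_norm_le_one {f : ℂ → ℂ} {c : ℂ} {R : ℝ} (hR : 0 < R)
    (hf : DifferentiableOn ℂ f (ball c R)) (hf1 : ∀ z ∈ ball c R, ‖f z‖ ≤ 1)
    {z : ℂ} (hz : dist z c ≤ R / 2) : ‖1 - f z‖ ≤ 3 * ‖1 - f c‖ := by
  have hmaps : ∀ w ∈ ball (0 : ℂ) R, w + c ∈ ball c R := by
    intro w hw
    rw [mem_ball, dist_eq_norm, add_sub_cancel_right]
    simpa using hw
  have hzn : ‖z - c‖ ≤ R / 2 := by rwa [← dist_eq_norm]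
  have hmain : ∀ M : ℝ, 0 < M → ‖1 - f z‖ ≤ 2 * M + 3 * ‖1 - f c‖ := by
    intro M hM
    have h := borelCaratheodory (f := fun w => f (w + c) - 1) (M := M) (R := R) (z := z - c) hM
      ((hf.comp (f := fun w => w + c) (by fun_prop) hmaps).sub_const 1)
      (by
        intro w hw
        have h1 := hf1 _ (hmaps w hw)
        have h2 := (re_le_norm (f (w + c))).trans h1
        change (f (w + c) - 1).re ≤ M; rw [sub_re, one_re]
        linarith) hR
      (by rw [mem_ball_zero_iff]; linarith)
    simp only [sub_add_cancel, zero_add] at h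
    rw [norm_sub_rev (f z), norm_sub_rev (f c)] at h
    refine h.trans ?_
    have hd : 0 < R - ‖z - c‖ := by linarith
    have e1 : 2 * M * ‖z - c‖ / (R - ‖z - c‖) ≤ 2 * M := by
      rw [div_le_iff₀ hd]; nlinarith
    have e2 : ‖1 - f c‖ * (R + ‖z - c‖) / (R - ‖z - c‖) ≤ 3 * ‖1 - f c‖ := by
      rw [div_le_iff₀ hd]; nlinarith [norm_nonneg (1 - f c)]
    linarith
  refine le_of_forall_pos_le_add fun ε hε => ?_
  have := hmain (ε / 2) (by positivity)
  linarith

open Complex Metric Set in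
theorem harnack_chain {Ω : Set ℂ} (hΩ : IsOpen Ω) (hc : IsPreconnected Ω) {l : ℂ} (hl : l ∈ Ω)
    {Q : Set ℂ} (hQ : IsCompact Q) (hQΩ : Q ⊆ Ω) :
    ∃ ρ > 0, ∃ B : ℝ, 0 ≤ B ∧ ∃ Q' : Set ℂ, IsCompact Q' ∧ Q' ⊆ Ω ∧
      ∀ f : ℂ → ℂ, Differentiable ℂ f → (∀ z ∈ Q', ‖f z‖ ≤ 1) →
        ∀ z₀ ∈ ball l ρ, ∀ z ∈ Q, ‖1 - f z‖ ≤ B * ‖1 - f z₀‖ := by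
  obtain ⟨R, hR, hRΩ⟩ := Metric.isOpen_iff.1 hΩ l hl
  set ρ := R / 6 with hρ
  have hρ0 : 0 < ρ := by positivity
  set P : Set ℂ → Prop := fun Z => ∃ B : ℝ, 0 ≤ B ∧ ∃ Q' : Set ℂ, IsCompact Q' ∧ Q' ⊆ Ω ∧
      ∀ f : ℂ → ℂ, Differentiable ℂ f → (∀ z ∈ Q', ‖f z‖ ≤ 1) →
        ∀ z₀ ∈ ball l ρ, ∀ z ∈ Z, ‖1 - f z‖ ≤ B * ‖1 - f z₀‖ with hP
  refine ⟨ρ, hρ0, ?_⟩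
  change P Q
  set G : Set ℂ := {z | ∃ r > 0, P (ball z r)} with hG
  have hmono : ∀ s t, s ⊆ t → P t → P s := by
    rintro s t hst ⟨B, hB, Q', h1, h2, h3⟩
    exact ⟨B, hB, Q', h1, h2, fun f hf hf1 z₀ hz₀ z hz => h3 f hf hf1 z₀ hz₀ z (hst hz)⟩
  have hGo : IsOpen G := by
    rw [Metric.isOpen_iff]
    rintro z ⟨r, hr, h⟩
    refine ⟨r / 2, by positivity, fun w hw => ⟨r / 2, by positivity, hmono _ _ ?_ h⟩⟩
    exact ball_subset_ball' (by rw [mem_ball] at hw; linarith)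
  have hlG : l ∈ G := by
    refine ⟨ρ, hρ0, 3, by norm_num, closedBall l (5 * ρ), isCompact_closedBall _ _,
      (closedBall_subset_ball (by linarith)).trans hRΩ, ?_⟩
    intro f hf hf1 z₀ hz₀ z hz
    rw [mem_ball] at hz hz₀
    refine norm_one_sub_le_of_norm_le_one (R := 4 * ρ) (by positivity) hf.differentiableOn
      (fun w hw => hf1 w ?_) ?_
    · rw [mem_ball] at hw; rw [mem_closedBall]
      linarith [dist_triangle w z₀ l]
    · linarith [dist_triangle z l z₀, dist_comm l z₀]
  have hsub : Ω ⊆ G := by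
    refine hc.subset_of_closure_inter_subset hGo ⟨l, hl, hlG⟩ ?_
    rintro z ⟨hzc, hzΩ⟩
    obtain ⟨r, hr, hrΩ⟩ := Metric.isOpen_iff.1 hΩ z hzΩ
    obtain ⟨w, ⟨r', hr', B, hB, Q', h1, h2, h3⟩, hw⟩ :=
      Metric.mem_closure_iff.1 hzc (r / 8) (by positivity)
    refine ⟨r / 8, by positivity, 3 * B, by positivity, Q' ∪ closedBall w (r / 2),
      h1.union (isCompact_closedBall _ _), union_subset h2 ?_, ?_⟩
    · refine (closedBall_subset_ball' ?_).trans hrΩ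
      rw [dist_comm]; linarith
    · intro f hf hf1 z₀ hz₀ y hy
      rw [mem_ball] at hy
      have e1 := h3 f hf (fun z hz => hf1 z (Or.inl hz)) z₀ hz₀ w (mem_ball_self hr')
      have e2 := norm_one_sub_le_of_norm_le_one (c := w) (z := y) (R := r / 2) (by positivity)
        hf.differentiableOn
        (fun x hx => hf1 x (Or.inr (ball_subset_closedBall hx)))
        (by linarith [dist_triangle y z w])
      linarith
  refine hQ.induction_on (p := P) ?_ hmono ?_ ?_
  · exact ⟨0, le_rfl, ∅, isCompact_empty, empty_subset _, by simp⟩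
  · rintro s t ⟨B, hB, Q', h1, h2, h3⟩ ⟨B', hB', Q'', h1', h2', h3'⟩
    refine ⟨B + B', by positivity, Q' ∪ Q'', h1.union h1', union_subset h2 h2', ?_⟩
    intro f hf hf1 z₀ hz₀ z hz
    have n0 := norm_nonneg (1 - f z₀)
    rcases hz with hz | hz
    · have := h3 f hf (fun z hz => hf1 z (Or.inl hz)) z₀ hz₀ z hz
      nlinarith
    · have := h3' f hf (fun z hz => hf1 z (Or.inr hz)) z₀ hz₀ z hz
      nlinarith
  · intro z hz
    obtain ⟨r, hr, h⟩ := hsub (hQΩ hz)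
    exact ⟨ball z r, mem_nhdsWithin_of_mem_nhds (ball_mem_nhds z hr), h⟩

end HullDim

namespace HullDim
open Polynomial

/-- The product of all differences `u i - u j` over ordered pairs `i ≠ j`. -/
noncomputable def disc {α : Type*} [Fintype α] (u : α → ℂ) : ℂ :=
  open Classical in ∏ i, ∏ j, if i = j then 1 else u i - u j

/-- The discriminant transform of the atomic measure `∑ κ l • δ (w l)` with weight `π`. -/
noncomputable def bigH (α : Type*) {ι : Type*} [Fintype α] [DecidableEq α] [Fintype ι]
    (w : ι → ℂ) (π : ℂ[X]) (κ : ι → ℂ) : ℂ :=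
  ∑ f : α → ι, disc (w ∘ f) * ∏ i, (π.eval (w (f i)) * κ (f i))

/-- Polynomial weights of degree at most `k` bounded by one on the disc of radius `1/2`. -/
def IsWeight (k : ℕ) (π : ℂ[X]) : Prop :=
  π.natDegree ≤ k ∧ ∀ w : ℂ, ‖w‖ ≤ 1 / 2 → ‖π.eval w‖ ≤ 1

theorem disc_comp_equiv {α β : Type*} [Fintype α] [Fintype β] (e : α ≃ β) (u : β → ℂ) :
    disc (u ∘ e) = disc u := by
  classical
  unfold disc
  rw [← e.prod_comp]
  refine Finset.prod_congr rfl fun i _ => ?_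
  rw [← e.prod_comp]
  refine Finset.prod_congr rfl fun j _ => ?_
  simp

theorem bigH_congr_equiv {α β ι : Type*} [Fintype α] [DecidableEq α] [Fintype β] [DecidableEq β]
    [Fintype ι] (e : α ≃ β) (w : ι → ℂ) (π : ℂ[X]) (κ : ι → ℂ) :
    bigH α w π κ = bigH β w π κ := by
  unfold bigH
  rw [← (e.arrowCongr (Equiv.refl ι)).sum_comp]
  refine Finset.sum_congr rfl fun f _ => ?_
  congr 1
  · rw [← disc_comp_equiv e]; congr 1; ext i; simp
  · rw [← e.prod_comp]; simp

theorem disc_sumElim {β γ : Type*} [Fintype β] [Fintype γ] (u : β → ℂ) (v : γ → ℂ) :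
    disc (Sum.elim u v) = disc v * (disc u * ∏ i, ∏ j, -(u i - v j) ^ 2) := by
  classical
  unfold disc
  simp only [Fintype.prod_sum_type, Sum.elim_inl, Sum.elim_inr, Sum.inl.injEq, Sum.inr.injEq,
    reduceCtorEq, if_false, Finset.prod_mul_distrib]
  have e1 : ∏ i, ∏ j, -(u i - v j) ^ 2 = (∏ i, ∏ j, (u i - v j)) * ∏ j, ∏ i, (v j - u i) := by
    rw [Finset.prod_comm (s := (Finset.univ : Finset γ)), ← Finset.prod_mul_distrib]
    refine Finset.prod_congr rfl fun i _ => ?_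
    rw [← Finset.prod_mul_distrib]
    refine Finset.prod_congr rfl fun j _ => ?_
    ring
  rw [e1]
  ring

theorem norm_disc_le_one {α : Type*} [Fintype α] {u : α → ℂ} (hu : ∀ i, ‖u i‖ ≤ 1 / 2) :
    ‖disc u‖ ≤ 1 := by
  classical
  unfold disc
  rw [norm_prod]
  refine Finset.prod_le_one (fun _ _ => norm_nonneg _) fun i _ => ?_
  rw [norm_prod]
  refine Finset.prod_le_one (fun _ _ => norm_nonneg _) fun j _ => ?_
  split_ifs
  · simp
  · exact (norm_sub_le _ _).trans (by linarith [hu i, hu j])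

theorem sum_prod_norm_eq {γ ι : Type*} [Fintype γ] [DecidableEq γ] [Fintype ι] (κ : ι → ℂ) :
    ∑ g : γ → ι, ∏ j, ‖κ (g j)‖ = (∑ l, ‖κ l‖) ^ Fintype.card γ := by
  have := Finset.prod_univ_sum (fun _ : γ => (Finset.univ : Finset ι)) (fun _ l => ‖κ l‖)
  rw [Fintype.piFinset_univ] at this
  rw [← this]; simp

theorem norm_bigH_le {α ι : Type*} [Fintype α] [DecidableEq α] [Fintype ι] {w : ι → ℂ}
    (hw : ∀ l, ‖w l‖ ≤ 1 / 2) {k : ℕ} {π : ℂ[X]} (hπ : IsWeight k π) (κ : ι → ℂ) :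
    ‖bigH α w π κ‖ ≤ (∑ l, ‖κ l‖) ^ Fintype.card α := by
  rw [← sum_prod_norm_eq]
  refine (norm_sum_le _ _).trans (Finset.sum_le_sum fun f _ => ?_)
  rw [norm_mul, norm_prod]
  refine (mul_le_of_le_one_left (by positivity) (norm_disc_le_one fun i => hw _)).trans ?_
  refine Finset.prod_le_prod (fun _ _ => norm_nonneg _) fun i _ => ?_
  rw [norm_mul]
  exact mul_le_of_le_one_left (norm_nonneg _) (hπ.2 _ (hw _))

theorem IsWeight.mono {k k' : ℕ} {π : ℂ[X]} (h : IsWeight k π) (hk : k ≤ k') : IsWeight k' π :=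
  ⟨h.1.trans hk, h.2⟩

theorem IsWeight.mul_prod {γ : Type*} [Fintype γ] {k : ℕ} {π : ℂ[X]} (h : IsWeight k π)
    {v : γ → ℂ} (hv : ∀ j, ‖v j‖ ≤ 1 / 2) :
    IsWeight (k + 2 * Fintype.card γ) (π * ∏ j, -(X - C (v j)) ^ 2) := by
  refine ⟨?_, fun w hw => ?_⟩
  · refine natDegree_mul_le.trans (add_le_add h.1 ?_)
    refine (natDegree_prod_le _ _).trans ?_
    refine (Finset.sum_le_card_nsmul _ _ 2 fun j _ => ?_).trans ?_
    · rw [natDegree_neg]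
      exact natDegree_pow_le.trans (by simp)
    · simp [mul_comm]
  · rw [eval_mul, norm_mul, eval_prod, norm_prod]
    refine mul_le_one₀ (h.2 w hw) (by positivity) ?_
    refine Finset.prod_le_one (fun _ _ => norm_nonneg _) fun j _ => ?_
    simp only [eval_neg, eval_pow, eval_sub, eval_X, eval_C, norm_neg, norm_pow]
    refine pow_le_one₀ (norm_nonneg _) ((norm_sub_le _ _).trans (by linarith [hv j]))

/-- Contribution to the discriminant transform of a fixed splitting of the index set. -/
theorem norm_mixed_le {β γ ι : Type*} [Fintype β] [DecidableEq β] [Fintype γ] [DecidableEq γ]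
    [Fintype ι] {w : ι → ℂ} (hw : ∀ l, ‖w l‖ ≤ 1 / 2) {k : ℕ} {π : ℂ[X]} (hπ : IsWeight k π)
    (κ₁ κ₂ : ι → ℂ) {B E : ℝ}
    (hB : ∀ π', IsWeight (k + 2 * Fintype.card γ) π' → ‖bigH β w π' κ₁‖ ≤ B)
    (hE : ∀ g : γ → ι, (∀ j, κ₂ (g j) ≠ 0) → ‖disc (w ∘ g)‖ ≤ E) :
    ‖∑ f : β ⊕ γ → ι, disc (w ∘ f) * ((∏ i, π.eval (w (f i))) *
      ((∏ i, κ₁ (f (Sum.inl i))) * ∏ j, κ₂ (f (Sum.inr j))))‖ ≤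
      E * (∑ l, ‖κ₂ l‖) ^ Fintype.card γ * B := by
  have e : ∑ f : β ⊕ γ → ι, disc (w ∘ f) * ((∏ i, π.eval (w (f i))) *
      ((∏ i, κ₁ (f (Sum.inl i))) * ∏ j, κ₂ (f (Sum.inr j)))) =
      ∑ g : γ → ι, (disc (w ∘ g) * ∏ j, (π.eval (w (g j)) * κ₂ (g j))) *
        bigH β w (π * ∏ j, -(X - C (w (g j))) ^ 2) κ₁ := by
    rw [← (Equiv.sumArrowEquivProdArrow β γ ι).symm.sum_comp, Fintype.sum_prod_type_right]
    refine Finset.sum_congr rfl fun g _ => ?_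
    unfold bigH
    rw [Finset.mul_sum]
    refine Finset.sum_congr rfl fun f _ => ?_
    have h1 : w ∘ ((Equiv.sumArrowEquivProdArrow β γ ι).symm (f, g)) =
        Sum.elim (w ∘ f) (w ∘ g) := by ext (i | j) <;> rfl
    rw [h1, disc_sumElim, Fintype.prod_sum_type]
    simp only [Equiv.sumArrowEquivProdArrow_symm_apply_inl,
      Equiv.sumArrowEquivProdArrow_symm_apply_inr, eval_mul, eval_prod, eval_neg, eval_pow,
      eval_sub, eval_X, eval_C, Finset.prod_mul_distrib, Function.comp]
    ring
  rw [e, ← sum_prod_norm_eq, Finset.mul_sum, Finset.sum_mul]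
  refine (norm_sum_le _ _).trans (Finset.sum_le_sum fun g _ => ?_)
  rw [norm_mul, norm_mul]
  by_cases hg : ∀ j, κ₂ (g j) ≠ 0
  · refine mul_le_mul (mul_le_mul (hE g hg) ?_ (norm_nonneg _)
      ((norm_nonneg _).trans (hE g hg))) (hB _ (hπ.mul_prod fun j => hw _)) (norm_nonneg _)
      (mul_nonneg ((norm_nonneg _).trans (hE g hg)) (by positivity))
    · rw [norm_prod]
      refine Finset.prod_le_prod (fun _ _ => norm_nonneg _) fun i _ => ?_
      rw [norm_mul]
      exact mul_le_of_le_one_left (norm_nonneg _) (hπ.2 _ (hw _))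
  · push Not at hg
    obtain ⟨j, hj⟩ := hg
    have e1 : ∏ j, (π.eval (w (g j)) * κ₂ (g j)) = 0 :=
      Finset.prod_eq_zero (Finset.mem_univ j) (by rw [hj, mul_zero])
    have e2 : ∏ j, ‖κ₂ (g j)‖ = 0 :=
      Finset.prod_eq_zero (Finset.mem_univ j) (by rw [hj, norm_zero])
    simp [e1, e2]

theorem bigH_add {α ι : Type*} [Fintype α] [DecidableEq α] [Fintype ι] (w : ι → ℂ) (π : ℂ[X])
    (κ₁ κ₂ : ι → ℂ) :
    bigH α w π (κ₁ + κ₂) = ∑ S : Finset α, ∑ f : {i // i ∈ S} ⊕ {i // i ∉ S} → ι,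
      disc (w ∘ f) * ((∏ i, π.eval (w (f i))) *
        ((∏ i, κ₁ (f (Sum.inl i))) * ∏ j, κ₂ (f (Sum.inr j)))) := by
  unfold bigH
  simp only [Finset.prod_mul_distrib, Pi.add_apply, Finset.prod_add, Finset.powerset_univ,
    Finset.mul_sum]
  rw [Finset.sum_comm]
  refine Finset.sum_congr rfl fun S _ => ?_
  rw [← ((Equiv.sumCompl (fun i => i ∈ S)).arrowCongr (Equiv.refl ι)).sum_comp]
  refine Finset.sum_congr rfl fun f _ => ?_
  set e := Equiv.sumCompl (fun i => i ∈ S)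
  have h0 : ∀ i, (e.arrowCongr (Equiv.refl ι)) f (e i) = f i := fun i => by simp
  congr 1
  · rw [← disc_comp_equiv e]; congr 1; ext i; simp
  · congr 1
    · rw [← e.prod_comp]; simp only [h0]
    · congr 1
      · rw [← Finset.prod_coe_sort S]
        exact Finset.prod_congr rfl fun i _ => by rw [← h0]; rfl
      · rw [← Finset.compl_eq_univ_sdiff, Finset.prod_subtype (p := fun i => i ∉ S) Sᶜ
          (fun i => Finset.mem_compl) (fun i => κ₂ ((e.arrowCongr (Equiv.refl ι)) f i))]
        exact Finset.prod_congr rfl fun i _ => by rw [← h0]; rfl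

theorem norm_disc_le_of_cluster {γ : Type*} [Fintype γ] {u : γ → ℂ} (hu : ∀ i, ‖u i‖ ≤ 1 / 2)
    {m : ℕ} (hm : 0 < m) (cl : γ → Fin m) {ε : ℝ} (hε0 : 0 < ε) (hε1 : ε ≤ 1)
    (hcl : ∀ i j, cl i = cl j → ‖u i - u j‖ ≤ ε) :
    ‖disc u‖ ≤ ε ^ ((Fintype.card γ : ℝ) ^ 2 / m - Fintype.card γ) := by
  classical
  set c : Fin m → ℕ := fun a => (Finset.univ.filter fun i => cl i = a).card with hc
  have hsum : ∑ a, c a = Fintype.card γ := by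
    rw [← Finset.card_univ, Finset.card_eq_sum_card_fiberwise (f := cl) (t := Finset.univ)]
    simp
  have hcs : ((Fintype.card γ : ℝ)) ^ 2 ≤ m * ∑ a, (c a : ℝ) ^ 2 := by
    have := sq_sum_le_card_mul_sum_sq (s := (Finset.univ : Finset (Fin m))) (f := fun a => (c a : ℝ))
    rw [← hsum]; push_cast; simpa using this
  have h1 : ‖disc u‖ ≤ ∏ i : γ, ∏ j : γ, if cl i = cl j ∧ i ≠ j then ε else 1 := by
    unfold disc
    rw [norm_prod]
    refine Finset.prod_le_prod (fun _ _ => norm_nonneg _) fun i _ => ?_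
    rw [norm_prod]
    refine Finset.prod_le_prod (fun _ _ => norm_nonneg _) fun j _ => ?_
    have := (norm_sub_le (u i) (u j)).trans (by linarith [hu i, hu j] : _ ≤ (1 : ℝ))
    split_ifs with h h' h' <;> simp_all
  have h2 : ∏ i : γ, ∏ j : γ, (if cl i = cl j ∧ i ≠ j then ε else 1) =
      ε ^ (∑ i : γ, (Finset.univ.filter fun j => cl i = cl j ∧ i ≠ j).card) := by
    rw [← Finset.prod_pow_eq_pow_sum]
    refine Finset.prod_congr rfl fun i _ => ?_
    rw [Finset.prod_ite]; simp
  have h3 : ∀ i, (Finset.univ.filter fun j => cl i = cl j ∧ i ≠ j).card + 1 = c (cl i) := by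
    intro i
    rw [hc]
    dsimp only
    rw [← Finset.card_erase_add_one (a := i) (s := Finset.univ.filter fun j => cl j = cl i)
      (by simp)]
    congr 2
    ext j; simp [eq_comm, and_comm]
  have h4 : ∑ i, c (cl i) = ∑ a, c a ^ 2 := by
    rw [← Finset.sum_fiberwise (s := Finset.univ) (g := cl)]
    refine Finset.sum_congr rfl fun a _ => ?_
    rw [Finset.sum_congr rfl (g := fun _ => c a) (by simp +contextual)]
    simp [hc, sq]
  have h5 : (∑ i : γ, (Finset.univ.filter fun j => cl i = cl j ∧ i ≠ j).card) + Fintype.card γ =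
      ∑ a, c a ^ 2 := by
    rw [← h4, ← Finset.card_univ, Finset.card_eq_sum_ones, ← Finset.sum_add_distrib]
    exact Finset.sum_congr rfl fun i _ => h3 i
  refine h1.trans ?_
  rw [h2, ← Real.rpow_natCast]
  refine Real.rpow_le_rpow_of_exponent_ge hε0 hε1 ?_
  have h6 : ((∑ i : γ, (Finset.univ.filter fun j => cl i = cl j ∧ i ≠ j).card : ℕ) : ℝ) +
    Fintype.card γ = ∑ a, (c a : ℝ) ^ 2 := by exact_mod_cast h5
  have : ((Fintype.card γ : ℝ)) ^ 2 / m ≤ ∑ a, (c a : ℝ) ^ 2 := by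
    rw [div_le_iff₀ (by exact_mod_cast hm)]; linarith
  linarith

/-- Splitting estimate: a decaying part plus a part supported in few small clusters. -/
theorem norm_bigH_add_le {n : ℕ} {ι : Type*} [Fintype ι] {w : ι → ℂ} (hw : ∀ l, ‖w l‖ ≤ 1 / 2)
    {k : ℕ} {π : ℂ[X]} (hπ : IsWeight k π) (κ₁ κ₂ : ι → ℂ) {T : ℝ} (hT : 1 ≤ T)
    (h₁ : ∑ l, ‖κ₁ l‖ ≤ T) (h₂ : ∑ l, ‖κ₂ l‖ ≤ T) {m : ℕ} (hm : 0 < m) (cl : ι → Fin m)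
    {ε : ℝ} (hε0 : 0 < ε) (hε1 : ε ≤ 1)
    (hcl : ∀ l l', κ₂ l ≠ 0 → κ₂ l' ≠ 0 → cl l = cl l' → ‖w l - w l'‖ ≤ ε) {δ : ℝ} (hδ : 0 ≤ δ)
    (hB : ∀ j, n ≤ 2 * j → j ≤ n → ∀ π', IsWeight (k + 2 * n) π' →
      ‖bigH (Fin j) w π' κ₁‖ ≤ δ) :
    ‖bigH (Fin n) w π (κ₁ + κ₂)‖ ≤
      (2 * T) ^ n * max δ (ε ^ ((n : ℝ) ^ 2 / (4 * m) - n)) := by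
  have hT0 : 0 ≤ T := by linarith
  rw [bigH_add]
  have hmR : (0 : ℝ) < m := by exact_mod_cast hm
  have key : ∀ S : Finset (Fin n), ‖∑ f : {i // i ∈ S} ⊕ {i // i ∉ S} → ι,
      disc (w ∘ f) * ((∏ i, π.eval (w (f i))) *
        ((∏ i, κ₁ (f (Sum.inl i))) * ∏ j, κ₂ (f (Sum.inr j))))‖ ≤
      T ^ n * max δ (ε ^ ((n : ℝ) ^ 2 / (4 * m) - n)) := by
    intro S
    have c1 : Fintype.card {i // i ∈ S} = S.card := by simp
    have c2 : Fintype.card {i // i ∉ S} = n - S.card := by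
      rw [Fintype.card_subtype_compl]; simp
    have hSn : S.card ≤ n := by simpa using S.card_le_univ
    rcases le_or_gt n (2 * S.card) with h | h
    · refine (norm_mixed_le hw hπ κ₁ κ₂ (B := δ) (E := 1) (fun π' hπ' => ?_)
        (fun g _ => norm_disc_le_one fun i => hw _)).trans ?_
      · rw [bigH_congr_equiv (Fintype.equivFinOfCardEq c1)]
        refine hB _ h hSn _ (hπ'.mono ?_)
        rw [c2]; omega
      · rw [one_mul]
        refine mul_le_mul ?_ (le_max_left _ _) hδ (by positivity)
        rw [c2]
        exact (pow_le_pow_left₀ (by positivity) h₂ _).trans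
          (pow_le_pow_right₀ hT (Nat.sub_le _ _))
    · refine (norm_mixed_le hw hπ κ₁ κ₂ (B := T ^ S.card)
        (E := ε ^ ((n : ℝ) ^ 2 / (4 * m) - n)) (fun π' hπ' => ?_)
        (fun g hg => ?_)).trans ?_
      · refine (norm_bigH_le hw hπ' κ₁).trans ?_
        rw [c1]
        exact pow_le_pow_left₀ (by positivity) h₁ _
      · refine (norm_disc_le_of_cluster (fun i => hw (g i)) hm (cl ∘ g) hε0 hε1
          (fun i j hij => hcl _ _ (hg i) (hg j) hij)).trans ?_
        refine Real.rpow_le_rpow_of_exponent_ge hε0 hε1 ?_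
        rw [c2]
        have hk : (n : ℝ) / 2 ≤ ((n - S.card : ℕ) : ℝ) := by
          rw [Nat.cast_sub hSn]
          have : (2 * S.card : ℝ) < n := by exact_mod_cast h
          linarith
        have hk2 : ((n - S.card : ℕ) : ℝ) ≤ n := by exact_mod_cast Nat.sub_le _ _
        have : (n : ℝ) ^ 2 / (4 * m) ≤ ((n - S.card : ℕ) : ℝ) ^ 2 / m := by
          rw [div_le_div_iff₀ (by positivity) hmR]
          have : (n : ℝ) ^ 2 ≤ 4 * ((n - S.card : ℕ) : ℝ) ^ 2 := by
            nlinarith [(Nat.cast_nonneg n : (0 : ℝ) ≤ n)]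
          nlinarith
        linarith
      · rw [mul_assoc, mul_comm]
        refine mul_le_mul ?_ (le_max_right _ _) (by positivity) (by positivity)
        rw [c2]
        calc (∑ l, ‖κ₂ l‖) ^ (n - S.card) * T ^ S.card ≤ T ^ (n - S.card) * T ^ S.card := by
              gcongr
          _ = T ^ n := by rw [← pow_add]; congr 1; omega
  refine (norm_sum_le _ _).trans ((Finset.sum_le_card_nsmul _ _ _ fun S _ => key S).trans ?_)
  rw [nsmul_eq_mul, mul_pow, mul_assoc]
  simp

end HullDim

namespace HullDim
open Polynomial Metric

theorem norm_bigH_succ_le {n : ℕ} {ι : Type*} [Fintype ι] {w : ι → ℂ} (hw : ∀ l, ‖w l‖ ≤ 1 / 2)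
    {k : ℕ} {π : ℂ[X]} (hπ : IsWeight k π) (κ : ι → ℂ) {B : ℝ}
    (hB : ∀ π', IsWeight (k + 2 * n) π' → ‖∑ l, π'.eval (w l) * κ l‖ ≤ B) :
    ‖bigH (Fin (n + 1)) w π κ‖ ≤ (∑ l, ‖κ l‖) ^ n * B := by
  have e : Fin (n + 1) ≃ Unit ⊕ Fin n := Fintype.equivOfCardEq (by simp [add_comm])
  rw [bigH_congr_equiv e]
  have h := norm_mixed_le (β := Unit) (γ := Fin n) hw hπ κ κ (B := B) (E := 1)
    (fun π' hπ' => by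
      rw [Fintype.card_fin] at hπ'
      refine le_trans (le_of_eq ?_) (hB π' hπ')
      unfold bigH
      rw [← (Equiv.funUnique Unit ι).symm.sum_comp]
      simp [disc])
    (fun g _ => norm_disc_le_one fun i => hw _)
  simp only [one_mul, Fintype.card_fin] at h
  refine le_trans (le_of_eq ?_) h
  unfold bigH
  congr 1
  refine Finset.sum_congr rfl fun f _ => ?_
  rw [Finset.prod_mul_distrib, Fintype.prod_sum_type (fun i => κ (f i))]

/-- Finite atomic data `∑ b l • δ (z l, w l)` in `ℂ × ℂ`. -/
structure Data where
  k : ℕ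
  b : Fin k → ℂ
  z : Fin k → ℂ
  w : Fin k → ℂ

/-- `d` is carried by `G`, has mass at most one and annihilates monomials of degree `≤ n ^ 3`. -/
def Data.IsRep (d : Data) (G : Set (ℂ × ℂ)) (n : ℕ) : Prop :=
  (∀ l, (d.z l, d.w l) ∈ G) ∧ ∑ l, ‖d.b l‖ ≤ 1 ∧
    ∀ i ≤ n ^ 3, ∀ j ≤ n ^ 3, ∑ l, d.b l * d.z l ^ i * d.w l ^ j = 0

theorem Data.IsRep.mono {d : Data} {G : Set (ℂ × ℂ)} {n n' : ℕ} (h : d.IsRep G n) (hn : n' ≤ n) :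
    d.IsRep G n' :=
  ⟨h.1, h.2.1, fun i hi j hj => h.2.2 i (hi.trans (Nat.pow_le_pow_left hn 3)) j
    (hj.trans (Nat.pow_le_pow_left hn 3))⟩

/-- Super-exponential decay of the discriminant transforms of the kernels `κ d z` on `Q`. -/
def Decay (G : Set (ℂ × ℂ)) (κ : (d : Data) → ℂ → Fin d.k → ℂ) (Q : Set ℂ) (A : ℝ) (K : ℕ) :
    Prop :=
  ∃ n₀ : ℕ, ∀ n ≥ n₀, ∀ d : Data, d.IsRep G n → ∀ π, IsWeight (K * n) π → ∀ z ∈ Q,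
    ‖bigH (Fin n) d.w π (κ d z)‖ ≤ Real.exp (-A * n ^ 2)

/-- Cauchy kernels of the data. -/
noncomputable def cau (d : Data) (z : ℂ) (l : Fin d.k) : ℂ := d.b l / (d.z l - z)

open Classical in
/-- The part of the Cauchy kernel with poles near `ζ`. -/
noncomputable def near (ζ : ℂ) (r : ℝ) (d : Data) (z : ℂ) (l : Fin d.k) : ℂ :=
  if ‖d.z l - ζ‖ < r then cau d z l else 0

open Classical in
/-- The part of the Cauchy kernel with poles away from `ζ`. -/
noncomputable def far (ζ : ℂ) (r : ℝ) (d : Data) (z : ℂ) (l : Fin d.k) : ℂ :=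
  if ‖d.z l - ζ‖ < r then 0 else cau d z l

variable {G : Set (ℂ × ℂ)} {κ κ₁ κ₂ : (d : Data) → ℂ → Fin d.k → ℂ} {Q Q' : Set ℂ} {A : ℝ} {K : ℕ}

theorem Decay.mono (h : Decay G κ Q A K) (hQ : Q' ⊆ Q) : Decay G κ Q' A K := by
  obtain ⟨n₀, h⟩ := h
  exact ⟨n₀, fun n hn d hd π hπ z hz => h n hn d hd π hπ z (hQ hz)⟩

theorem Decay.union (h : Decay G κ Q A K) (h' : Decay G κ Q' A K) : Decay G κ (Q ∪ Q') A K := by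
  obtain ⟨n₀, h⟩ := h
  obtain ⟨n₁, h'⟩ := h'
  refine ⟨max n₀ n₁, fun n hn d hd π hπ z hz => ?_⟩
  rcases hz with hz | hz
  · exact h n (le_of_max_le_left hn) d hd π hπ z hz
  · exact h' n (le_of_max_le_right hn) d hd π hπ z hz

theorem decay_add {m : ℕ} (hm : 0 < m) (A : ℝ) (K : ℕ) :
    ∃ A' : ℝ, 0 < A' ∧ ∀ (G : Set (ℂ × ℂ)) (κ₁ κ₂ : (d : Data) → ℂ → Fin d.k → ℂ) (Q : Set ℂ)
      (T ε : ℝ), (∀ p ∈ G, ‖p.2‖ ≤ 1 / 2) → 1 ≤ T → 0 < ε → ε ≤ Real.exp (-A') →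
      (∀ n d, Data.IsRep d G n → ∀ z ∈ Q, ∑ l, ‖κ₁ d z l‖ ≤ T ∧ ∑ l, ‖κ₂ d z l‖ ≤ T ∧
        ∃ cl : Fin d.k → Fin m, ∀ l l', κ₂ d z l ≠ 0 → κ₂ d z l' ≠ 0 → cl l = cl l' →
          ‖d.w l - d.w l'‖ ≤ ε) →
      Decay G κ₁ Q A' (2 * K + 4) → Decay G (fun d z => κ₁ d z + κ₂ d z) Q A K := by
  have hmR : (1 : ℝ) ≤ m := by exact_mod_cast hm
  refine ⟨8 * m * (|A| + 1), by positivity, ?_⟩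
  set A' := 8 * m * (|A| + 1) with hA'
  intro G κ₁ κ₂ Q T ε hG hT hε hεA hb ⟨n₀, h⟩
  have hA'0 : 0 < A' := by positivity
  refine ⟨max (2 * n₀) (max (8 * m) ⌈Real.log (2 * T)⌉₊), fun n hn d hd π hπ z hz => ?_⟩
  have hn0 : 2 * n₀ ≤ n := le_of_max_le_left hn
  have hn1 : 8 * m ≤ n := le_of_max_le_left (le_of_max_le_right hn)
  have hn2 : Real.log (2 * T) ≤ n :=
    (Nat.le_ceil _).trans (by exact_mod_cast le_of_max_le_right (le_of_max_le_right hn))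
  have hn1R : 8 * (m : ℝ) ≤ n := by exact_mod_cast hn1
  have hnR : (0 : ℝ) ≤ n := Nat.cast_nonneg n
  obtain ⟨b1, b2, cl, hcl⟩ := hb n d hd z hz
  have main := norm_bigH_add_le (n := n) (fun l => hG _ (hd.1 l)) hπ (κ₁ d z) (κ₂ d z) hT b1 b2 hm
    cl hε (hεA.trans (Real.exp_le_one_iff.2 (by linarith))) hcl
    (δ := Real.exp (-A' * (n / 2) ^ 2)) (Real.exp_pos _).le (by
      intro j hj hjn π' hπ'
      refine (h j (by omega) d (hd.mono hjn) π' (hπ'.mono ?_) z hz).trans ?_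
      · nlinarith
      · refine Real.exp_le_exp.2 ?_
        have : (n : ℝ) / 2 ≤ j := by
          have : (n : ℝ) ≤ 2 * j := by exact_mod_cast hj
          linarith
        have : ((n : ℝ) / 2) ^ 2 ≤ (j : ℝ) ^ 2 := by gcongr
        nlinarith)
  refine main.trans ?_
  have hA2 : 8 * (|A| + 1) ≤ A' := by
    rw [hA']; nlinarith [abs_nonneg A]
  have e1 : max (Real.exp (-A' * (n / 2) ^ 2)) (ε ^ ((n : ℝ) ^ 2 / (4 * m) - n)) ≤
      Real.exp (-(|A| + 1) * n ^ 2) := by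
    refine max_le (Real.exp_le_exp.2 ?_) ?_
    · nlinarith [sq_nonneg (n : ℝ)]
    · have hexp : (n : ℝ) ^ 2 / (8 * m) ≤ (n : ℝ) ^ 2 / (4 * m) - n := by
        have : (n : ℝ) ^ 2 / (4 * m) = 2 * ((n : ℝ) ^ 2 / (8 * m)) := by field_simp; ring
        rw [this]
        have : (n : ℝ) ≤ (n : ℝ) ^ 2 / (8 * m) := by
          rw [le_div_iff₀ (by positivity)]; nlinarith
        linarith
      calc ε ^ ((n : ℝ) ^ 2 / (4 * m) - n) ≤ Real.exp (-A') ^ ((n : ℝ) ^ 2 / (4 * m) - n) := by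
            refine Real.rpow_le_rpow hε.le hεA (le_trans (by positivity) hexp)
        _ = Real.exp (-A' * ((n : ℝ) ^ 2 / (4 * m) - n)) := by rw [← Real.exp_mul]
        _ ≤ _ := by
            refine Real.exp_le_exp.2 ?_
            have : A' * ((n : ℝ) ^ 2 / (8 * m)) = (|A| + 1) * n ^ 2 := by
              rw [hA']; field_simp
            nlinarith
  have e2 : (2 * T) ^ n ≤ Real.exp ((n : ℝ) ^ 2) := by
    rw [← Real.exp_log (show 0 < 2 * T by linarith), ← Real.exp_nat_mul]
    refine Real.exp_le_exp.2 ?_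
    nlinarith
  calc (2 * T) ^ n * max (Real.exp (-A' * (n / 2) ^ 2)) (ε ^ ((n : ℝ) ^ 2 / (4 * m) - n))
      ≤ Real.exp ((n : ℝ) ^ 2) * Real.exp (-(|A| + 1) * n ^ 2) := by gcongr
    _ = Real.exp (-|A| * n ^ 2) := by rw [← Real.exp_add]; congr 1; ring
    _ ≤ _ := Real.exp_le_exp.2 (by nlinarith [le_abs_self A, sq_nonneg (n : ℝ)])

theorem decay_transfer {h r R : ℝ} (hh : 0 < h) (hr : 0 < r) (hR : 0 < R)
    (hRr : h ^ 2 + r ^ 2 < R ^ 2) :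
    ∃ θ : ℝ, 0 < θ ∧ ∀ (G : Set (ℂ × ℂ)) (κ : (d : Data) → ℂ → Fin d.k → ℂ) (c : ℂ)
      (s T A : ℝ) (K : ℕ), (∀ p ∈ G, ‖p.2‖ ≤ 1 / 2) → 0 < s → 1 ≤ T →
      (∀ n d, Data.IsRep d G n → (∀ l, DifferentiableOn ℂ (fun z => κ d z l) (ball c (s * R))) ∧
        ∀ z ∈ ball c (s * R), ∑ l, ‖κ d z l‖ ≤ T) →
      Decay G κ ((fun y : ℝ => c + y * Complex.I) '' Set.Icc (-(s * h)) (s * h)) ((|A| + 1) / θ) K →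
      Decay G κ (ball c (s * r)) A K := by
  obtain ⟨θ, hθ, hθ1, H⟩ := two_constants hh hr hR hRr
  refine ⟨θ, hθ, ?_⟩
  intro G κ c s T A K hG hs hT hκ ⟨n₀, hd⟩
  refine ⟨max n₀ ⌈Real.log T⌉₊, fun n hn d hdr π hπ z hz => ?_⟩
  have hn2 : Real.log T ≤ n :=
    (Nat.le_ceil _).trans (by exact_mod_cast le_of_max_le_right hn)
  have hT0 : 0 < T := by linarith
  have hnR : (0 : ℝ) ≤ n := Nat.cast_nonneg n
  obtain ⟨k1, k2⟩ := hκ n d hdr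
  have hmaps : ∀ u ∈ ball (0 : ℂ) R, c + s * u ∈ ball c (s * R) := by
    intro u hu
    rw [mem_ball, dist_eq_norm, add_sub_cancel_left, norm_mul, Complex.norm_real,
      Real.norm_of_nonneg hs.le]
    rw [mem_ball_zero_iff] at hu
    gcongr
  have hTn : (1 : ℝ) ≤ T ^ n := one_le_pow₀ hT
  have main := H (fun u => bigH (Fin n) d.w π (κ d (c + s * u))) 0 (T ^ n)
    (Real.exp (-((|A| + 1) / θ) * n ^ 2))
    (by
      unfold bigH
      refine DifferentiableOn.fun_sum fun f _ => DifferentiableOn.const_mul ?_ _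
      refine DifferentiableOn.fun_finsetProd fun i _ => DifferentiableOn.const_mul ?_ _
      exact (k1 (f i)).comp (f := fun u => c + s * u) (by fun_prop) hmaps)
    (fun u hu => by
      refine (norm_bigH_le (fun l => hG _ (hdr.1 l)) hπ _).trans ?_
      rw [Fintype.card_fin]
      exact pow_le_pow_left₀ (by positivity) (k2 _ (hmaps u hu)) _)
    (Real.exp_pos _).le
    (le_trans (Real.exp_le_one_iff.2 (by
      have : 0 ≤ (|A| + 1) / θ * (n : ℝ) ^ 2 := by positivity
      linarith)) hTn)
    (fun y hy => hd n (le_of_max_le_left hn) d hdr π hπ _ ⟨s * y, ⟨by nlinarith [hy.1],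
      by nlinarith [hy.2]⟩, by push_cast; ring⟩)
    ((z - c) / s) (by
      rw [mem_ball_zero_iff, norm_div, Complex.norm_real, Real.norm_of_nonneg hs.le,
        div_lt_iff₀ hs, mul_comm, ← dist_eq_norm]
      exact hz)
  have hs' : (s : ℂ) ≠ 0 := by exact_mod_cast hs.ne'
  rw [mul_div_cancel₀ _ hs', add_sub_cancel] at main
  refine main.trans ?_
  have e1 : (T ^ n) ^ (1 - θ) ≤ Real.exp ((n : ℝ) ^ 2) := by
    calc (T ^ n) ^ (1 - θ) ≤ (T ^ n) ^ (1 : ℝ) :=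
          Real.rpow_le_rpow_of_exponent_le hTn (by linarith)
      _ = T ^ n := Real.rpow_one _
      _ ≤ _ := by
        rw [← Real.exp_log hT0, ← Real.exp_nat_mul]
        exact Real.exp_le_exp.2 (by nlinarith)
  calc (T ^ n) ^ (1 - θ) * Real.exp (-((|A| + 1) / θ) * n ^ 2) ^ θ
      ≤ Real.exp ((n : ℝ) ^ 2) * Real.exp (-((|A| + 1) / θ) * n ^ 2) ^ θ := by gcongr
    _ = Real.exp (-|A| * n ^ 2) := by
      rw [← Real.exp_mul, ← Real.exp_add]
      congr 1
      field_simp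
      ring
    _ ≤ _ := Real.exp_le_exp.2 (by nlinarith [le_abs_self A, sq_nonneg (n : ℝ)])

end HullDim

namespace HullDim
open Polynomial Metric

variable {G : Set (ℂ × ℂ)}

theorem Data.IsRep.sum_eval_eq_zero {d : Data} {n i : ℕ} (h : d.IsRep G n) (hi : i ≤ n ^ 3)
    {π : ℂ[X]} (hπ : π.natDegree ≤ n ^ 3) :
    ∑ l, d.b l * d.z l ^ i * π.eval (d.w l) = 0 := by
  simp_rw [Polynomial.eval_eq_sum_range, Finset.mul_sum]
  rw [Finset.sum_comm]
  refine Finset.sum_eq_zero fun j hj => ?_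
  have := h.2.2 i hi j (by have := Finset.mem_range.1 hj; omega)
  calc _ = π.coeff j * ∑ l, d.b l * d.z l ^ i * d.w l ^ j := by
        rw [Finset.mul_sum]; exact Finset.sum_congr rfl fun l _ => by ring
    _ = 0 := by rw [this, mul_zero]

theorem cauchy_kernel_eq {a z : ℂ} (hz : z ≠ 0) (ha : a ≠ z) (M : ℕ) :
    1 / (a - z) = (a / z) ^ (M + 1) / (a - z) - ∑ i ∈ Finset.range (M + 1), a ^ i / z ^ (i + 1) := by
  have h1 : a - z ≠ 0 := sub_ne_zero.2 ha
  have h2 : a / z ≠ 1 := by rw [Ne, div_eq_one_iff_eq hz]; exact ha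
  have h3 : ∑ i ∈ Finset.range (M + 1), a ^ i / z ^ (i + 1) =
      (∑ i ∈ Finset.range (M + 1), (a / z) ^ i) / z := by
    rw [Finset.sum_div]
    exact Finset.sum_congr rfl fun i _ => by rw [div_pow, pow_succ, div_div]
  rw [h3, geom_sum_eq h2]
  have : a / z - 1 = (a - z) / z := by field_simp
  rw [this]
  field_simp
  ring

theorem decay_base (hG : ∀ p ∈ G, ‖p.1‖ ≤ 1 / 2 ∧ ‖p.2‖ ≤ 1 / 2) (A : ℝ) (K : ℕ) :
    Decay G cau {z | 1 ≤ ‖z‖} A K := by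
  refine ⟨max (K + 2) (⌈2 * A⌉₊ + 1), fun n hn d hd π hπ z hz => ?_⟩
  have hn1 : K + 2 ≤ n := le_of_max_le_left hn
  have hn2 : ⌈2 * A⌉₊ + 1 ≤ n := le_of_max_le_right hn
  have hA : 2 * A ≤ n - 1 := by
    have : ((⌈2 * A⌉₊ + 1 : ℕ) : ℝ) ≤ n := by exact_mod_cast hn2
    push_cast at this
    linarith [Nat.le_ceil (2 * A)]
  obtain ⟨n', rfl⟩ : ∃ n', n = n' + 1 := ⟨n - 1, by omega⟩
  have hz1 : 1 ≤ ‖z‖ := hz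
  have hz0 : z ≠ 0 := by rintro rfl; simp at hz1; linarith
  have hdist : ∀ l, 1 / 2 ≤ ‖d.z l - z‖ := fun l => by
    have := norm_sub_norm_le z (d.z l)
    rw [norm_sub_rev] at this
    linarith [(hG _ (hd.1 l)).1]
  have hne : ∀ l, d.z l ≠ z := fun l h => by
    have := hdist l; simp [h] at this; linarith
  have hw : ∀ l, ‖d.w l‖ ≤ 1 / 2 := fun l => (hG _ (hd.1 l)).2
  set M := (n' + 1) ^ 3 with hM
  have hdeg : K * (n' + 1) + 2 * n' ≤ M := by
    have : (K + 2) * (n' + 1) ≤ (n' + 1) * (n' + 1) := Nat.mul_le_mul_right _ hn1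
    have h3 : M = (n' + 1) * (n' + 1) * (n' + 1) := by rw [hM]; ring
    nlinarith
  have hterm : ∀ l, ‖cau d z l‖ ≤ 2 * ‖d.b l‖ := fun l => by
    rw [cau, norm_div, div_le_iff₀ (by linarith [hdist l])]
    nlinarith [hdist l, norm_nonneg (d.b l)]
  have hs : ∑ l, ‖cau d z l‖ ≤ 2 := by
    calc _ ≤ ∑ l, 2 * ‖d.b l‖ := Finset.sum_le_sum fun l _ => hterm l
      _ = 2 * ∑ l, ‖d.b l‖ := by rw [Finset.mul_sum]
      _ ≤ 2 := by linarith [hd.2.1]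
  have key := norm_bigH_succ_le (n := n') hw hπ (cau d z) (B := 2 * (1 / 2) ^ (M + 1)) (by
    intro π' hπ'
    have e : ∑ l, π'.eval (d.w l) * cau d z l =
        ∑ l, π'.eval (d.w l) * (cau d z l * (d.z l / z) ^ (M + 1)) := by
      have h0 : ∀ i ∈ Finset.range (M + 1),
          ∑ l, d.b l * d.z l ^ i * π'.eval (d.w l) = 0 := fun i hi =>
        hd.sum_eval_eq_zero (by have := Finset.mem_range.1 hi; omega) (hπ'.1.trans hdeg)
      have h1 : ∀ l, π'.eval (d.w l) * cau d z l =
          π'.eval (d.w l) * (cau d z l * (d.z l / z) ^ (M + 1)) -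
          ∑ i ∈ Finset.range (M + 1), (d.b l * d.z l ^ i * π'.eval (d.w l)) / z ^ (i + 1) := by
        intro l
        have : cau d z l = d.b l * (1 / (d.z l - z)) := by rw [cau]; ring
        have e3 : ∑ i ∈ Finset.range (M + 1),
            (d.b l * d.z l ^ i * π'.eval (d.w l)) / z ^ (i + 1) =
            d.b l * π'.eval (d.w l) * ∑ i ∈ Finset.range (M + 1), d.z l ^ i / z ^ (i + 1) := by
          rw [Finset.mul_sum]
          exact Finset.sum_congr rfl fun i _ => by ring
        rw [e3]
        calc π'.eval (d.w l) * cau d z l = d.b l * π'.eval (d.w l) * (1 / (d.z l - z)) := by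
              rw [this]; ring
          _ = _ := by
              rw [cauchy_kernel_eq hz0 (hne l) M, this]; ring
      rw [Finset.sum_congr rfl fun l _ => h1 l, Finset.sum_sub_distrib, Finset.sum_comm]
      simp_rw [← Finset.sum_div]
      rw [Finset.sum_eq_zero (s := Finset.range (M + 1)) (fun i hi => by rw [h0 i hi, zero_div]),
        sub_zero]
    rw [e]
    calc _ ≤ ∑ l, 2 * ‖d.b l‖ * (1 / 2) ^ (M + 1) := by
          refine norm_sum_le_of_le _ fun l _ => ?_
          rw [norm_mul, norm_mul, norm_pow]
          have h1 := hπ'.2 _ (hw l)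
          have h2 : ‖d.z l / z‖ ≤ 1 / 2 := by
            rw [norm_div, div_le_iff₀ (by linarith)]
            linarith [(hG _ (hd.1 l)).1]
          calc _ ≤ 1 * (2 * ‖d.b l‖ * (1 / 2) ^ (M + 1)) := by
                gcongr
                exact hterm l
            _ = _ := one_mul _
      _ = (2 * ∑ l, ‖d.b l‖) * (1 / 2) ^ (M + 1) := by rw [Finset.mul_sum, Finset.sum_mul]
      _ ≤ 2 * (1 / 2) ^ (M + 1) := by
          gcongr; linarith [hd.2.1])
  refine key.trans ?_
  have hl := Real.log_two_gt_d9
  calc (∑ l, ‖cau d z l‖) ^ n' * (2 * (1 / 2) ^ (M + 1)) ≤ 2 ^ n' * (2 * (1 / 2) ^ (M + 1)) := by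
        gcongr
    _ = 2 ^ n' * (1 / 2) ^ M := by ring
    _ = Real.exp (Real.log 2 * n' - Real.log 2 * M) := by
        rw [Real.exp_sub, mul_comm _ (n' : ℝ), mul_comm _ (M : ℝ), Real.exp_nat_mul,
          Real.exp_nat_mul, Real.exp_log (by norm_num)]
        simp [div_eq_mul_inv]
    _ ≤ _ := by
        refine Real.exp_le_exp.2 ?_
        have e1 : (M : ℝ) = ((n' + 1 : ℕ) : ℝ) ^ 3 := by rw [hM]; push_cast; ring
        have e2 : (n' : ℝ) = ((n' + 1 : ℕ) : ℝ) - 1 := by push_cast; ring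
        set x : ℝ := ((n' + 1 : ℕ) : ℝ)
        have hx : 1 ≤ x := by
          have : (0 : ℝ) ≤ n' := Nat.cast_nonneg _
          linarith
        rw [e1, e2]
        have hp : 0 ≤ x ^ 3 - (x - 1) := by nlinarith [sq_nonneg (x - 1), sq_nonneg x]
        have h1 : (1 / 2) * (x ^ 3 - (x - 1)) ≤ Real.log 2 * (x ^ 3 - (x - 1)) := by
          gcongr; linarith
        have h2 : A * x ^ 2 ≤ (x - 1) / 2 * x ^ 2 := by gcongr; linarith
        nlinarith

end HullDim

namespace HullDim
open Polynomial Metric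

variable {G : Set (ℂ × ℂ)}

/-- Points off the projection of `G` near which the Cauchy kernels decay at every rate. -/
def good (G : Set (ℂ × ℂ)) : Set ℂ :=
  {z | z ∉ Prod.fst '' G ∧ ∃ ρ > 0, ∀ A K, Decay G cau (ball z ρ) A K}

theorem sum_norm_cau_le {d : Data} {n : ℕ} (hd : d.IsRep G n) {z : ℂ} {δ : ℝ} (hδ : 0 < δ)
    (hz : ∀ p ∈ G, δ ≤ ‖p.1 - z‖) : ∑ l, ‖cau d z l‖ ≤ 1 / δ := by
  calc ∑ l, ‖cau d z l‖ ≤ ∑ l, ‖d.b l‖ * (1 / δ) := by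
        refine Finset.sum_le_sum fun l _ => ?_
        have := hz _ (hd.1 l)
        rw [cau, norm_div, div_eq_mul_one_div]
        gcongr
    _ = (∑ l, ‖d.b l‖) * (1 / δ) := by rw [Finset.sum_mul]
    _ ≤ 1 * (1 / δ) := by gcongr; exact hd.2.1
    _ = _ := one_mul _

theorem differentiableOn_cau {d : Data} {n : ℕ} (hd : d.IsRep G n) {U : Set ℂ}
    (hU : ∀ p ∈ G, p.1 ∉ U) (l : Fin d.k) : DifferentiableOn ℂ (fun z => cau d z l) U := by
  unfold cau
  refine DifferentiableOn.div (by fun_prop) (by fun_prop) fun z hz h => ?_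
  exact hU _ (hd.1 l) (by rwa [sub_eq_zero.1 h])

theorem exists_sum_norm_cau_le (hGc : IsCompact G) {Q : Set ℂ} (hQ : IsCompact Q)
    (hQG : Disjoint Q (Prod.fst '' G)) :
    ∃ T : ℝ, 1 ≤ T ∧ ∀ n d, Data.IsRep d G n → ∀ z ∈ Q, ∑ l, ‖cau d z l‖ ≤ T := by
  obtain ⟨δ, hδ, h⟩ := Metric.exists_pos_forall_lt_edist hQ
    (hGc.image continuous_fst).isClosed hQG
  refine ⟨max 1 (1 / δ), le_max_left _ _, fun n d hd z hz => ?_⟩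
  refine (sum_norm_cau_le hd (z := z) (δ := δ) (by exact_mod_cast hδ) fun p hp => ?_).trans
    (le_max_right _ _)
  have h1 := h z hz p.1 ⟨p, hp, rfl⟩
  rw [edist_nndist, ENNReal.coe_lt_coe] at h1
  rw [← dist_eq_norm, dist_comm]
  exact_mod_cast h1.le

theorem isOpen_good (hGc : IsCompact G) : IsOpen (good G) := by
  have hC : IsOpen (Prod.fst '' G)ᶜ := (hGc.image continuous_fst).isClosed.isOpen_compl
  rw [Metric.isOpen_iff]
  rintro z ⟨hz, ρ, hρ, h⟩
  obtain ⟨ε, hε, hb⟩ := Metric.isOpen_iff.1 hC z hz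
  refine ⟨min ε (ρ / 2), by positivity, fun z' hz' => ⟨hb (ball_subset_ball (min_le_left _ _) hz'),
    ρ / 2, by positivity, fun A K => (h A K).mono ?_⟩⟩
  refine ball_subset_ball' ?_
  have := mem_ball.1 (ball_subset_ball (min_le_right _ _) hz')
  linarith

theorem decay_of_subset_good {Q : Set ℂ} (hQ : IsCompact Q)
    (hQg : Q ⊆ good G) (A : ℝ) (K : ℕ) : Decay G cau Q A K := by
  refine hQ.induction_on (p := fun Q => Decay G cau Q A K) ⟨0, by simp⟩
    (fun s t hst h => h.mono hst) (fun s t h h' => h.union h') fun z hz => ?_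
  obtain ⟨-, ρ, hρ, h⟩ := hQg hz
  exact ⟨ball z ρ, mem_nhdsWithin_of_mem_nhds (ball_mem_nhds _ hρ), h A K⟩

theorem subset_good_of_isPreconnected (hGc : IsCompact G) (hG : ∀ p ∈ G, ‖p.2‖ ≤ 1 / 2)
    {S : Set ℂ} (hS : IsPreconnected S) (hSG : Disjoint S (Prod.fst '' G))
    (hne : (S ∩ good G).Nonempty) : S ⊆ good G := by
  refine hS.subset_of_closure_inter_subset (isOpen_good hGc) hne ?_
  rintro z ⟨hz, hzS⟩
  have hC : IsOpen (Prod.fst '' G)ᶜ := (hGc.image continuous_fst).isClosed.isOpen_compl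
  have hzC : z ∉ Prod.fst '' G := fun h => Set.disjoint_left.1 hSG hzS h
  obtain ⟨R, hR, hb⟩ := Metric.isOpen_iff.1 hC z hzC
  obtain ⟨c, ⟨hcC, ρ, hρ, hc⟩, hzc⟩ := Metric.mem_closure_iff.1 hz (R / 8) (by positivity)
  refine ⟨hzC, R / 8, by positivity, fun A K => ?_⟩
  have hh1 : min (ρ / 2) (R / 8) ≤ R / 8 := min_le_right _ _
  have hh0 : 0 < min (ρ / 2) (R / 8) := by positivity
  obtain ⟨θ, hθ, H⟩ := decay_transfer (h := min (ρ / 2) (R / 8)) (r := R / 4) (R := R / 2)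
    hh0 (by positivity) (by positivity) (by nlinarith)
  have hfar : ∀ p ∈ G, ∀ u ∈ ball c (R / 2), 3 * R / 8 ≤ ‖p.1 - u‖ := by
    intro p hp u hu
    by_contra! hlt
    refine hb (a := p.1) ?_ ⟨p, hp, rfl⟩
    rw [mem_ball] at hu ⊢
    have h1 := dist_triangle4 p.1 u c z
    rw [← dist_eq_norm] at hlt
    rw [dist_comm z c] at hzc
    linarith
  refine (H G cau c 1 (max 1 (1 / (3 * R / 8))) A K hG one_pos (le_max_left _ _) ?_ ?_).mono ?_
  · intro n d hd
    rw [one_mul]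
    refine ⟨fun l => differentiableOn_cau hd (fun p hp hu => ?_) l, fun u hu =>
      (sum_norm_cau_le hd (by positivity) fun p hp => hfar p hp u hu).trans (le_max_right _ _)⟩
    have := hfar p hp _ hu
    simp at this
    linarith
  · refine (hc _ _).mono ?_
    rintro _ ⟨y, hy, rfl⟩
    rw [one_mul] at hy
    rw [mem_ball, dist_eq_norm, add_sub_cancel_left, norm_mul, Complex.norm_real, Complex.norm_I,
      mul_one, Real.norm_eq_abs]
    have : |y| ≤ min (ρ / 2) (R / 8) := abs_le.2 hy
    linarith [min_le_left (ρ / 2) (R / 8)]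
  · refine ball_subset_ball' ?_
    linarith

/-- If the fibre of `G` over `ζ` is finite and the vertical segment above `ζ` is good, then the
kernels decay at a prescribed rate in a full punctured neighbourhood of `ζ`. -/
theorem exists_decay_near (hGc : IsCompact G) (hG : ∀ p ∈ G, ‖p.2‖ ≤ 1 / 2) {ζ : ℂ}
    (hζ : ζ ∈ Prod.fst '' G) (hfin : {w | (ζ, w) ∈ G}.Finite) {h₀ : ℝ} (hh₀ : 0 < h₀)
    (hseg : ∀ y ∈ Set.Ioc 0 h₀, ζ + (y : ℂ) * Complex.I ∈ good G) (A : ℝ) (K : ℕ) :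
    ∃ r > 0, ∀ Q, IsCompact Q → Q ⊆ ball ζ r → Disjoint Q (Prod.fst '' G) → Decay G cau Q A K := by
  classical
  set F := hfin.toFinset with hF
  have hmemF : ∀ w, w ∈ F ↔ (ζ, w) ∈ G := by simp [hF]
  have hm : 0 < F.card := by
    obtain ⟨⟨a, b⟩, hp, rfl⟩ := hζ
    exact Finset.card_pos.2 ⟨b, (hmemF _).2 hp⟩
  obtain ⟨θ, hθ, H⟩ := decay_transfer (h := 1 / 32) (r := 1 / 8) (R := 13 / 32)
    (by norm_num) (by norm_num) (by norm_num) (by norm_num)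
  obtain ⟨A₂, hA₂, H₂⟩ := decay_add hm A K
  set A₃ := (|A₂| + 1) / θ with hA₃
  obtain ⟨A₁, hA₁, H₁⟩ := decay_add hm A₃ (2 * K + 4)
  set ε := Real.exp (-max A₁ A₂) with hε
  have hε0 : 0 < ε := Real.exp_pos _
  have hεA₁ : ε ≤ Real.exp (-A₁) := Real.exp_le_exp.2 (neg_le_neg (le_max_left _ _))
  have hεA₂ : ε ≤ Real.exp (-A₂) := Real.exp_le_exp.2 (neg_le_neg (le_max_right _ _))
  obtain ⟨r₀, hr₀, hclust⟩ : ∃ r₀ > 0, ∀ p ∈ G, ‖p.1 - ζ‖ < r₀ → ∃ v ∈ F, ‖p.2 - v‖ < ε / 2 := by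
    have hB : IsCompact {p ∈ G | ∀ v ∈ F, ε / 2 ≤ ‖p.2 - v‖} := by
      refine hGc.inter_right ?_
      have : {p : ℂ × ℂ | ∀ v ∈ F, ε / 2 ≤ ‖p.2 - v‖} =
          ⋂ v ∈ F, {p : ℂ × ℂ | ε / 2 ≤ ‖p.2 - v‖} := by ext; simp
      change IsClosed {p : ℂ × ℂ | ∀ v ∈ F, ε / 2 ≤ ‖p.2 - v‖}
      rw [this]
      exact isClosed_biInter fun v _ => isClosed_le (by fun_prop) (by fun_prop)
    obtain ⟨r₀, hr₀, h⟩ := hB.exists_forall_le' (f := fun p : ℂ × ℂ => ‖p.1 - ζ‖) (a := 0)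
      (by fun_prop) (by
        rintro p ⟨hp, hv⟩
        refine norm_pos_iff.2 (sub_ne_zero.2 fun h => ?_)
        have := hv p.2 ((hmemF _).2 (by rw [← h]; exact hp))
        simp at this
        linarith)
    refine ⟨r₀, hr₀, fun p hp hlt => ?_⟩
    by_contra! hc
    exact absurd (h p ⟨hp, hc⟩) (not_le.2 hlt)
  set r := min r₀ (8 * h₀) with hr
  have hr0 : 0 < r := by positivity
  have hcl : ∀ n d, Data.IsRep d G n → ∀ z, ∃ cl : Fin d.k → Fin F.card, ∀ l l',
      near ζ r d z l ≠ 0 → near ζ r d z l' ≠ 0 → cl l = cl l' → ‖d.w l - d.w l'‖ ≤ ε := by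
    intro n d hd z
    have : ∀ l, ∃ i : Fin F.card, near ζ r d z l ≠ 0 → ‖d.w l - (F.equivFin.symm i : ℂ)‖ < ε / 2 := by
      intro l
      by_cases h : near ζ r d z l = 0
      · exact ⟨⟨0, hm⟩, fun h' => absurd h h'⟩
      · have h1 : ‖d.z l - ζ‖ < r := by
          by_contra h2
          exact h (by rw [near, if_neg h2])
        obtain ⟨v, hv, hlt⟩ := hclust _ (hd.1 l) (h1.trans_le (min_le_left _ _))
        exact ⟨F.equivFin ⟨v, hv⟩, fun _ => by simpa using hlt⟩
    choose cl hcl using this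
    refine ⟨cl, fun l l' h h' heq => ?_⟩
    have h1 := hcl l h
    have h2 := hcl l' h'
    rw [heq] at h1
    have := norm_sub_le_norm_sub_add_norm_sub (d.w l) (F.equivFin.symm (cl l') : ℂ) (d.w l')
    rw [norm_sub_rev (F.equivFin.symm (cl l') : ℂ)] at this
    linarith
  have hnear : ∀ d z l, ‖near ζ r d z l‖ ≤ ‖cau d z l‖ := by
    intro d z l; unfold near; split_ifs <;> simp
  have hfar : ∀ d z l, ‖far ζ r d z l‖ ≤ ‖cau d z l‖ := by
    intro d z l; unfold far; split_ifs <;> simp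
  have hsplit : ∀ d z, far ζ r d z + near ζ r d z = cau d z := by
    intro d z; ext l; unfold far near; simp only [Pi.add_apply]; split_ifs <;> simp
  set c : ℂ := ζ + ((3 * r / 32 : ℝ) : ℂ) * Complex.I with hc
  set I : Set ℂ := (fun y : ℝ => c + y * Complex.I) '' Set.Icc (-(r * (1 / 32))) (r * (1 / 32))
    with hI
  have hIc : IsCompact I := isCompact_Icc.image (by fun_prop)
  have hIg : I ⊆ good G := by
    rintro _ ⟨y, hy, rfl⟩
    have := hseg (3 * r / 32 + y) ⟨by linarith [hy.1], by
      linarith [hy.2, min_le_right r₀ (8 * h₀)]⟩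
    simp only [hc]
    convert this using 1
    push_cast; ring
  have hIfar : Decay G (far ζ r) I A₃ (2 * K + 4) := by
    obtain ⟨T, hT, hTb⟩ := exists_sum_norm_cau_le hGc hIc
      (Set.disjoint_left.2 fun z hz => (hIg hz).1)
    have h1 := H₁ G cau (fun d z => -near ζ r d z) I T ε hG hT hε0 hεA₁ (by
      intro n d hd z hz
      refine ⟨hTb n d hd z hz, ?_, ?_⟩
      · refine le_trans (Finset.sum_le_sum fun l _ => ?_) (hTb n d hd z hz)
        rw [Pi.neg_apply, norm_neg]; exact hnear d z l
      · obtain ⟨cl, h⟩ := hcl n d hd z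
        exact ⟨cl, fun l l' hl hl' => h l l' (by simpa using hl) (by simpa using hl')⟩)
      (decay_of_subset_good hIc hIg _ _)
    have e : (fun d z => cau d z + -near ζ r d z) = far ζ r := by
      funext d z; rw [← hsplit d z]; abel
    rwa [e] at h1
  have hcζ : dist c ζ = 3 * r / 32 := by
    rw [hc, dist_eq_norm, add_sub_cancel_left, norm_mul, Complex.norm_real, Complex.norm_I,
      mul_one, Real.norm_of_nonneg (by positivity)]
  have hball : ball c (r * (13 / 32)) ⊆ ball ζ (r / 2) := ball_subset_ball' (by linarith)
  have hpole : ∀ u ∈ ball ζ (r / 2), ∀ x : ℂ, ¬ ‖x - ζ‖ < r → r / 2 ≤ ‖x - u‖ := by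
    intro u hu x hx
    rw [mem_ball, dist_eq_norm] at hu
    have := norm_sub_le_norm_sub_add_norm_sub x u ζ
    linarith
  have hfarb : Decay G (far ζ r) (ball c (r * (1 / 8))) A₂ (2 * K + 4) := by
    refine H G (far ζ r) c r (max 1 (1 / (r / 2))) A₂ (2 * K + 4) hG hr0 (le_max_left _ _) ?_ hIfar
    intro n d hd
    refine ⟨fun l => ?_, fun u hu => ?_⟩
    · unfold far
      split_ifs with h
      · fun_prop
      · unfold cau
        refine DifferentiableOn.div (by fun_prop) (by fun_prop) fun u hu h0 => ?_
        have := hpole u (hball hu) _ h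
        rw [h0, norm_zero] at this
        linarith
    · refine le_trans ?_ (le_max_right _ _)
      calc ∑ l, ‖far ζ r d u l‖ ≤ ∑ l, ‖d.b l‖ * (1 / (r / 2)) := by
            refine Finset.sum_le_sum fun l _ => ?_
            unfold far
            split_ifs with h
            · simp; positivity
            · have := hpole u (hball hu) _ h
              rw [cau, norm_div, div_eq_mul_one_div]
              gcongr
        _ = (∑ l, ‖d.b l‖) * (1 / (r / 2)) := by rw [Finset.sum_mul]
        _ ≤ 1 * (1 / (r / 2)) := by gcongr; exact hd.2.1
        _ = _ := one_mul _
  refine ⟨r / 32, by positivity, fun Q hQ hQb hQC => ?_⟩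
  obtain ⟨T, hT, hTb⟩ := exists_sum_norm_cau_le hGc hQ hQC
  have h2 := H₂ G (far ζ r) (near ζ r) Q T ε hG hT hε0 hεA₂
    (fun n d hd z hz => ⟨le_trans (Finset.sum_le_sum fun l _ => hfar d z l) (hTb n d hd z hz),
      le_trans (Finset.sum_le_sum fun l _ => hnear d z l) (hTb n d hd z hz), hcl n d hd z⟩)
    (hfarb.mono (hQb.trans (ball_subset_ball' (by rw [dist_comm]; linarith))))
  have e : (fun d z => far ζ r d z + near ζ r d z) = cau := by
    funext d z; exact hsplit d z
  rwa [e] at h2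

end HullDim

namespace HullDim
open Polynomial Metric

section RungeLog
variable {J : Set ℂ}

theorem mem_of_hasSum_pow [CompactSpace J] {S : Subalgebra ℂ C(J, ℂ)} (hS : IsClosed (S : Set C(J, ℂ)))
    {u v : C(J, ℂ)} (hu : u ∈ S) {c : ℕ → ℂ} (h : HasSum (fun n => c n • u ^ n) v) : v ∈ S :=
  hS.mem_of_tendsto h (Filter.Eventually.of_forall fun _ =>
    S.sum_mem fun n _ => S.smul_mem (S.pow_mem hu n) _)

theorem exists_exp_mem [CompactSpace J] {S : Subalgebra ℂ C(J, ℂ)} (hS : IsClosed (S : Set C(J, ℂ)))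
    {u : C(J, ℂ)} (hu : u ∈ S) : ∃ v ∈ S, ∀ z, v z = Complex.exp (u z) := by
  have h := NormedSpace.exp_series_hasSum_exp' (𝕂 := ℂ) u
  refine ⟨_, mem_of_hasSum_pow hS hu h, fun z => ?_⟩
  have h2 := ContinuousMap.hasSum_apply h z
  have h3 := NormedSpace.exp_series_hasSum_exp' (𝕂 := ℂ) (u z)
  rw [← Complex.exp_eq_exp_ℂ] at h3
  exact h2.unique h3

theorem exists_log_one_sub_mem [CompactSpace J] {S : Subalgebra ℂ C(J, ℂ)}
    (hS : IsClosed (S : Set C(J, ℂ))) {u : C(J, ℂ)} (hu : u ∈ S) (hu1 : ‖u‖ < 1) :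
    ∃ v ∈ S, ∀ z, Complex.exp (v z) = 1 - u z := by
  have hs : Summable fun n : ℕ => ((1 : ℂ) / n) • u ^ n := by
    refine Summable.of_norm_bounded (g := fun n : ℕ => ‖u‖ ^ n)
      (summable_geometric_of_lt_one (norm_nonneg _) hu1) fun n => ?_
    rw [norm_smul]
    have h1 : ‖(1 : ℂ) / n‖ ≤ 1 := by
      rcases Nat.eq_zero_or_pos n with rfl | hn
      · simp
      · rw [norm_div, norm_one, Complex.norm_natCast]
        exact (div_le_one (by exact_mod_cast hn)).2 (by exact_mod_cast hn)
    have h2 : ‖u ^ n‖ ≤ ‖u‖ ^ n := by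
      rcases Nat.eq_zero_or_pos n with rfl | hn
      · rw [pow_zero, pow_zero, ContinuousMap.norm_le _ zero_le_one]; simp
      · exact norm_pow_le' _ hn
    calc _ ≤ 1 * ‖u‖ ^ n := by gcongr
      _ = _ := one_mul _
  obtain ⟨v, h⟩ := hs
  refine ⟨-v, S.neg_mem (mem_of_hasSum_pow hS hu h), fun z => ?_⟩
  have h2 := ContinuousMap.hasSum_apply h z
  have hz : ‖u z‖ < 1 := (u.norm_coe_le_norm z).trans_lt hu1
  have h3 := Complex.hasSum_taylorSeries_neg_log hz
  have : v z = -Complex.log (1 - u z) := by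
    refine h2.unique ?_
    convert h3 using 1
    funext n
    simp [div_eq_inv_mul]
  rw [ContinuousMap.neg_apply, this, neg_neg, Complex.exp_log]
  intro h0
  rw [← sub_eq_zero.1 h0] at hz
  simp at hz

theorem exists_re_eval_near_log (hJ : IsCompact J) (hJne : J.Nonempty) (hJc : IsPreconnected Jᶜ)
    {a : ℂ} (ha : a ∉ J) {ε : ℝ} (hε : 0 < ε) :
    ∃ h : ℂ[X], ∀ z ∈ J, |Real.log ‖z - a‖ - (h.eval z).re| ≤ ε := by
  have : CompactSpace J := isCompact_iff_compactSpace.1 hJ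
  have : Nonempty J := hJne.to_subtype
  set S := (polynomialFunctions J).topologicalClosure with hSdef
  have hS : IsClosed (S : Set C(J, ℂ)) := Subalgebra.isClosed_topologicalClosure _
  set O : Set ℂ := {a | ∃ h ∈ S, ∀ z : J, Complex.exp (h z) = z - a} with hO
  have hstep : ∀ a₀ ∈ O, ∀ d > 0, (∀ z ∈ J, d ≤ ‖z - a₀‖) → ball a₀ (d / 2) ⊆ O := by
    rintro a₀ ⟨h, hS', hh⟩ d hd hdist a ha
    obtain ⟨v, hv, hvz⟩ := exists_exp_mem hS (S.neg_mem hS')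
    have hvz' : ∀ z : J, v z = 1 / (z - a₀) := fun z => by
      rw [hvz, ContinuousMap.neg_apply, Complex.exp_neg, hh, one_div]
    have hu : ‖(a - a₀) • v‖ < 1 := by
      refine lt_of_le_of_lt (b := 1 / 2) ?_ (by norm_num)
      rw [ContinuousMap.norm_le _ (by norm_num)]
      intro z
      rw [ContinuousMap.smul_apply, hvz', smul_eq_mul, norm_mul, norm_div, norm_one]
      have h1 := hdist z z.2
      rw [mem_ball, dist_eq_norm] at ha
      rw [mul_one_div, div_le_iff₀ (by linarith)]
      linarith
    obtain ⟨g, hg, hgz⟩ := exists_log_one_sub_mem hS (S.smul_mem hv (a - a₀)) hu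
    refine ⟨h + g, S.add_mem hS' hg, fun z => ?_⟩
    have h1 : (z : ℂ) - a₀ ≠ 0 := by
      have := hdist z z.2
      intro h0
      rw [h0, norm_zero] at this
      linarith
    rw [ContinuousMap.add_apply, Complex.exp_add, hh, hgz, ContinuousMap.smul_apply, hvz',
      smul_eq_mul]
    field_simp
    ring
  have hOJ : ∀ a ∈ O, a ∉ J := by
    rintro a ⟨h, -, hh⟩ haJ
    have := hh ⟨a, haJ⟩
    simp at this
  have hdist : ∀ a, a ∉ J → ∃ d > 0, ∀ z ∈ J, d ≤ ‖z - a‖ := fun a ha =>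
    ⟨infDist a J, (hJ.isClosed.notMem_iff_infDist_pos hJne).1 ha, fun z hz => by
      rw [← dist_eq_norm, dist_comm]; exact infDist_le_dist_of_mem hz⟩
  have hOo : IsOpen O := by
    rw [Metric.isOpen_iff]
    intro a ha
    obtain ⟨d, hd, h⟩ := hdist a (hOJ a ha)
    exact ⟨d / 2, by positivity, hstep a ha d hd h⟩
  obtain ⟨R, hR, hJR⟩ := hJ.isBounded.exists_pos_norm_le
  have hX : (ContinuousMap.restrict J (ContinuousMap.id ℂ)) ∈ S := by
    refine Subalgebra.le_topologicalClosure _ ?_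
    refine ⟨X, by simp, ?_⟩
    ext z
    simp
  have hlarge : ((2 * R : ℝ) : ℂ) ∈ O := by
    have hR0 : (R : ℂ) ≠ 0 := by exact_mod_cast hR.ne'
    obtain ⟨g, hg, hgz⟩ := exists_log_one_sub_mem hS (S.smul_mem hX ((2 * R : ℝ) : ℂ)⁻¹) (by
      refine lt_of_le_of_lt (b := 1 / 2) ?_ (by norm_num)
      rw [ContinuousMap.norm_le _ (by norm_num)]
      intro z
      rw [ContinuousMap.smul_apply, smul_eq_mul, norm_mul, norm_inv, Complex.norm_real,
        Real.norm_of_nonneg (by positivity), inv_mul_le_iff₀ (by positivity)]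
      have := hJR z z.2
      simpa using this.trans (by linarith))
    refine ⟨algebraMap ℂ _ (Complex.log (-((2 * R : ℝ) : ℂ))) + g,
      S.add_mem (S.algebraMap_mem _) hg, fun z => ?_⟩
    rw [ContinuousMap.add_apply, Complex.exp_add, hgz, ContinuousMap.smul_apply,
      _root_.algebraMap_apply, smul_eq_mul, smul_eq_mul, mul_one, Complex.exp_log]
    · simp
      field_simp
      ring
    · simpa using hR0
  have hsub : Jᶜ ⊆ O := by
    refine hJc.subset_of_closure_inter_subset hOo ⟨_, hOJ _ hlarge, hlarge⟩ ?_
    rintro a ⟨hacl, haJ⟩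
    obtain ⟨d, hd, h⟩ := hdist a haJ
    obtain ⟨a₀, ha₀, hlt⟩ := Metric.mem_closure_iff.1 hacl (d / 3) (by positivity)
    refine hstep a₀ ha₀ (2 * d / 3) (by positivity) (fun z hz => ?_) (by rw [mem_ball]; linarith)
    have h1 := h z hz
    have h2 := norm_sub_le_norm_sub_add_norm_sub z a₀ a
    rw [dist_comm, dist_eq_norm] at hlt
    linarith
  obtain ⟨h, hh, hhz⟩ := hsub ha
  have hh' : h ∈ closure (polynomialFunctions J : Set C(J, ℂ)) := hh
  obtain ⟨p, hp, hpd⟩ := Metric.mem_closure_iff.1 hh' ε hε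
  obtain ⟨q, -, rfl⟩ := hp
  refine ⟨q, fun z hz => ?_⟩
  have h1 : Real.log ‖z - a‖ = (h ⟨z, hz⟩).re := by
    rw [← hhz ⟨z, hz⟩, Complex.norm_exp, Real.log_exp]
  have h2 := (ContinuousMap.dist_apply_le_dist (f := h) (g := _) ⟨z, hz⟩).trans hpd.le
  rw [h1, ← Complex.sub_re]
  refine (Complex.abs_re_le_norm _).trans ?_
  rw [dist_eq_norm] at h2
  simpa using h2

end RungeLog

end HullDim

namespace HullDim
open Polynomial Metric

variable {J : Set ℂ} {c : ℂ}

/-- Boundedness of a real function on a set. -/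
def BddOn (Y : Set ℂ) (u : ℂ → ℝ) : Prop := ∃ M : ℝ, ∀ z ∈ Y, |u z| ≤ M

/-- Values at `c` of the real parts of polynomials that dominate `u` on the boundary of `J`. -/
def majorants (J : Set ℂ) (c : ℂ) (u : ℂ → ℝ) : Set ℝ :=
  {x | ∃ g : ℂ[X], (∀ z ∈ frontier J, u z ≤ (g.eval z).re) ∧ (g.eval c).re = x}

theorem le_re_eval_of_forall_frontier (hJ : IsCompact J) (hc : c ∈ interior J) (g : ℂ[X]) {m : ℝ}
    (h : ∀ z ∈ frontier J, m ≤ (g.eval z).re) : m ≤ (g.eval c).re := by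
  have key := Complex.norm_le_of_forall_mem_frontier_norm_le (U := interior J)
    (f := fun z => Complex.exp (-g.eval z)) (C := Real.exp (-m))
    (hJ.isBounded.subset interior_subset)
    (Differentiable.diffContOnCl (by fun_prop))
    (fun z hz => by
      rw [Complex.norm_exp, Complex.neg_re]
      exact Real.exp_le_exp.2 (neg_le_neg (h z (frontier_interior_subset hz))))
    (subset_closure hc)
  rw [Complex.norm_exp, Complex.neg_re, Real.exp_le_exp] at key
  linarith

theorem majorants_nonempty {u : ℂ → ℝ} (hu : BddOn (frontier J) u) : (majorants J c u).Nonempty := by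
  obtain ⟨M, hM⟩ := hu
  exact ⟨_, C (M : ℂ), fun z hz => by simpa using (le_abs_self _).trans (hM z hz), rfl⟩

theorem bddBelow_majorants (hJ : IsCompact J) (hc : c ∈ interior J) {u : ℂ → ℝ} (hu : BddOn (frontier J) u) :
    BddBelow (majorants J c u) := by
  obtain ⟨M, hM⟩ := hu
  refine ⟨-M, ?_⟩
  rintro _ ⟨g, hg, rfl⟩
  exact le_re_eval_of_forall_frontier hJ hc g fun z hz =>
    (neg_le_of_abs_le (hM z hz)).trans (hg z hz)

theorem exists_representing_functional (hJ : IsCompact J) (hc : c ∈ interior J) {χ : ℂ → ℝ}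
    (hχ : BddOn (frontier J) χ) :
    ∃ Λ : (ℂ → ℝ) →ₗ[ℝ] ℝ, (∀ u v, BddOn (frontier J) u → BddOn (frontier J) v →
        (∀ z ∈ frontier J, u z ≤ v z) → Λ u ≤ Λ v) ∧
      (∀ g : ℂ[X], Λ (fun z => (g.eval z).re) = (g.eval c).re) ∧
      Λ χ = sInf (majorants J c χ) := by
  let E : Submodule ℝ (ℂ → ℝ) :=
    { carrier := {u | BddOn (frontier J) u}
      add_mem' := by
        rintro u v ⟨M, hM⟩ ⟨N, hN⟩
        exact ⟨M + N, fun z hz => (abs_add_le _ _).trans (add_le_add (hM z hz) (hN z hz))⟩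
      zero_mem' := ⟨0, by simp⟩
      smul_mem' := by
        rintro a u ⟨M, hM⟩
        refine ⟨|a| * M, fun z hz => ?_⟩
        rw [Pi.smul_apply, smul_eq_mul, abs_mul]
        exact mul_le_mul_of_nonneg_left (hM z hz) (abs_nonneg _) }
  let N : E → ℝ := fun u => sInf (majorants J c u)
  have hbdd : ∀ g : ℂ[X], BddOn (frontier J) fun z => (g.eval z).re := by
    intro g
    have hY : IsCompact (frontier J) := hJ.of_isClosed_subset isClosed_frontier
      hJ.isClosed.frontier_subset
    obtain ⟨M, hM⟩ := hY.exists_bound_of_continuousOn (f := fun z => (g.eval z).re) (by fun_prop)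
    exact ⟨M, hM⟩
  have hNle : ∀ (u : E) (g : ℂ[X]), (∀ z ∈ frontier J, (u : ℂ → ℝ) z ≤ (g.eval z).re) →
      N u ≤ (g.eval c).re := fun u g hg =>
    csInf_le (bddBelow_majorants hJ hc u.2) ⟨g, hg, rfl⟩
  have hleN : ∀ (u : E) (m : ℝ), (∀ g : ℂ[X], (∀ z ∈ frontier J, (u : ℂ → ℝ) z ≤ (g.eval z).re) →
      m ≤ (g.eval c).re) → m ≤ N u := fun u m h =>
    le_csInf (majorants_nonempty u.2) (by rintro _ ⟨g, hg, rfl⟩; exact h g hg)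
  have hNhom1 : ∀ a : ℝ, 0 < a → ∀ u : E, a * N u ≤ N (a • u) := by
    intro a ha u
    refine hleN _ _ fun g hg => ?_
    have h1 := hNle u (C ((a⁻¹ : ℝ) : ℂ) * g) (fun z hz => by
      have := hg z hz
      rw [eval_mul, eval_C, Complex.re_ofReal_mul, le_inv_mul_iff₀ ha]
      exact this)
    rw [eval_mul, eval_C, Complex.re_ofReal_mul, le_inv_mul_iff₀ ha] at h1
    exact h1
  have hNhom : ∀ a : ℝ, 0 < a → ∀ u : E, N (a • u) = a * N u := by
    intro a ha u
    refine le_antisymm ?_ (hNhom1 a ha u)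
    have := hNhom1 a⁻¹ (by positivity) (a • u)
    rw [inv_smul_smul₀ ha.ne', inv_mul_le_iff₀ ha] at this
    exact this
  have hNadd : ∀ u v : E, N (u + v) ≤ N u + N v := by
    intro u v
    have h1 : ∀ g : ℂ[X], (∀ z ∈ frontier J, (v : ℂ → ℝ) z ≤ (g.eval z).re) →
        N (u + v) - (g.eval c).re ≤ N u := by
      intro g hg
      refine hleN _ _ fun g' hg' => ?_
      have := hNle (u + v) (g' + g) (fun z hz => by
        rw [eval_add, Complex.add_re]; exact add_le_add (hg' z hz) (hg z hz))
      rw [eval_add, Complex.add_re] at this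
      linarith
    have := hleN v (N (u + v) - N u) fun g hg => by linarith [h1 g hg]
    linarith
  have hN0 : N 0 = 0 := by
    have h1 := hNle 0 0 (by simp)
    have h2 := hleN 0 0 fun g hg => le_re_eval_of_forall_frontier hJ hc g fun z hz => hg z hz
    simp at h1
    linarith
  let x : E := ⟨χ, hχ⟩
  have hspan : ∀ a : ℝ, a • x = 0 → RingHom.id ℝ a • N x = 0 := by
    intro a ha
    rcases smul_eq_zero.1 ha with h | h
    · simp [h]
    · rw [h, hN0, smul_zero]
  obtain ⟨L, hL1, hL2⟩ := exists_extension_of_le_sublinear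
    (LinearPMap.mkSpanSingleton' (R := ℝ) x (N x) hspan) N hNhom hNadd (by
      rintro ⟨y, hy⟩
      obtain ⟨a, rfl⟩ := Submodule.mem_span_singleton.1 hy
      rw [LinearPMap.mkSpanSingleton'_apply, smul_eq_mul, RingHom.id_apply]
      rcases lt_trichotomy a 0 with h | h | h
      · have h1 := hNadd (a • x) ((-a) • x)
        rw [← add_smul, add_neg_cancel, zero_smul, hN0, hNhom (-a) (by linarith)] at h1
        change _ ≤ N (a • x)
        linarith
      · subst h
        change _ ≤ N ((0 : ℝ) • x)
        rw [zero_smul, hN0, zero_mul]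
      · change _ ≤ N (a • x)
        rw [hNhom a h])
  obtain ⟨Λ, hΛ⟩ := L.exists_extend
  have hΛ' : ∀ u : E, Λ u = L u := fun u => by rw [← hΛ]; rfl
  refine ⟨Λ, ?_, ?_, ?_⟩
  · intro u v hu hv huv
    have h1 := hL2 (⟨u, hu⟩ - ⟨v, hv⟩)
    have h2 := hNle (⟨u, hu⟩ - ⟨v, hv⟩) 0 (fun z hz => by simpa using huv z hz)
    rw [map_sub, ← hΛ', ← hΛ'] at h1
    simp at h2
    simp only at h1
    linarith
  · have h1 : ∀ g : ℂ[X], Λ (fun z => (g.eval z).re) ≤ (g.eval c).re := fun g => by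
      have := hL2 ⟨_, hbdd g⟩
      rw [← hΛ'] at this
      exact this.trans (hNle _ g fun z hz => le_rfl)
    intro g
    refine le_antisymm (h1 g) ?_
    have h2 := h1 (-g)
    have h3 : (fun z => ((-g).eval z).re) = -fun z => (g.eval z).re := by
      funext z; simp
    rw [h3, map_neg, eval_neg, Complex.neg_re] at h2
    linarith
  · have h1 := hL1 ⟨x, Submodule.mem_span_singleton_self x⟩
    have h2 := LinearPMap.mkSpanSingleton'_apply_self (R := ℝ) x (N x) hspan (Submodule.mem_span_singleton_self x)
    rw [h2] at h1
    exact (hΛ' x).trans h1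

end HullDim

namespace HullDim
open Polynomial Metric

variable {J : Set ℂ} {c : ℂ} {Λ : (ℂ → ℝ) →ₗ[ℝ] ℝ}

/-- `Λ` is monotone on functions bounded on the boundary of `J` and represents evaluation at `c`
on real parts of polynomials. -/
def IsRepr (J : Set ℂ) (c : ℂ) (Λ : (ℂ → ℝ) →ₗ[ℝ] ℝ) : Prop :=
  (∀ u v, BddOn (frontier J) u → BddOn (frontier J) v →
        (∀ z ∈ frontier J, u z ≤ v z) → Λ u ≤ Λ v) ∧
      ∀ g : ℂ[X], Λ (fun z => (g.eval z).re) = (g.eval c).re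

theorem bddOn_frontier (hJ : IsCompact J) {u : ℂ → ℝ} (hu : ContinuousOn u (frontier J)) :
    BddOn (frontier J) u := by
  have hY : IsCompact (frontier J) := hJ.of_isClosed_subset isClosed_frontier
    hJ.isClosed.frontier_subset
  exact hY.exists_bound_of_continuousOn hu

theorem IsRepr.const (h : IsRepr J c Λ) (m : ℝ) : Λ (fun _ => m) = m := by
  simpa using h.2 (C (m : ℂ))

theorem IsRepr.le_add (h : IsRepr J c Λ) {u v : ℂ → ℝ} (hu : BddOn (frontier J) u)
    (hv : BddOn (frontier J) v) {e : ℝ} (huv : ∀ z ∈ frontier J, u z ≤ v z + e) :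
    Λ u ≤ Λ v + e := by
  obtain ⟨M, hM⟩ := hv
  have := h.1 u (v + fun _ => e) hu ⟨M + |e|, fun z hz => (abs_add_le _ _).trans
    (add_le_add (hM z hz) le_rfl)⟩ huv
  rwa [map_add, h.const] at this

theorem continuousOn_log_norm_sub {Y : Set ℂ} {a : ℂ} (ha : a ∉ Y) :
    ContinuousOn (fun z => Real.log ‖z - a‖) Y := by
  refine ContinuousOn.log (by fun_prop) fun z hz h => ha ?_
  rwa [← sub_eq_zero.1 (norm_eq_zero.1 h)]

theorem IsRepr.log_of_notMem (h : IsRepr J c Λ) (hJ : IsCompact J) (hc : c ∈ J)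
    (hJc : IsPreconnected Jᶜ) {a : ℂ} (ha : a ∉ J) :
    Λ (fun z => Real.log ‖z - a‖) = Real.log ‖c - a‖ := by
  have hsub := hJ.isClosed.frontier_subset
  have hb : BddOn (frontier J) fun z => Real.log ‖z - a‖ :=
    bddOn_frontier hJ (continuousOn_log_norm_sub fun h => ha (hsub h))
  refine eq_of_forall_dist_le fun ε hε => ?_
  obtain ⟨g, hg⟩ := exists_re_eval_near_log hJ ⟨c, hc⟩ hJc ha (half_pos hε)
  have hgb : BddOn (frontier J) fun z => (g.eval z).re := bddOn_frontier hJ (by fun_prop)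
  have h1 := h.le_add (e := ε / 2) hb hgb fun z hz => by
    linarith [(abs_le.1 (hg z (hsub hz))).2]
  have h2 := h.le_add (e := ε / 2) hgb hb fun z hz => by
    linarith [(abs_le.1 (hg z (hsub hz))).1]
  rw [h.2] at h1 h2
  have h3 := abs_le.1 (hg c hc)
  rw [Real.dist_eq, abs_le]
  constructor <;> linarith

theorem log_sub_log_le_div {x y : ℝ} (hx : 0 < x) (hy : 0 < y) :
    Real.log x - Real.log y ≤ (x - y) / y := by
  rw [← Real.log_div hx.ne' hy.ne']
  refine (Real.log_le_sub_one_of_pos (by positivity)).trans (le_of_eq ?_)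
  field_simp

/-- The potential `Λ log ‖· - a‖` minus `log ‖c - a‖`. -/
noncomputable def excess (Λ : (ℂ → ℝ) →ₗ[ℝ] ℝ) (c a : ℂ) : ℝ :=
  Λ (fun z => Real.log ‖z - a‖) - Real.log ‖c - a‖

theorem log_diff_le_near {x x' s κ : ℝ} (hs : 0 < s) (hsx : s ≤ x) (hx' : 0 < x')
    (hxx' : x' ≤ x + 2 * s) (h4 : x' ≤ 4) (hκ : 0 < κ)
    (hκs : √s ≤ Real.exp (-(Real.log 3 / κ))) :
    Real.log x' - Real.log x ≤ 2 * √s + κ * (Real.log 4 - Real.log x') := by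
  have hx : 0 < x := hs.trans_le hsx
  have hσ : 0 < √s := Real.sqrt_pos.2 hs
  have hss : √s * √s = s := Real.mul_self_sqrt hs.le
  have h0 : 0 ≤ Real.log 4 - Real.log x' := sub_nonneg.2 (Real.log_le_log hx' h4)
  rcases le_or_gt √s x with hle | hlt
  · have h1 : Real.log x' - Real.log x ≤ 2 * √s := by
      refine (log_sub_log_le_div hx' hx).trans ?_
      rw [div_le_iff₀ hx]
      nlinarith
    have : 0 ≤ κ * (Real.log 4 - Real.log x') := by positivity
    linarith
  · have h1 : Real.log x' - Real.log x ≤ Real.log 3 := by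
      rw [← Real.log_div hx'.ne' hx.ne']
      refine Real.log_le_log (by positivity) ?_
      rw [div_le_iff₀ hx]; linarith
    have h2 : x' ≤ 4 * √s := by nlinarith
    have h3 : Real.log x' ≤ Real.log 4 - Real.log 3 / κ := by
      have := Real.log_le_log hx' (h2.trans (mul_le_mul_of_nonneg_left hκs (by norm_num)))
      rwa [Real.log_mul (by norm_num) (Real.exp_pos _).ne', Real.log_exp] at this
    have h4 : Real.log 3 ≤ κ * (Real.log 4 - Real.log x') := by
      have : Real.log 3 = κ * (Real.log 3 / κ) := by field_simp
      rw [this]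
      gcongr
      linarith
    linarith

theorem frontier_nonempty_of_isCompact (hJ : IsCompact J) (hne : J.Nonempty) :
    (frontier J).Nonempty :=
  nonempty_frontier_iff.2 ⟨hne, hJ.ne_univ⟩

theorem IsRepr.exists_le_excess_near_frontier (h : IsRepr J c Λ) (hJ : IsCompact J)
    (hJc : IsPreconnected Jᶜ) (hJ1 : J ⊆ closedBall 0 1) {ρ : ℝ} (hρ : 0 < ρ) (hρ4 : ρ ≤ 4)
    (hρJ : ball c ρ ⊆ interior J) {η : ℝ} (hη : 0 < η) :
    ∃ s₀ > 0, ∀ a ∈ interior J, a ≠ c → infDist a (frontier J) < s₀ → -η ≤ excess Λ c a := by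
  have hcJ : c ∈ J := interior_subset (hρJ (mem_ball_self hρ))
  have hY : IsCompact (frontier J) := hJ.of_isClosed_subset isClosed_frontier
    hJ.isClosed.frontier_subset
  have hYne := frontier_nonempty_of_isCompact hJ ⟨c, hcJ⟩
  have hlog : 0 ≤ Real.log (4 / ρ) := Real.log_nonneg (by rw [le_div_iff₀ hρ]; linarith)
  set κ := η / (2 + Real.log (4 / ρ)) with hκ
  have hκ0 : 0 < κ := by positivity
  set τ := min (min (κ / 2) (κ * ρ / 2)) (min 1 (Real.exp (-(Real.log 3 / κ)))) with hτ
  have hτ0 : 0 < τ := by positivity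
  have hτ1 : τ ≤ κ / 2 := (min_le_left _ _).trans (min_le_left _ _)
  have hτ2 : τ ≤ κ * ρ / 2 := (min_le_left _ _).trans (min_le_right _ _)
  have hτ3 : τ ≤ 1 := (min_le_right _ _).trans (min_le_left _ _)
  have hτ4 : τ ≤ Real.exp (-(Real.log 3 / κ)) := (min_le_right _ _).trans (min_le_right _ _)
  refine ⟨τ ^ 2, by positivity, fun a ha hac hs => ?_⟩
  have haY : a ∉ frontier J := fun hf => hf.2 ha
  set s := infDist a (frontier J) with hs_def
  have hs0 : 0 < s := (isClosed_frontier.notMem_iff_infDist_pos hYne).1 haY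
  have hσ : √s ≤ τ := (Real.sqrt_le_left hτ0.le).2 hs.le
  have hss : √s * √s = s := Real.mul_self_sqrt hs0.le
  have hsσ : s ≤ √s := by nlinarith [Real.sqrt_nonneg s]
  obtain ⟨y, hy, hay⟩ := hY.exists_infDist_eq_dist hYne a
  rw [← hs_def] at hay
  have hycl : y ∈ closure Jᶜ := by
    rw [closure_compl]; exact hy.2
  obtain ⟨a', ha', hya'⟩ := Metric.mem_closure_iff.1 hycl s hs0
  have haa' : ‖a - a'‖ ≤ 2 * s := by
    rw [← dist_eq_norm]
    linarith [dist_triangle a y a']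
  have ha'J : a' ∉ J := ha'
  have ha'Y : a' ∉ frontier J := fun hf => ha'J (hJ.isClosed.frontier_subset hf)
  have hnorm : ∀ z ∈ J, ‖z‖ ≤ 1 := fun z hz => by simpa using hJ1 hz
  have hb := bddOn_frontier hJ (continuousOn_log_norm_sub haY)
  have hb' := bddOn_frontier hJ (continuousOn_log_norm_sub ha'Y)
  obtain ⟨M, hM⟩ := hb'
  have hpt : ∀ z ∈ frontier J, (1 + κ) * Real.log ‖z - a'‖ ≤
      Real.log ‖z - a‖ + (2 * √s + κ * Real.log 4) := by
    intro z hz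
    have hzJ := hJ.isClosed.frontier_subset hz
    have hza' : z ≠ a' := fun h => ha'J (h ▸ hzJ)
    have h1 := log_diff_le_near (x := ‖z - a‖) (x' := ‖z - a'‖) (s := s) (κ := κ) hs0
      (by rw [← dist_eq_norm, dist_comm]; exact infDist_le_dist_of_mem hz)
      (norm_pos_iff.2 (sub_ne_zero.2 hza'))
      (by linarith [norm_sub_le_norm_sub_add_norm_sub z a a'])
      (by
        have e1 := norm_sub_le_norm_sub_add_norm_sub z a a'
        have e2 := norm_sub_le z a
        have e3 := hnorm z hzJ
        have e4 := hnorm a (interior_subset ha)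
        have e5 : s ≤ 1 := by linarith
        linarith) hκ0 (hσ.trans hτ4)
    linarith
  have key := h.le_add (u := (1 + κ) • fun z => Real.log ‖z - a'‖)
    ⟨|1 + κ| * M, fun z hz => by
      rw [Pi.smul_apply, smul_eq_mul, abs_mul]
      exact mul_le_mul_of_nonneg_left (hM z hz) (abs_nonneg _)⟩ hb hpt
  rw [map_smul, smul_eq_mul, h.log_of_notMem hJ hcJ hJc ha'J] at key
  have hca' : ρ ≤ ‖c - a'‖ := by
    by_contra! hlt
    exact ha'J (interior_subset (hρJ (by rw [mem_ball, dist_comm, dist_eq_norm]; exact hlt)))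
  have e1 : Real.log ‖c - a‖ - Real.log ‖c - a'‖ ≤ 2 * s / ρ := by
    refine (log_sub_log_le_div (norm_pos_iff.2 (sub_ne_zero.2 hac.symm)) (hρ.trans_le hca')).trans ?_
    have : ‖c - a‖ - ‖c - a'‖ ≤ 2 * s := by
      have := norm_sub_le_norm_sub_add_norm_sub c a' a
      rw [norm_sub_rev a' a] at this
      linarith
    calc _ ≤ 2 * s / ‖c - a'‖ := by gcongr
      _ ≤ _ := by gcongr
  have e2 : Real.log ρ ≤ Real.log ‖c - a'‖ := Real.log_le_log hρ hca'
  have e3 : Real.log (4 / ρ) = Real.log 4 - Real.log ρ := Real.log_div (by norm_num) hρ.ne'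
  have e4 : 2 * s / ρ ≤ κ := by
    rw [div_le_iff₀ hρ]; linarith
  have e5 : κ * (2 + Real.log (4 / ρ)) = η := by rw [hκ]; field_simp
  have e6 : κ * Real.log ρ ≤ κ * Real.log ‖c - a'‖ := by gcongr
  rw [e3] at e5
  unfold excess
  nlinarith

theorem IsRepr.excess_nonneg_near (h : IsRepr J c Λ) (hJ : IsCompact J) {ρ : ℝ}
    (hρJ : ball c ρ ⊆ interior J) {a : ℂ} (hac : a ≠ c) (ha : ‖a - c‖ ≤ ρ / 2) :
    0 ≤ excess Λ c a := by
  have h0 : 0 < ‖a - c‖ := norm_pos_iff.2 (sub_ne_zero.2 hac)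
  have haY : a ∉ frontier J := fun hf => hf.2 (hρJ (by
    rw [mem_ball, dist_eq_norm]; linarith))
  have := h.1 (fun _ => Real.log ‖c - a‖) (fun z => Real.log ‖z - a‖)
    (bddOn_frontier hJ (by fun_prop)) (bddOn_frontier hJ (continuousOn_log_norm_sub haY))
    (fun z hz => by
      refine Real.log_le_log (by rw [norm_sub_rev]; exact h0) ?_
      have hz' : ρ ≤ ‖z - c‖ := by
        by_contra! hlt
        exact hz.2 (hρJ (by rw [mem_ball, dist_eq_norm]; exact hlt))
      have := norm_sub_le_norm_sub_add_norm_sub z a c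
      rw [norm_sub_rev c a]
      linarith)
  rw [h.const] at this
  exact sub_nonneg.2 this

theorem abs_sum_log_four_sub_le {w : ℂ} {d s : ℝ} (hd : 0 < d) (hw : d ≤ ‖w‖) (hs : 0 < s)
    (hsd : 2 * s ≤ d) :
    |Real.log ‖w - s‖ + Real.log ‖w + s‖ + Real.log ‖w - s * Complex.I‖ +
      Real.log ‖w + s * Complex.I‖ - 4 * Real.log ‖w‖| ≤ 2 * (s / d) ^ 4 := by
  have hw0 : 0 < ‖w‖ := hd.trans_le hw
  have hsn : ‖(s : ℂ)‖ = s := by rw [Complex.norm_real, Real.norm_of_nonneg hs.le]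
  have hsI : ‖(s : ℂ) * Complex.I‖ = s := by rw [norm_mul, hsn, Complex.norm_I, mul_one]
  have hne : ∀ v : ℂ, ‖v‖ = s → ‖w - v‖ ≠ 0 := by
    intro v hv h0
    have := norm_sub_norm_le w v
    linarith
  have hne' : ∀ v : ℂ, ‖v‖ = s → ‖w + v‖ ≠ 0 := by
    intro v hv
    have := hne (-v) (by rwa [norm_neg])
    rwa [sub_neg_eq_add] at this
  have e1 : Real.log ‖w - s‖ + Real.log ‖w + s‖ + Real.log ‖w - s * Complex.I‖ +
      Real.log ‖w + s * Complex.I‖ = Real.log ‖w ^ 4 - (s : ℂ) ^ 4‖ := by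
    have : w ^ 4 - (s : ℂ) ^ 4 = (w - s) * (w + s) * (w - s * Complex.I) * (w + s * Complex.I) := by
      linear_combination (-(w ^ 2 - (s : ℂ) ^ 2) * (s : ℂ) ^ 2) * -Complex.I_sq
    rw [this, norm_mul, norm_mul, norm_mul, Real.log_mul, Real.log_mul, Real.log_mul]
    · exact hne _ hsn
    · exact hne' _ hsn
    · exact mul_ne_zero (hne _ hsn) (hne' _ hsn)
    · exact hne _ hsI
    · exact mul_ne_zero (mul_ne_zero (hne _ hsn) (hne' _ hsn)) (hne _ hsI)
    · exact hne' _ hsI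
  rw [e1]
  set q := (s / d) ^ 4 with hq
  have hsdq : s / d ≤ 1 / 2 := by rw [div_le_iff₀ hd]; linarith
  have hq0 : 0 < q := by positivity
  have hq1 : q ≤ 1 / 2 := by
    calc q ≤ (1 / 2) ^ 4 := by rw [hq]; gcongr
      _ ≤ 1 / 2 := by norm_num
  have hs4 : s ^ 4 ≤ q * ‖w‖ ^ 4 := by
    have : s ^ 4 = q * d ^ 4 := by rw [hq]; field_simp
    rw [this]; gcongr
  have hn4 : ‖(s : ℂ) ^ 4‖ = s ^ 4 := by rw [norm_pow, hsn]
  have hw4 : 0 < ‖w‖ ^ 4 := by positivity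
  have hup : ‖w ^ 4 - (s : ℂ) ^ 4‖ ≤ (1 + q) * ‖w‖ ^ 4 := by
    refine (norm_sub_le _ _).trans ?_
    rw [hn4, norm_pow]; linarith
  have hlo : (1 - q) * ‖w‖ ^ 4 ≤ ‖w ^ 4 - (s : ℂ) ^ 4‖ := by
    refine le_trans ?_ (norm_sub_norm_le _ _)
    rw [hn4, norm_pow]; linarith
  have hlop : 0 < (1 - q) * ‖w‖ ^ 4 := by
    have : 0 < 1 - q := by linarith
    positivity
  have hl4 : Real.log (‖w‖ ^ 4) = 4 * Real.log ‖w‖ := by rw [Real.log_pow]; norm_num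
  have k1 := log_sub_log_le_div (hlop.trans_le hlo) hw4
  have k2 := log_sub_log_le_div hw4 (hlop.trans_le hlo)
  have k3 : (‖w ^ 4 - (s : ℂ) ^ 4‖ - ‖w‖ ^ 4) / ‖w‖ ^ 4 ≤ q := by
    rw [div_le_iff₀ hw4]; linarith
  have k4 : (‖w‖ ^ 4 - ‖w ^ 4 - (s : ℂ) ^ 4‖) / ‖w ^ 4 - (s : ℂ) ^ 4‖ ≤ 2 * q := by
    rw [div_le_iff₀ (hlop.trans_le hlo)]
    have h1 : 2 * q * ((1 - q) * ‖w‖ ^ 4) ≤ 2 * q * ‖w ^ 4 - (s : ℂ) ^ 4‖ := by gcongr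
    have h2 : q * ‖w‖ ^ 4 ≤ 2 * q * ((1 - q) * ‖w‖ ^ 4) := by
      have : 0 ≤ q * ‖w‖ ^ 4 * (1 - 2 * q) := mul_nonneg (by positivity) (by linarith)
      linarith
    linarith
  rw [hl4] at k1 k2
  rw [abs_le]
  constructor <;> linarith

end HullDim

namespace HullDim
open Polynomial Metric

variable {J : Set ℂ} {c : ℂ} {Λ : (ℂ → ℝ) →ₗ[ℝ] ℝ}

theorem IsRepr.continuousOn_excess (h : IsRepr J c Λ) (hJ : IsCompact J) {s₀ : ℝ} (hs : 0 < s₀)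
    (hYne : (frontier J).Nonempty) :
    ContinuousOn (excess Λ c) {a | s₀ ≤ infDist a (frontier J) ∧ a ≠ c} := by
  refine ContinuousOn.sub (f := fun a => Λ (fun z => Real.log ‖z - a‖)) ?_ ?_
  · have hLip : ∀ a b, s₀ ≤ infDist a (frontier J) → s₀ ≤ infDist b (frontier J) →
        Λ (fun z => Real.log ‖z - a‖) ≤ Λ (fun z => Real.log ‖z - b‖) + 1 / s₀ * dist a b := by
      intro a b ha hb
      have hmem : ∀ x, s₀ ≤ infDist x (frontier J) → x ∉ frontier J := fun x hx =>
        (isClosed_frontier.notMem_iff_infDist_pos hYne).2 (hs.trans_le hx)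
      refine h.le_add (bddOn_frontier hJ (continuousOn_log_norm_sub (hmem a ha)))
        (bddOn_frontier hJ (continuousOn_log_norm_sub (hmem b hb))) fun z hz => ?_
      have hza : s₀ ≤ ‖z - a‖ := by
        rw [← dist_eq_norm, dist_comm]; exact ha.trans (infDist_le_dist_of_mem hz)
      have hzb : s₀ ≤ ‖z - b‖ := by
        rw [← dist_eq_norm, dist_comm]; exact hb.trans (infDist_le_dist_of_mem hz)
      have h1 := log_sub_log_le_div (hs.trans_le hza) (hs.trans_le hzb)
      have h2 : ‖z - a‖ - ‖z - b‖ ≤ dist a b := by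
        have := norm_sub_le_norm_sub_add_norm_sub z b a
        rw [norm_sub_rev b a, ← dist_eq_norm a b] at this
        linarith
      have h3 : (‖z - a‖ - ‖z - b‖) / ‖z - b‖ ≤ dist a b / s₀ := by
        calc _ ≤ dist a b / ‖z - b‖ := by gcongr
          _ ≤ _ := by gcongr
      rw [one_div_mul_eq_div]
      linarith
    have : LipschitzOnWith (Real.toNNReal (1 / s₀)) (fun a => Λ (fun z => Real.log ‖z - a‖))
        {a | s₀ ≤ infDist a (frontier J) ∧ a ≠ c} := by
      refine LipschitzOnWith.of_le_add_mul _ fun a ha b hb => ?_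
      rw [Real.coe_toNNReal _ (by positivity)]
      exact hLip a b ha.1 hb.1
    exact this.continuousOn
  · refine ContinuousOn.log (by fun_prop) fun a ha h0 => ha.2 ?_
    exact (sub_eq_zero.1 (norm_eq_zero.1 h0)).symm

theorem IsRepr.excess_nonneg (h : IsRepr J c Λ) (hJ : IsCompact J) (hc : c ∈ interior J)
    (hJc : IsPreconnected Jᶜ) (hJ1 : J ⊆ closedBall 0 1) {a : ℂ} (ha : a ∈ interior J)
    (hac : a ≠ c) : 0 ≤ excess Λ c a := by
  obtain ⟨ρ, hρ, hρ4, hρJ⟩ : ∃ ρ > 0, ρ ≤ 4 ∧ ball c ρ ⊆ interior J := by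
    obtain ⟨ρ, hρ, hb⟩ := Metric.isOpen_iff.1 isOpen_interior c hc
    exact ⟨min ρ 4, by positivity, min_le_right _ _, (ball_subset_ball (min_le_left _ _)).trans hb⟩
  have hYne := frontier_nonempty_of_isCompact hJ ⟨c, interior_subset hc⟩
  refine le_of_forall_pos_le_add fun η' hη' => ?_
  obtain ⟨η, hη, rfl⟩ : ∃ η > 0, η' = 2 * η := ⟨η' / 2, by positivity, by ring⟩
  obtain ⟨s₀, hs₀, hbd⟩ := h.exists_le_excess_near_frontier hJ hJc hJ1 hρ hρ4 hρJ hη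
  set K : Set ℂ := J ∩ {a | s₀ ≤ infDist a (frontier J) ∧ ρ / 2 ≤ ‖a - c‖} with hK
  have hKc : IsCompact K := by
    refine hJ.inter_right ?_
    have h1 : IsClosed {a : ℂ | s₀ ≤ infDist a (frontier J)} :=
      isClosed_le continuous_const (continuous_infDist_pt _)
    have h2 : IsClosed {a : ℂ | ρ / 2 ≤ ‖a - c‖} := isClosed_le continuous_const (by fun_prop)
    exact h1.inter h2
  have houtside : ∀ b ∈ interior J, b ≠ c → b ∉ K → -η ≤ excess Λ c b := by
    intro b hb hbc hbK
    by_cases h1 : s₀ ≤ infDist b (frontier J)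
    · have h2 : ‖b - c‖ ≤ ρ / 2 := by
        by_contra! h3
        exact hbK ⟨interior_subset hb, h1, h3.le⟩
      linarith [h.excess_nonneg_near hJ hρJ hbc h2]
    · exact hbd b hb hbc (not_le.1 h1)
  have hsq : ∀ b ∈ J, ‖b‖ ^ 2 ≤ 1 := fun b hb =>
    pow_le_one₀ (norm_nonneg _) (by simpa using hJ1 hb)
  by_cases haK : a ∈ K
  swap
  · linarith [houtside a ha hac haK]
  have hKne : ∀ b ∈ K, b ≠ c := by
    rintro b ⟨-, -, hb⟩ rfl
    simp at hb; linarith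
  have hKint : ∀ b ∈ K, b ∈ interior J := by
    rintro b ⟨hb, hb2, -⟩
    by_contra hni
    have : b ∈ frontier J := ⟨subset_closure hb, hni⟩
    rw [infDist_zero_of_mem this] at hb2
    linarith
  have hcont : ContinuousOn (fun b => excess Λ c b - η * ‖b‖ ^ 2) K :=
    ((h.continuousOn_excess hJ hs₀ hYne).mono fun b hb => ⟨hb.2.1, hKne b hb⟩).sub (by fun_prop)
  obtain ⟨b, hb, hmin⟩ := hKc.exists_isMinOn ⟨a, haK⟩ hcont
  have hmin' : ∀ x ∈ K, excess Λ c b - η * ‖b‖ ^ 2 ≤ excess Λ c x - η * ‖x‖ ^ 2 := hmin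
  have haJ := interior_subset ha
  suffices hge : -(2 * η) ≤ excess Λ c b - η * ‖b‖ ^ 2 by
    have := hmin' a haK
    have h0 : 0 ≤ η * ‖a‖ ^ 2 := by positivity
    linarith
  by_contra! hlt
  set d := min s₀ (ρ / 2) with hd
  have hd0 : 0 < d := by positivity
  obtain ⟨r, hr, hrJ⟩ := Metric.isOpen_iff.1
    (isOpen_interior.inter (isOpen_compl_singleton (x := c))) b ⟨hKint b hb, hKne b hb⟩
  obtain ⟨s, hs, hsr, hsd, hsη⟩ : ∃ s > 0, s < r ∧ 2 * s ≤ d ∧ s ^ 2 < η * d ^ 4 := by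
    have h1 : 0 < √(η * d ^ 4) := Real.sqrt_pos.2 (by positivity)
    refine ⟨min (r / 2) (min (d / 2) (√(η * d ^ 4) / 2)), by positivity, ?_, ?_, ?_⟩
    · exact (min_le_left _ _).trans_lt (by linarith)
    · linarith [(min_le_right (r / 2) (min (d / 2) (√(η * d ^ 4) / 2))).trans (min_le_left _ _)]
    · have h2 : min (r / 2) (min (d / 2) (√(η * d ^ 4) / 2)) < √(η * d ^ 4) :=
        ((min_le_right _ _).trans (min_le_right _ _)).trans_lt (by linarith)
      calc _ < √(η * d ^ 4) ^ 2 := pow_lt_pow_left₀ h2 (by positivity) (by norm_num)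
        _ = _ := Real.sq_sqrt (by positivity)
  have hsn : ‖(s : ℂ)‖ = s := by rw [Complex.norm_real, Real.norm_of_nonneg hs.le]
  have hsI : ‖(s : ℂ) * Complex.I‖ = s := by rw [norm_mul, hsn, Complex.norm_I, mul_one]
  have hnbr : ∀ v : ℂ, ‖v‖ = s → b + v ∈ interior J ∧ b + v ≠ c := by
    intro v hv
    exact hrJ (by rw [mem_ball, dist_eq_norm, add_sub_cancel_left, hv]; exact hsr)
  have hstep : ∀ v : ℂ, ‖v‖ = s →
      excess Λ c b - η * ‖b‖ ^ 2 ≤ excess Λ c (b + v) - η * ‖b + v‖ ^ 2 := by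
    intro v hv
    obtain ⟨h1, h2⟩ := hnbr v hv
    by_cases hK' : b + v ∈ K
    · exact hmin' _ hK'
    · have h3 := houtside _ h1 h2 hK'
      have h4 : η * ‖b + v‖ ^ 2 ≤ η * 1 := by
        gcongr; exact hsq _ (interior_subset h1)
      linarith
  have s1 := hstep s hsn
  have s2 := hstep (-s) (by rw [norm_neg, hsn])
  have s3 := hstep (s * Complex.I) hsI
  have s4 := hstep (-(s * Complex.I)) (by rw [norm_neg, hsI])
  have hpar1 : ‖b + s‖ ^ 2 + ‖b + -s‖ ^ 2 = 2 * (‖b‖ ^ 2 + s ^ 2) := by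
    have := parallelogram_law_with_norm ℂ b (s : ℂ)
    rw [hsn] at this
    rw [← sub_eq_add_neg]; nlinarith
  have hpar2 : ‖b + s * Complex.I‖ ^ 2 + ‖b + -(s * Complex.I)‖ ^ 2 = 2 * (‖b‖ ^ 2 + s ^ 2) := by
    have := parallelogram_law_with_norm ℂ b (s * Complex.I : ℂ)
    rw [hsI] at this
    rw [← sub_eq_add_neg]; nlinarith
  have hbdd : ∀ v : ℂ, ‖v‖ = s → BddOn (frontier J) fun z => Real.log ‖z - (b + v)‖ := fun v hv =>
    bddOn_frontier hJ (continuousOn_log_norm_sub fun hf => hf.2 (hnbr v hv).1)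
  have hbdd0 : BddOn (frontier J) fun z => Real.log ‖z - b‖ :=
    bddOn_frontier hJ (continuousOn_log_norm_sub fun hf => hf.2 (hKint b hb))
  have hadd : ∀ {u v : ℂ → ℝ}, BddOn (frontier J) u → BddOn (frontier J) v →
      BddOn (frontier J) (u + v) := by
    rintro u v ⟨M, hM⟩ ⟨N, hN⟩
    exact ⟨M + N, fun z hz => (abs_add_le _ _).trans (add_le_add (hM z hz) (hN z hz))⟩
  have hsmul : BddOn (frontier J) ((4 : ℝ) • fun z => Real.log ‖z - b‖) := by
    obtain ⟨M, hM⟩ := hbdd0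
    refine ⟨4 * M, fun z hz => ?_⟩
    rw [Pi.smul_apply, smul_eq_mul, abs_mul, abs_of_pos (by norm_num : (0 : ℝ) < 4)]
    linarith [hM z hz]
  have hform : ∀ z : ℂ, z - (b + s) = (z - b) - s ∧ z - (b + -s) = (z - b) + s ∧
      z - (b + s * Complex.I) = (z - b) - s * Complex.I ∧
      z - (b + -(s * Complex.I)) = (z - b) + s * Complex.I := fun z =>
    ⟨by ring, by ring, by ring, by ring⟩
  have key := h.le_add (e := 2 * (s / d) ^ 4)
    (hadd (hadd (hadd (hbdd s hsn) (hbdd (-s) (by rw [norm_neg, hsn]))) (hbdd (s * Complex.I) hsI))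
      (hbdd (-(s * Complex.I)) (by rw [norm_neg, hsI]))) hsmul (fun z hz => by
      obtain ⟨f1, f2, f3, f4⟩ := hform z
      simp only [Pi.add_apply, Pi.smul_apply, smul_eq_mul, f1, f2, f3, f4]
      have hzb : d ≤ ‖z - b‖ := by
        rw [← dist_eq_norm, dist_comm]
        exact (min_le_left _ _).trans (hb.2.1.trans (infDist_le_dist_of_mem hz))
      linarith [(abs_le.1 (abs_sum_log_four_sub_le hd0 hzb hs hsd)).2])
  rw [map_add, map_add, map_add, map_smul, smul_eq_mul] at key
  have hcb : d ≤ ‖c - b‖ := by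
    rw [norm_sub_rev]; exact (min_le_right _ _).trans hb.2.2
  have key2 := (abs_le.1 (abs_sum_log_four_sub_le hd0 hcb hs hsd)).1
  obtain ⟨f1, f2, f3, f4⟩ := hform c
  rw [← f1, ← f2, ← f3, ← f4] at key2
  unfold excess at s1 s2 s3 s4
  have hfin : η * s ^ 2 ≤ (s / d) ^ 4 := by nlinarith
  have : (s / d) ^ 4 * d ^ 4 = s ^ 4 := by field_simp
  have h5 : η * s ^ 2 * d ^ 4 ≤ s ^ 4 := by
    rw [← this]; gcongr
  have h6 : s ^ 2 * s ^ 2 < s ^ 2 * (η * d ^ 4) := by gcongr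
  nlinarith

theorem IsRepr.log_le_log_add (h : IsRepr J c Λ) (hJ : IsCompact J) (hc : c ∈ interior J)
    (hJc : IsPreconnected Jᶜ) (hJ1 : J ⊆ closedBall 0 1) {a : ℂ} (hac : a ≠ c) {t : ℝ}
    (ht : 0 < t) : Real.log ‖c - a‖ ≤ Λ (fun z => Real.log (‖z - a‖ + t)) := by
  have hcJ := interior_subset hc
  have hbt : BddOn (frontier J) fun z => Real.log (‖z - a‖ + t) :=
    bddOn_frontier hJ (ContinuousOn.log (by fun_prop) fun z _ => by positivity)
  have hmono : ∀ b, b ∉ frontier J → ‖b - a‖ ≤ t →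
      Λ (fun z => Real.log ‖z - b‖) ≤ Λ (fun z => Real.log (‖z - a‖ + t)) := by
    intro b hb hba
    refine h.1 _ _ (bddOn_frontier hJ (continuousOn_log_norm_sub hb)) hbt fun z hz => ?_
    refine Real.log_le_log (norm_pos_iff.2 (sub_ne_zero.2 fun h0 => hb (h0 ▸ hz))) ?_
    have := norm_sub_le_norm_sub_add_norm_sub z a b
    rw [norm_sub_rev a b] at this
    linarith
  by_cases haJ : a ∈ J
  · by_cases hai : a ∈ interior J
    · have h1 := h.excess_nonneg hJ hc hJc hJ1 hai hac
      unfold excess at h1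
      linarith [hmono a (fun hf => hf.2 hai) (by simpa using ht.le)]
    · have hacl : a ∈ closure Jᶜ := by rw [closure_compl]; exact hai
      by_contra! hlt
      have hcont : ContinuousAt (fun b => Real.log ‖c - b‖) a :=
        ContinuousAt.log (by fun_prop) (norm_ne_zero_iff.2 (sub_ne_zero.2 hac.symm))
      have hev := (hcont.eventually (lt_mem_nhds hlt)).and (ball_mem_nhds a ht)
      obtain ⟨b, ⟨hb1, hb2⟩, hbJ⟩ := mem_closure_iff_nhds.1 hacl _ hev
      have hbJ' : b ∉ J := hbJ
      have h1 := hmono b (fun hf => hbJ' (hJ.isClosed.frontier_subset hf))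
        (by rw [← dist_eq_norm]; exact hb2.le)
      rw [h.log_of_notMem hJ hcJ hJc hbJ'] at h1
      exact absurd hb1 (not_lt.2 h1)
  · rw [← h.log_of_notMem hJ hcJ hJc haJ]
    exact hmono a (fun hf => haJ (hJ.isClosed.frontier_subset hf)) (by simpa using ht.le)

end HullDim

namespace HullDim
open Polynomial Metric

variable {J : Set ℂ} {c : ℂ} {Λ : (ℂ → ℝ) →ₗ[ℝ] ℝ}

theorem norm_eval_eq_prod_roots (P : ℂ[X]) (z : ℂ) :
    ‖P.eval z‖ = ‖P.leadingCoeff‖ * (P.roots.map fun a => ‖z - a‖).prod := by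
  rw [(IsAlgClosed.splits P).eval_eq_prod_roots, norm_mul]
  congr 1
  induction P.roots using Multiset.induction_on with
  | empty => simp
  | cons a s ih => simp [ih]

theorem log_prod_map_multiset (s : Multiset ℂ) (f : ℂ → ℝ) (h : ∀ a ∈ s, 0 < f a) :
    Real.log (s.map f).prod = (s.map fun a => Real.log (f a)).sum := by
  induction s using Multiset.induction_on with
  | empty => simp
  | cons a s ih =>
    have h1 : 0 < (s.map f).prod := Multiset.prod_pos (by
      intro x hx
      obtain ⟨y, hy, rfl⟩ := Multiset.mem_map.1 hx
      exact h y (Multiset.mem_cons_of_mem hy))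
    rw [Multiset.map_cons, Multiset.prod_cons, Multiset.map_cons, Multiset.sum_cons,
      Real.log_mul (h a (Multiset.mem_cons_self _ _)).ne' h1.ne',
      ih fun b hb => h b (Multiset.mem_cons_of_mem hb)]

theorem map_sum_map_multiset (s : Multiset ℂ) (f : ℂ → ℂ → ℝ) :
    Λ (fun z => (s.map (f z)).sum) = (s.map fun a => Λ fun z => f z a).sum := by
  induction s using Multiset.induction_on with
  | empty =>
    simp only [Multiset.map_zero, Multiset.sum_zero]
    exact map_zero Λ
  | cons a s ih =>
    have : (fun z => ((a ::ₘ s).map (f z)).sum) =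
        (fun z => f z a) + fun z => (s.map (f z)).sum := by
      ext z; simp
    rw [this, map_add, ih]; simp

theorem exists_poly_of_rational_bound (hJ : IsCompact J) (hc : c ∈ interior J)
    (hJc : IsPreconnected Jᶜ) (hJ1 : J ⊆ closedBall 0 1) {χ : ℂ → ℝ}
    (hχ : ∀ z ∈ frontier J, χ z ∈ Set.Icc (0 : ℝ) 1) {P Q : ℂ[X]} (hQ : ∀ z ∈ J, Q.eval z ≠ 0)
    {a b k : ℝ} (ha : 0 < a)
    (hPQ : ∀ z ∈ frontier J, ‖P.eval z‖ ≤ Real.exp (-a * χ z + b) * ‖Q.eval z‖)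
    (hcPQ : Real.exp (-k) * ‖Q.eval c‖ ≤ ‖P.eval c‖) {ε : ℝ} (hε : 0 < ε) :
    ∃ g : ℂ[X], (∀ z ∈ frontier J, χ z ≤ (g.eval z).re) ∧ (g.eval c).re ≤ (b + k) / a + ε := by
  have hχb : BddOn (frontier J) χ := ⟨1, fun z hz => abs_le.2
    ⟨by linarith [(hχ z hz).1], (hχ z hz).2⟩⟩
  obtain ⟨Λ, hmono, hrepr, hΛ⟩ := exists_representing_functional hJ hc hχb
  have h : IsRepr J c Λ := ⟨hmono, hrepr⟩
  have hcJ := interior_subset hc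
  have hsub : frontier J ⊆ J := hJ.isClosed.frontier_subset
  have hY : IsCompact (frontier J) := hJ.of_isClosed_subset isClosed_frontier hsub
  suffices hmain : Λ χ ≤ (b + k) / a + ε / 2 by
    obtain ⟨x, ⟨g, hg, rfl⟩, hx⟩ := exists_lt_of_csInf_lt (majorants_nonempty hχb)
      (show sInf (majorants J c χ) < (b + k) / a + ε by rw [← hΛ]; linarith)
    exact ⟨g, hg, hx.le⟩
  have hQc : 0 < ‖Q.eval c‖ := norm_pos_iff.2 (hQ c hcJ)
  have hPc : 0 < ‖P.eval c‖ := lt_of_lt_of_le (by positivity) hcPQ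
  have hP0 : P ≠ 0 := by rintro rfl; simp at hPc
  have hQ0 : Q ≠ 0 := by rintro rfl; simp at hQc
  have hPl : 0 < ‖P.leadingCoeff‖ := by simpa using hP0
  have hQl : 0 < ‖Q.leadingCoeff‖ := by simpa using hQ0
  set δ := a * (ε / 2) with hδ
  have hδ0 : 0 < δ := by positivity
  -- perturb the zeros of `P`
  obtain ⟨t, ht, hbound⟩ : ∃ t > 0, ∀ z ∈ frontier J,
      ‖P.leadingCoeff‖ * (P.roots.map fun x => ‖z - x‖ + t).prod ≤
        Real.exp (-a * χ z + b + δ) * ‖Q.eval z‖ := by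
    obtain ⟨q, hq, hqY⟩ : ∃ q > 0, ∀ z ∈ frontier J, q ≤ ‖Q.eval z‖ := by
      have hcont : ContinuousOn (fun z => ‖Q.eval z‖) (frontier J) := by fun_prop
      obtain ⟨z₀, hz₀, hmin⟩ := hY.exists_isMinOn
        (frontier_nonempty_of_isCompact hJ ⟨c, hcJ⟩) hcont
      exact ⟨_, norm_pos_iff.2 (hQ z₀ (hsub hz₀)), fun z hz => hmin hz⟩
    set m := (Real.exp δ - 1) * (Real.exp (-a + b) * q) with hm
    have hm0 : 0 < m := mul_pos (by linarith [Real.add_one_lt_exp hδ0.ne']) (by positivity)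
    let F : ℝ → ℂ → ℝ := fun t z => ‖P.leadingCoeff‖ * (P.roots.map fun x => ‖z - x‖ + t).prod
    have hF : Continuous fun p : ℝ × ℂ => F p.1 p.2 := by
      refine continuous_const.mul ?_
      exact continuous_multiset_prod _ fun x _ => by fun_prop
    have hev : ∀ᶠ t in nhds (0 : ℝ), ∀ z ∈ frontier J, F t z < F 0 z + m := by
      refine hY.eventually_forall_of_forall_eventually fun z _ => ?_
      have h2 : Continuous fun p : ℝ × ℂ => F 0 p.2 + m := by
        have := hF.comp (f := fun p : ℝ × ℂ => ((0 : ℝ), p.2)) (by fun_prop)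
        exact this.add continuous_const
      exact hF.continuousAt.eventually_lt h2.continuousAt (by simpa using hm0)
    obtain ⟨t, ht, ht0⟩ := ((hev.filter_mono nhdsWithin_le_nhds).and
      (self_mem_nhdsWithin (s := Set.Ioi (0 : ℝ)))).exists
    refine ⟨t, ht0, fun z hz => (ht z hz).le.trans ?_⟩
    have e1 : F 0 z = ‖P.eval z‖ := by simp [F, norm_eval_eq_prod_roots P z]
    have e2 : Real.exp (-a + b) ≤ Real.exp (-a * χ z + b) :=
      Real.exp_le_exp.2 (by nlinarith [(hχ z hz).2])
    have e3 : m ≤ (Real.exp δ - 1) * (Real.exp (-a * χ z + b) * ‖Q.eval z‖) := by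
      have : 0 ≤ Real.exp δ - 1 := by linarith [Real.add_one_lt_exp hδ0.ne']
      rw [hm]
      gcongr
      exact hqY z hz
    rw [e1, Real.exp_add _ δ]
    nlinarith [hPQ z hz]
  have hlogQ : ∀ z ∈ J, Real.log ‖Q.eval z‖ =
      Real.log ‖Q.leadingCoeff‖ + (Q.roots.map fun x => Real.log ‖z - x‖).sum := by
    intro z hz
    have hpos : ∀ x ∈ Q.roots, 0 < ‖z - x‖ := fun x hx => norm_pos_iff.2
      (sub_ne_zero.2 fun hzx => hQ z hz (hzx ▸ (mem_roots'.1 hx).2))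
    have h1 := norm_pos_iff.2 (hQ z hz)
    rw [norm_eval_eq_prod_roots] at h1 ⊢
    rw [Real.log_mul hQl.ne' (pos_of_mul_pos_right h1 hQl.le).ne',
      log_prod_map_multiset _ _ hpos]
  have hbq : BddOn (frontier J) fun z => (Q.roots.map fun x => Real.log ‖z - x‖).sum :=
    bddOn_frontier hJ (continuousOn_multiset_sum _ fun x hx => continuousOn_log_norm_sub
      fun hf => hQ x (hsub hf) (mem_roots'.1 hx).2)
  have hbp : BddOn (frontier J) fun z => (P.roots.map fun x => Real.log (‖z - x‖ + t)).sum :=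
    bddOn_frontier hJ (continuousOn_multiset_sum _ fun x hx =>
      ContinuousOn.log (by fun_prop) fun z _ => by positivity)
  have hadd : ∀ {u v : ℂ → ℝ}, BddOn (frontier J) u → BddOn (frontier J) v →
      BddOn (frontier J) (u + v) := by
    rintro u v ⟨M, hM⟩ ⟨N, hN⟩
    exact ⟨M + N, fun z hz => (abs_add_le _ _).trans (add_le_add (hM z hz) (hN z hz))⟩
  have hbχ : BddOn (frontier J) ((-a) • χ) := by
    obtain ⟨M, hM⟩ := hχb
    refine ⟨a * M, fun z hz => ?_⟩
    rw [Pi.smul_apply, smul_eq_mul, abs_mul, abs_neg, abs_of_pos ha]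
    exact mul_le_mul_of_nonneg_left (hM z hz) ha.le
  have key := h.le_add hbp (hadd hbq hbχ)
    (e := b + δ + Real.log ‖Q.leadingCoeff‖ - Real.log ‖P.leadingCoeff‖) (by
      intro z hz
      have hpos : ∀ x ∈ P.roots, 0 < ‖z - x‖ + t := fun x _ => by positivity
      have hprod : 0 < (P.roots.map fun x => ‖z - x‖ + t).prod := Multiset.prod_pos (by
        intro y hy
        obtain ⟨x, hx, rfl⟩ := Multiset.mem_map.1 hy
        exact hpos x hx)
      have h1 := Real.log_le_log (by positivity) (hbound z hz)
      rw [Real.log_mul hPl.ne' hprod.ne', log_prod_map_multiset _ _ hpos,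
        Real.log_mul (Real.exp_pos _).ne' (norm_pos_iff.2 (hQ z (hsub hz))).ne', Real.log_exp,
        hlogQ z (hsub hz)] at h1
      simp only [Pi.add_apply, Pi.smul_apply, smul_eq_mul]
      linarith)
  rw [map_add, map_smul, map_sum_map_multiset, map_sum_map_multiset, smul_eq_mul] at key
  have hP1 : (P.roots.map fun x => Real.log ‖c - x‖).sum ≤
      (P.roots.map fun x => Λ fun z => Real.log (‖z - x‖ + t)).sum :=
    Multiset.sum_map_le_sum_map _ _ fun x hx => h.log_le_log_add hJ hc hJc hJ1
      (fun hxc => by simp [← hxc, (mem_roots'.1 hx).2.eq_zero] at hPc) ht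
  have hQ1 : (Q.roots.map fun x => Λ fun z => Real.log ‖z - x‖).sum =
      (Q.roots.map fun x => Real.log ‖c - x‖).sum := by
    congr 1
    exact Multiset.map_congr rfl fun x hx => h.log_of_notMem hJ hcJ hJc
      fun hf => hQ x hf (mem_roots'.1 hx).2
  have hlogP : Real.log ‖P.eval c‖ =
      Real.log ‖P.leadingCoeff‖ + (P.roots.map fun x => Real.log ‖c - x‖).sum := by
    have hpos : ∀ x ∈ P.roots, 0 < ‖c - x‖ := fun x hx => norm_pos_iff.2
      (sub_ne_zero.2 fun hzx => by simp [hzx, (mem_roots'.1 hx).2.eq_zero] at hPc)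
    rw [norm_eval_eq_prod_roots] at hPc ⊢
    rw [Real.log_mul hPl.ne' (pos_of_mul_pos_right hPc hPl.le).ne',
      log_prod_map_multiset _ _ hpos]
  have hlc := Real.log_le_log (by positivity) hcPQ
  rw [Real.log_mul (Real.exp_pos _).ne' hQc.ne', Real.log_exp, hlogQ c hcJ, hlogP] at hlc
  have hfin : a * Λ χ ≤ b + k + δ := by linarith
  calc Λ χ = a * Λ χ / a := by field_simp
    _ ≤ (b + k + δ) / a := by gcongr
    _ = _ := by rw [hδ]; field_simp

end HullDim

namespace HullDim
open Finset

theorem sum_mul_sub_succ (a h : ℕ → ℂ) (m : ℕ) :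
    ∑ j ∈ range (m + 1), a j * (h j - h (j + 1)) =
      a 0 * h 0 - a m * h (m + 1) + ∑ j ∈ range m, (a (j + 1) - a j) * h (j + 1) := by
  induction m with
  | zero => simp; ring
  | succ m ih => rw [sum_range_succ, ih, sum_range_succ _ m]; ring

theorem sum_add_succ_le {w : ℕ → ℝ} (hw : ∀ j, 0 ≤ w j) (m : ℕ) :
    ∑ j ∈ range m, (w j + w (j + 1)) ≤ 2 * ∑ j ∈ range (m + 1), w j := by
  rw [sum_add_distrib, two_mul]
  refine add_le_add ?_ ?_
  · exact sum_le_sum_of_subset_of_nonneg (range_subset_range.2 m.le_succ) fun _ _ _ => hw _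
  · rw [sum_range_succ' w m]; linarith [hw 0]

/-- Discrete Green formula for a union of cells (those with `a i j = 1`) of a square grid in which
the contour integral over each cell vanishes. -/
theorem norm_boundary_sum_le {a h v : ℕ → ℕ → ℂ} {w : ℕ → ℕ → ℝ} {δ : ℝ} {m : ℕ}
    (hδ : 0 ≤ δ) (hw : ∀ i j, 0 ≤ w i j) (ha : ∀ i j, a i j = 0 ∨ a i j = 1)
    (hcell : ∀ i j, h i j - h i (j + 1) + Complex.I * (v (i + 1) j - v i j) = 0)
    (hh : ∀ i j, i < m + 1 → j < m → a i j ≠ a i (j + 1) →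
      ‖h i (j + 1)‖ ≤ δ * (w i j + w i (j + 1)))
    (hv : ∀ i j, i < m → j < m + 1 → a i j ≠ a (i + 1) j →
      ‖v (i + 1) j‖ ≤ δ * (w i j + w (i + 1) j)) :
    ‖∑ i ∈ range (m + 1), (a i 0 * h i 0 - a i m * h i (m + 1)) +
      Complex.I * ∑ j ∈ range (m + 1), (a m j * v (m + 1) j - a 0 j * v 0 j)‖ ≤
      4 * (δ * ∑ i ∈ range (m + 1), ∑ j ∈ range (m + 1), w i j) := by
  have h0 : ∑ i ∈ range (m + 1), ∑ j ∈ range (m + 1), a i j * (h i j - h i (j + 1)) +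
      Complex.I * ∑ j ∈ range (m + 1), ∑ i ∈ range (m + 1), a i j * (v (i + 1) j - v i j) = 0 := by
    rw [sum_comm (s := range (m + 1)) (t := range (m + 1)) (f := fun j i => a i j * _), mul_sum,
      ← sum_add_distrib]
    refine sum_eq_zero fun i _ => ?_
    rw [mul_sum, ← sum_add_distrib]
    refine sum_eq_zero fun j _ => ?_
    linear_combination a i j * hcell i j
  have h1 : ∀ i, ∑ j ∈ range (m + 1), a i j * (h i j - h i (j + 1)) = _ := fun i =>
    sum_mul_sub_succ (a i) (h i) m
  have h2 : ∀ j, ∑ i ∈ range (m + 1), a i j * (v (i + 1) j - v i j) =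
      -(a 0 j * v 0 j - a m j * v (m + 1) j +
        ∑ i ∈ range m, (a (i + 1) j - a i j) * v (i + 1) j) := fun j => by
    rw [← sum_mul_sub_succ (fun i => a i j) (fun i => v i j) m, ← sum_neg_distrib]
    exact sum_congr rfl fun i _ => by ring
  simp only [h1, h2, sum_add_distrib, sum_neg_distrib] at h0
  have hdiff : ∀ i j i' j', a i j ≠ a i' j' → ‖a i' j' - a i j‖ = 1 := by
    intro i j i' j' hne
    rcases ha i j with h | h <;> rcases ha i' j' with h' | h' <;> simp_all
  have bh : ‖∑ i ∈ range (m + 1), ∑ j ∈ range m, (a i (j + 1) - a i j) * h i (j + 1)‖ ≤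
      2 * (δ * ∑ i ∈ range (m + 1), ∑ j ∈ range (m + 1), w i j) := by
    calc _ ≤ ∑ i ∈ range (m + 1), ∑ j ∈ range m, δ * (w i j + w i (j + 1)) := by
          refine norm_sum_le_of_le _ fun i hi => norm_sum_le_of_le _ fun j hj => ?_
          by_cases hne : a i j = a i (j + 1)
          · rw [hne, sub_self, zero_mul, norm_zero]
            exact mul_nonneg hδ (add_nonneg (hw _ _) (hw _ _))
          · rw [norm_mul, hdiff _ _ _ _ hne, one_mul]
            exact hh i j (mem_range.1 hi) (mem_range.1 hj) hne
      _ ≤ ∑ i ∈ range (m + 1), δ * (2 * ∑ j ∈ range (m + 1), w i j) := by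
          refine sum_le_sum fun i _ => ?_
          rw [← mul_sum]
          exact mul_le_mul_of_nonneg_left (sum_add_succ_le (hw i) m) hδ
      _ = _ := by rw [← mul_sum, ← mul_sum]; ring
  have bv : ‖∑ j ∈ range (m + 1), ∑ i ∈ range m, (a (i + 1) j - a i j) * v (i + 1) j‖ ≤
      2 * (δ * ∑ i ∈ range (m + 1), ∑ j ∈ range (m + 1), w i j) := by
    calc _ ≤ ∑ j ∈ range (m + 1), ∑ i ∈ range m, δ * (w i j + w (i + 1) j) := by
          refine norm_sum_le_of_le _ fun j hj => norm_sum_le_of_le _ fun i hi => ?_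
          by_cases hne : a i j = a (i + 1) j
          · rw [hne, sub_self, zero_mul, norm_zero]
            exact mul_nonneg hδ (add_nonneg (hw _ _) (hw _ _))
          · rw [norm_mul, hdiff _ _ _ _ hne, one_mul]
            exact hv i j (mem_range.1 hi) (mem_range.1 hj) hne
      _ ≤ ∑ j ∈ range (m + 1), δ * (2 * ∑ i ∈ range (m + 1), w i j) := by
          refine sum_le_sum fun j _ => ?_
          rw [← mul_sum]
          exact mul_le_mul_of_nonneg_left (sum_add_succ_le (fun i => hw i j) m) hδ
      _ = _ := by rw [← mul_sum, ← mul_sum, sum_comm]; ring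
  have hkey : ∑ i ∈ range (m + 1), (a i 0 * h i 0 - a i m * h i (m + 1)) +
      Complex.I * ∑ j ∈ range (m + 1), (a m j * v (m + 1) j - a 0 j * v 0 j) =
      -(∑ i ∈ range (m + 1), ∑ j ∈ range m, (a i (j + 1) - a i j) * h i (j + 1)) +
      Complex.I * (∑ j ∈ range (m + 1), ∑ i ∈ range m, (a (i + 1) j - a i j) * v (i + 1) j) := by
    have : ∑ j ∈ range (m + 1), (a m j * v (m + 1) j - a 0 j * v 0 j) =
        -∑ j ∈ range (m + 1), (a 0 j * v 0 j - a m j * v (m + 1) j) := by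
      rw [← sum_neg_distrib]; exact sum_congr rfl fun _ _ => by ring
    rw [this]
    linear_combination h0
  rw [hkey]
  refine (norm_add_le _ _).trans ?_
  rw [norm_neg, norm_mul, Complex.norm_I, one_mul]
  linarith

end HullDim

namespace HullDim
open Set Metric

/-- The closed square of side `δ` with lower left corner `p δ + (o + q δ) i`. -/
def cell (o δ : ℝ) (p q : ℤ) : Set ℂ :=
  Icc (p * δ) ((p + 1) * δ) ×ℂ Icc (o + q * δ) (o + (q + 1) * δ)

/-- The union of the closed grid squares contained in `Ω`. -/
def gridUnion (o δ : ℝ) (Ω : Set ℂ) : Set ℂ :=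
  ⋃ κ ∈ {κ : ℤ × ℤ | cell o δ κ.1 κ.2 ⊆ Ω}, cell o δ κ.1 κ.2

variable {o δ : ℝ} {Ω : Set ℂ} {p q : ℤ}

theorem mem_cell {z : ℂ} : z ∈ cell o δ p q ↔ (p * δ ≤ z.re ∧ z.re ≤ (p + 1) * δ) ∧
    o + q * δ ≤ z.im ∧ z.im ≤ o + (q + 1) * δ := by
  simp [cell, Complex.mem_reProdIm]

theorem isCompact_cell : IsCompact (cell o δ p q) := isCompact_Icc.reProdIm isCompact_Icc

theorem convex_reProdIm {s t : Set ℝ} (hs : Convex ℝ s) (ht : Convex ℝ t) :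
    Convex ℝ (s ×ℂ t) := by
  refine (hs.linear_preimage Complex.reLm).inter (ht.linear_preimage Complex.imLm)

theorem isPreconnected_cell : IsPreconnected (cell o δ p q) :=
  (convex_reProdIm (convex_Icc _ _) (convex_Icc _ _)).isPreconnected

theorem dist_le_of_mem_cell {z w : ℂ} (hz : z ∈ cell o δ p q) (hw : w ∈ cell o δ p q) :
    dist z w ≤ 2 * δ := by
  rw [mem_cell] at hz hw
  rw [dist_eq_norm]
  refine (Complex.norm_le_abs_re_add_abs_im _).trans ?_
  rw [Complex.sub_re, Complex.sub_im]
  have h1 : |z.re - w.re| ≤ δ := abs_le.2 ⟨by linarith, by linarith⟩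
  have h2 : |z.im - w.im| ≤ δ := abs_le.2 ⟨by linarith, by linarith⟩
  linarith

theorem mem_cell_floor (hδ : 0 < δ) (z : ℂ) : z ∈ cell o δ ⌊z.re / δ⌋ ⌊(z.im - o) / δ⌋ := by
  rw [mem_cell]
  have h1 := Int.floor_le (z.re / δ)
  have h2 := (Int.lt_floor_add_one (z.re / δ)).le
  have h3 := Int.floor_le ((z.im - o) / δ)
  have h4 := (Int.lt_floor_add_one ((z.im - o) / δ)).le
  rw [le_div_iff₀ hδ] at h1 h3
  rw [div_le_iff₀ hδ] at h2 h4
  exact ⟨⟨h1, h2⟩, by linarith, by linarith⟩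

theorem gridUnion_subset : gridUnion o δ Ω ⊆ Ω := iUnion₂_subset fun _ h => h

theorem cell_subset_gridUnion (h : cell o δ p q ⊆ Ω) : cell o δ p q ⊆ gridUnion o δ Ω :=
  subset_biUnion_of_mem (u := fun κ : ℤ × ℤ => cell o δ κ.1 κ.2) (x := (p, q)) h

theorem finite_cells_subset (hδ : 0 < δ) (hΩ : Bornology.IsBounded Ω) :
    {κ : ℤ × ℤ | cell o δ κ.1 κ.2 ⊆ Ω}.Finite := by
  obtain ⟨R, hR⟩ := hΩ.subset_closedBall 0
  have hfin : ∀ c : ℝ, {n : ℤ | |c + n * δ| ≤ R}.Finite := by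
    intro c
    refine (finite_Icc ⌊(-R - c) / δ⌋ ⌈(R - c) / δ⌉).subset fun n hn => ?_
    obtain ⟨h1, h2⟩ := abs_le.1 (show |c + n * δ| ≤ R from hn)
    constructor
    · have : (-R - c) / δ ≤ n := by rw [div_le_iff₀ hδ]; linarith
      exact_mod_cast (Int.floor_le _).trans this
    · have : n ≤ (R - c) / δ := by rw [le_div_iff₀ hδ]; linarith
      exact_mod_cast this.trans (Int.le_ceil _)
  refine ((hfin 0).prod (hfin o)).subset fun κ hκ => ?_
  have hmem : (⟨κ.1 * δ, o + κ.2 * δ⟩ : ℂ) ∈ cell o δ κ.1 κ.2 := by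
    rw [mem_cell]; exact ⟨⟨le_rfl, by nlinarith⟩, le_rfl, by nlinarith⟩
  have hn : ‖(⟨κ.1 * δ, o + κ.2 * δ⟩ : ℂ)‖ ≤ R := by simpa using hR (hκ hmem)
  exact ⟨by simpa using (Complex.abs_re_le_norm _).trans hn, (Complex.abs_im_le_norm _).trans hn⟩

theorem isCompact_gridUnion (hδ : 0 < δ) (hΩ : Bornology.IsBounded Ω) :
    IsCompact (gridUnion o δ Ω) :=
  (finite_cells_subset hδ hΩ).isCompact_biUnion fun _ _ => isCompact_cell

theorem ball_subset_gridUnion (hδ : 0 < δ) {z : ℂ} (hz : closedBall z (3 * δ) ⊆ Ω) :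
    ball z δ ⊆ gridUnion o δ Ω := by
  intro w hw
  refine cell_subset_gridUnion (fun x hx => hz ?_) (mem_cell_floor hδ w)
  have h1 := dist_le_of_mem_cell hx (mem_cell_floor hδ w)
  have h2 := dist_triangle x w z
  rw [mem_ball] at hw
  rw [mem_closedBall]
  linarith

theorem mem_interior_gridUnion (hδ : 0 < δ) {z : ℂ} (hz : closedBall z (3 * δ) ⊆ Ω) :
    z ∈ interior (gridUnion o δ Ω) :=
  mem_interior.2 ⟨ball z δ, ball_subset_gridUnion hδ hz, isOpen_ball, mem_ball_self hδ⟩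

/-- The interior of a grid square. -/
def openCell (o δ : ℝ) (p q : ℤ) : Set ℂ :=
  Ioo (p * δ) ((p + 1) * δ) ×ℂ Ioo (o + q * δ) (o + (q + 1) * δ)

theorem closure_openCell (hδ : 0 < δ) : closure (openCell o δ p q) = cell o δ p q := by
  rw [openCell, Complex.closure_reProdIm, closure_Ioo (by nlinarith), closure_Ioo (by nlinarith),
    cell]

theorem disjoint_openCell_gridUnion (hδ : 0 < δ) (h : ¬ cell o δ p q ⊆ Ω) :
    Disjoint (openCell o δ p q) (gridUnion o δ Ω) := by
  rw [disjoint_left]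
  intro z hz hJ
  obtain ⟨κ, hκ, hzκ⟩ := mem_iUnion₂.1 hJ
  rw [mem_cell] at hzκ
  obtain ⟨⟨h1, h2⟩, h3, h4⟩ : (p * δ < z.re ∧ z.re < (p + 1) * δ) ∧
    o + q * δ < z.im ∧ z.im < o + (q + 1) * δ := hz
  have key : ∀ {a b : ℤ}, (a : ℝ) * δ < (b + 1) * δ → a < b + 1 := fun {a b} hab => by
    exact_mod_cast lt_of_mul_lt_mul_right hab hδ.le
  have e1 := key (show (p : ℝ) * δ < (κ.1 + 1) * δ by linarith)
  have e2 := key (show (κ.1 : ℝ) * δ < (p + 1) * δ by linarith)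
  have e3 := key (show (q : ℝ) * δ < (κ.2 + 1) * δ by linarith)
  have e4 := key (show (κ.2 : ℝ) * δ < (q + 1) * δ by linarith)
  obtain rfl : p = κ.1 := by lia
  obtain rfl : q = κ.2 := by lia
  exact h hκ

theorem mem_frontier_gridUnion {p' q' : ℤ} (hδ : 0 < δ) (h : cell o δ p q ⊆ Ω)
    (h' : ¬ cell o δ p' q' ⊆ Ω) {z : ℂ} (hz : z ∈ cell o δ p q) (hz' : z ∈ cell o δ p' q') :
    z ∈ frontier (gridUnion o δ Ω) := by
  rw [frontier_eq_closure_inter_closure]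
  refine ⟨subset_closure (cell_subset_gridUnion h hz), ?_⟩
  rw [← closure_openCell hδ] at hz'
  exact closure_mono (disjoint_openCell_gridUnion hδ h').subset_compl_right hz'

theorem isPreconnected_compl_gridUnion (hδ : 0 < δ) (hΩ : IsPreconnected Ωᶜ)
    (hne : Ωᶜ.Nonempty) : IsPreconnected (gridUnion o δ Ω)ᶜ := by
  obtain ⟨x₀, hx₀⟩ := hne
  have hsub : Ωᶜ ⊆ (gridUnion o δ Ω)ᶜ := compl_subset_compl.2 gridUnion_subset
  refine isPreconnected_of_forall x₀ fun y hy => ?_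
  set p := ⌊y.re / δ⌋
  set q := ⌊(y.im - o) / δ⌋
  have hyc : y ∈ cell o δ p q := mem_cell_floor hδ y
  have hnot : ¬ cell o δ p q ⊆ Ω := fun h => hy (cell_subset_gridUnion h hyc)
  obtain ⟨w, hw, hwΩ⟩ := not_subset.1 hnot
  have hconn : IsPreconnected (cell o δ p q \ gridUnion o δ Ω) := by
    refine IsPreconnected.subset_closure (s := openCell o δ p q)
      (convex_reProdIm (convex_Ioo _ _) (convex_Ioo _ _)).isPreconnected ?_ ?_
    · exact fun z hz => ⟨closure_openCell hδ ▸ subset_closure hz,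
        (disjoint_left.1 (disjoint_openCell_gridUnion hδ hnot)) hz⟩
    · rw [closure_openCell hδ]; exact sdiff_subset
  refine ⟨Ωᶜ ∪ cell o δ p q \ gridUnion o δ Ω, union_subset hsub fun z hz => hz.2, Or.inl hx₀,
    Or.inr ⟨hyc, hy⟩, hΩ.union w hwΩ ⟨hw, hsub hwΩ⟩ hconn⟩

theorem isPreconnected_compl_connectedComponentIn {C : Set ℂ} (hC : IsClosed C)
    (hconn : IsConnected C) {l : ℂ} : IsPreconnected (connectedComponentIn Cᶜ l)ᶜ := by
  obtain ⟨c, hc⟩ := hconn.nonempty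
  have hCsub : C ⊆ (connectedComponentIn Cᶜ l)ᶜ :=
    subset_compl_comm.1 (connectedComponentIn_subset _ _)
  refine isPreconnected_of_forall c fun x hx => ?_
  by_cases hxC : x ∈ C
  · exact ⟨C, hCsub, hc, hxC, hconn.isPreconnected⟩
  set D := connectedComponentIn Cᶜ x with hD
  have hDo : IsOpen D := hC.isOpen_compl.connectedComponentIn
  have hLo : IsOpen (connectedComponentIn Cᶜ l) := hC.isOpen_compl.connectedComponentIn
  have hxD : x ∈ D := mem_connectedComponentIn hxC
  have hdisj : Disjoint D (connectedComponentIn Cᶜ l) := by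
    rw [disjoint_left]
    intro y hy hy'
    refine hx ?_
    rw [connectedComponentIn_eq hy', ← connectedComponentIn_eq hy]
    exact hxD
  have hcl : closure D ⊆ (connectedComponentIn Cᶜ l)ᶜ :=
    closure_minimal hdisj.subset_compl_right hLo.isClosed_compl
  have hDp : IsPreconnected D := isPreconnected_connectedComponentIn
  obtain ⟨y, hyD, hyC⟩ : (closure D ∩ C).Nonempty := by
    by_contra hemp
    rw [not_nonempty_iff_eq_empty, ← disjoint_iff_inter_eq_empty] at hemp
    have h1 : closure D ⊆ D := hDp.closure.subset_connectedComponentIn (subset_closure hxD)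
      hemp.subset_compl_right
    have h2 : IsClopen D := ⟨closure_subset_iff_isClosed.1 h1, hDo⟩
    rcases isClopen_iff.1 h2 with h | h
    · rw [h] at hxD; exact hxD
    · exact connectedComponentIn_subset Cᶜ x (by rw [← hD, h]; trivial) hc
  exact ⟨C ∪ closure D, union_subset hCsub hcl, Or.inl hc, Or.inr (subset_closure hxD),
    hconn.isPreconnected.union y hyC hyD hDp.closure⟩

end HullDim

namespace HullDim
open Set Metric
open scoped ENNReal

theorem volume_image_le_hausdorffMeasure {X : Type*} [MetricSpace X] [MeasurableSpace X]
    [BorelSpace X] {f : X → ℝ} (hf : LipschitzWith 1 f) (B : Set X) :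
    volume (f '' B) ≤ μH[1] B := by
  have := (hf.lipschitzOnWith (s := B)).hausdorffMeasure_image_le zero_le_one
  simpa [hausdorffMeasure_real] using this

/-- Eilenberg's inequality for the counting function of the fibres of a `1`-Lipschitz function. -/
theorem exists_measurable_multiplicity_bound {X : Type*} [MetricSpace X]
    [SecondCountableTopology X] [MeasurableSpace X] [BorelSpace X] {f : X → ℝ}
    (hf : LipschitzWith 1 f) {B : Set X} (hB : MeasurableSet B) :
    ∃ g : ℝ → ℝ≥0∞, Measurable g ∧
      (∀ t, ∀ T : Finset X, ↑T ⊆ B → (∀ x ∈ T, f x = t) → (T.card : ℝ≥0∞) ≤ g t) ∧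
      ∫⁻ t, g t ≤ μH[1] B := by
  classical
  rcases isEmpty_or_nonempty X with hX | hX
  · refine ⟨0, measurable_zero, fun t T _ _ => ?_, by simp⟩
    rw [T.eq_empty_of_isEmpty]; simp
  let P : ℕ → ℕ → Set X := fun m =>
    disjointed fun k => ball (TopologicalSpace.denseSeq X k) (1 / ((m : ℝ) + 1))
  have hPm : ∀ m k, MeasurableSet (P m k) := fun m k =>
    MeasurableSet.disjointed (fun _ => measurableSet_ball) k
  have hPdisj : ∀ m, Pairwise (Function.onFun Disjoint (P m)) := fun m => disjoint_disjointed _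
  have hPuniv : ∀ m, ⋃ k, P m k = univ := by
    intro m
    rw [iUnion_disjointed, eq_univ_iff_forall]
    intro x
    obtain ⟨k, hk⟩ := (TopologicalSpace.denseRange_denseSeq X).exists_dist_lt x
      (show 0 < 1 / ((m : ℝ) + 1) by positivity)
    exact mem_iUnion.2 ⟨k, hk⟩
  have hPdist : ∀ m k x y, x ∈ P m k → y ∈ P m k → dist x y < 2 / ((m : ℝ) + 1) := by
    intro m k x y hx hy
    have h1 := disjointed_subset _ _ hx
    have h2 := disjointed_subset _ _ hy
    rw [mem_ball] at h1 h2
    have := dist_triangle_right x y (TopologicalSpace.denseSeq X k)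
    have h3 : 2 / ((m : ℝ) + 1) = 1 / ((m : ℝ) + 1) + 1 / ((m : ℝ) + 1) := by ring
    linarith
  let M : ℕ → ℕ → Set ℝ := fun m k => toMeasurable volume (f '' (B ∩ P m k))
  let G : ℕ → ℝ → ℝ≥0∞ := fun m t => ∑' k, (M m k).indicator 1 t
  have hGm : ∀ m, Measurable (G m) := fun m => Measurable.tsum fun k =>
    measurable_one.indicator (measurableSet_toMeasurable _ _)
  have hGint : ∀ m, ∫⁻ t, G m t ≤ μH[1] B := by
    intro m
    calc ∫⁻ t, G m t = ∑' k, ∫⁻ t, (M m k).indicator 1 t :=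
          lintegral_tsum fun k =>
            (measurable_one.indicator (measurableSet_toMeasurable _ _)).aemeasurable
      _ = ∑' k, volume (f '' (B ∩ P m k)) := by
          refine tsum_congr fun k => ?_
          rw [lintegral_indicator_one (measurableSet_toMeasurable _ _), measure_toMeasurable]
      _ ≤ ∑' k, μH[1] (B ∩ P m k) :=
          ENNReal.tsum_le_tsum fun k => volume_image_le_hausdorffMeasure hf _
      _ = μH[1] (⋃ k, B ∩ P m k) := (measure_iUnion
          (fun i j hij => (hPdisj m hij).mono inter_subset_right inter_subset_right)
          fun k => hB.inter (hPm m k)).symm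
      _ = μH[1] B := by rw [← inter_iUnion, hPuniv, inter_univ]
  refine ⟨fun t => Filter.liminf (fun m => G m t) Filter.atTop, Measurable.liminf hGm, ?_, ?_⟩
  · intro t T hTB hTt
    refine Filter.le_liminf_of_le (by isBoundedDefault) ?_
    obtain ⟨d, hd, hsep⟩ : ∃ d > 0, ∀ x ∈ T, ∀ y ∈ T, x ≠ y → d ≤ dist x y := by
      rcases T.offDiag.eq_empty_or_nonempty with he | hne
      · refine ⟨1, one_pos, fun x hx y hy hxy => ?_⟩
        have : (x, y) ∈ T.offDiag := by simp [hx, hy, hxy]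
        simp [he] at this
      · obtain ⟨p, hp, hmin⟩ := T.offDiag.exists_min_image (fun p => dist p.1 p.2) hne
        refine ⟨dist p.1 p.2, dist_pos.2 (Finset.mem_offDiag.1 hp).2.2, fun x hx y hy hxy => ?_⟩
        exact hmin (x, y) (by simp [hx, hy, hxy])
    have hev : ∀ᶠ m : ℕ in Filter.atTop, 2 / ((m : ℝ) + 1) < d := by
      have := tendsto_one_div_add_atTop_nhds_zero_nat (𝕜 := ℝ)
      have h2 := (this.const_mul 2).eventually (gt_mem_nhds (show 2 * 0 < d by simpa using hd))
      filter_upwards [h2] with m hm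
      rwa [mul_one_div] at hm
    filter_upwards [hev] with m hm
    have hidx : ∀ x, ∃ k, x ∈ P m k := fun x => mem_iUnion.1 (hPuniv m ▸ mem_univ x)
    choose k hk using hidx
    have hinj : Set.InjOn k T := by
      intro x hx y hy hxy
      by_contra hne
      have h1 := hsep x hx y hy hne
      have h2 := hPdist m (k x) x y (hk x) (hxy ▸ hk y)
      linarith
    calc (T.card : ℝ≥0∞) = ∑ j ∈ T.image k, (1 : ℝ≥0∞) := by
          rw [Finset.sum_const, Finset.card_image_of_injOn hinj]; simp
      _ ≤ ∑ j ∈ T.image k, (M m j).indicator 1 t := by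
          refine Finset.sum_le_sum fun j hj => ?_
          obtain ⟨x, hx, rfl⟩ := Finset.mem_image.1 hj
          rw [indicator_of_mem]
          · simp
          · exact subset_toMeasurable _ _ ⟨x, ⟨hTB hx, hk x⟩, hTt x hx⟩
      _ ≤ G m t := ENNReal.sum_le_tsum _
  · exact (lintegral_liminf_le hGm).trans
      ((Filter.liminf_le_liminf (Filter.Eventually.of_forall hGint)).trans (by simp))

theorem le_hausdorffMeasure_inter_ball {C : Set ℂ} (hC : IsPreconnected C) {c c' : ℂ} (hc : c ∈ C)
    (hc' : c' ∈ C) {r : ℝ} (hr : r ≤ dist c' c) : ENNReal.ofReal r ≤ μH[1] (C ∩ ball c r) := by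
  have hl : LipschitzWith 1 fun z : ℂ => dist z c := LipschitzWith.dist_left c
  refine le_trans ?_ (volume_image_le_hausdorffMeasure hl _)
  calc ENNReal.ofReal r = volume (Ico 0 r) := by simp
    _ ≤ _ := measure_mono fun x hx => by
      obtain ⟨z, hz, rfl⟩ := hC.intermediate_value hc hc' hl.continuous.continuousOn
        ⟨by simpa using hx.1, hx.2.le.trans hr⟩
      exact ⟨z, ⟨hz, hx.2⟩, rfl⟩

/-- A family of grid squares, each with a disc of radius `δ` of mass at least `δ` centred on it. -/
theorem card_mul_le_of_forall_cell {o δ : ℝ} (hδ : 0 < δ) {ν : Measure ℂ} {V : Set ℂ}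
    (hV : MeasurableSet V) (F : Finset (ℤ × ℤ))
    (hF : ∀ κ ∈ F, ∃ c ∈ cell o δ κ.1 κ.2, ball c δ ⊆ V ∧ ENNReal.ofReal δ ≤ ν (ball c δ)) :
    F.card * ENNReal.ofReal δ ≤ 9 * ν V := by
  let idx : ℂ → ℤ × ℤ := fun z => (⌊z.re / δ⌋, ⌊(z.im - o) / δ⌋)
  have hidx : Measurable idx := by
    refine Measurable.prodMk ?_ ?_
    · exact Int.measurable_floor.comp (Complex.measurable_re.div_const δ)
    · exact Int.measurable_floor.comp ((Complex.measurable_im.sub_const o).div_const δ)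
  let A : Finset (ℤ × ℤ) := Finset.Icc (-1) 1 ×ˢ Finset.Icc (-1) 1
  have hA : A.card = 9 := by decide
  have hms : ∀ κ, MeasurableSet (V ∩ idx ⁻¹' {κ}) := fun κ =>
    hV.inter (hidx (measurableSet_singleton κ))
  have hone : ∀ κ ∈ F, ENNReal.ofReal δ ≤ ∑ e ∈ A, ν (V ∩ idx ⁻¹' {κ + e}) := by
    intro κ hκ
    obtain ⟨c, hc, hcV, hle⟩ := hF κ hκ
    refine hle.trans ((measure_mono ?_).trans (measure_biUnion_finset_le A _))
    intro z hz
    rw [mem_cell] at hc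
    have hd : dist z c < δ := hz
    rw [dist_eq_norm] at hd
    have h1 := abs_lt.1 ((Complex.abs_re_le_norm (z - c)).trans_lt hd)
    have h2 := abs_lt.1 ((Complex.abs_im_le_norm (z - c)).trans_lt hd)
    rw [Complex.sub_re] at h1
    rw [Complex.sub_im] at h2
    have key : ∀ {x : ℝ} {n : ℤ}, (n - 1) * δ ≤ x → x < (n + 2) * δ → ⌊x / δ⌋ - n ∈
        Finset.Icc (-1 : ℤ) 1 := by
      intro x n ha hb
      have h3 : n - 1 ≤ ⌊x / δ⌋ := Int.le_floor.2 (by push_cast; rwa [le_div_iff₀ hδ])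
      have h4 : ⌊x / δ⌋ < n + 2 := Int.floor_lt.2 (by push_cast; rwa [div_lt_iff₀ hδ])
      rw [Finset.mem_Icc]
      lia
    refine mem_iUnion₂.2 ⟨idx z - κ, Finset.mem_product.2 ⟨key ?_ ?_, key ?_ ?_⟩, hcV hz, ?_⟩
    · linarith
    · linarith
    · linarith
    · linarith
    · simp
  calc F.card * ENNReal.ofReal δ = ∑ κ ∈ F, ENNReal.ofReal δ := by simp
    _ ≤ ∑ κ ∈ F, ∑ e ∈ A, ν (V ∩ idx ⁻¹' {κ + e}) := Finset.sum_le_sum hone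
    _ = ∑ e ∈ A, ∑ κ ∈ F, ν (V ∩ idx ⁻¹' {κ + e}) := Finset.sum_comm
    _ ≤ ∑ e ∈ A, ν V := by
        refine Finset.sum_le_sum fun e _ => ?_
        rw [← measure_biUnion_finset (fun κ _ κ' _ hne => ?_) fun κ _ => hms _]
        · exact measure_mono (iUnion₂_subset fun _ _ => inter_subset_left)
        · refine disjoint_left.2 fun z hz hz' => hne ?_
          have h1 : idx z = κ + e := hz.2
          have h2 : idx z = κ' + e := hz'.2
          exact add_right_cancel (h1.symm.trans h2)
    _ = 9 * ν V := by rw [Finset.sum_const, hA]; simp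

end HullDim

namespace HullDim
open Set Metric
open scoped ENNReal

theorem isOpen_setOf_forall_add_mem {W : Set ℂ} (hW : IsOpen W) (e : ℂ) (a b : ℝ) :
    IsOpen {ζ : ℂ | ∀ t ∈ Icc a b, ζ + t * e ∈ W} := by
  rw [isOpen_iff_eventually]
  intro ζ hζ
  refine isCompact_Icc.eventually_forall_of_forall_eventually
    (P := fun (z : ℂ) (t : ℝ) => z + t * e ∈ W) fun t ht => ?_
  have hc : Continuous fun p : ℂ × ℝ => p.1 + p.2 * e := by fun_prop
  exact (hW.preimage hc).mem_nhds (hζ t ht)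

theorem measurableSet_setOf_forall_add_mem {W : Set ℂ} (hW : IsOpen W) (e : ℂ) (b : ℝ) :
    MeasurableSet {ζ : ℂ | ∀ t ∈ Ioc 0 b, ζ + t * e ∈ W} := by
  have : {ζ : ℂ | ∀ t ∈ Ioc 0 b, ζ + t * e ∈ W} =
      ⋂ j : ℕ, {ζ : ℂ | ∀ t ∈ Icc (1 / ((j : ℝ) + 1)) b, ζ + t * e ∈ W} := by
    ext ζ
    simp only [mem_ofPred_eq, mem_iInter]
    refine ⟨fun h j t ht => h t ⟨lt_of_lt_of_le (by positivity) ht.1, ht.2⟩, fun h t ht => ?_⟩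
    obtain ⟨j, hj⟩ := exists_nat_one_div_lt ht.1
    exact h j t ⟨hj.le, ht.2⟩
  rw [this]
  exact MeasurableSet.iInter fun j => (isOpen_setOf_forall_add_mem hW e _ b).measurableSet

theorem volume_setOf_infinite_fibre {X : Type*} [MetricSpace X]
    [SecondCountableTopology X] [MeasurableSpace X] [BorelSpace X] {f : X → ℝ}
    (hf : LipschitzWith 1 f) {B : Set X} (hB : MeasurableSet B) (hfin : μH[1] B < ∞) :
    volume {t | (B ∩ f ⁻¹' {t}).Infinite} = 0 := by
  obtain ⟨g, hg, hle, h_int⟩ := exists_measurable_multiplicity_bound hf hB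
  have := ae_lt_top hg (h_int.trans_lt hfin).ne
  refine measure_mono_null (fun t ht => ?_) (ae_iff.1 this)
  simp only [mem_ofPred_eq, not_lt, top_le_iff]
  refine ENNReal.eq_top_of_forall_nnreal_le fun r => ?_
  obtain ⟨n, hn⟩ := exists_nat_gt r
  obtain ⟨T, hT, hTc⟩ := Set.Infinite.exists_subset_card_eq ht n
  refine le_trans ?_ (hle t T (hT.trans inter_subset_left) fun x hx => (hT hx).2)
  rw [hTc]
  exact_mod_cast hn.le

/-- On a vertical line meeting `C` finitely often and meeting `V`, there is a last exit from `V`. -/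
theorem exists_crossing {C W V : Set ℂ} (hWo : IsOpen W) (hVo : IsOpen V)
    (hWV : W ∪ V = Cᶜ) (hdisj : Disjoint W V) (hVb : Bornology.IsBounded V) {v : ℂ} (hv : v ∈ V)
    (hfin : (C ∩ Complex.re ⁻¹' {v.re}).Finite) :
    ∃ ζ ∈ C, ζ.re = v.re ∧ ∃ h > 0, ∀ t ∈ Ioc (0 : ℝ) h,
      ζ + t * Complex.I ∈ W ∧ ζ + t * (-Complex.I) ∈ V := by
  set L : ℝ → ℂ := fun y => ⟨v.re, y⟩ with hL
  have hLc : Continuous L := by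
    have : L = fun y : ℝ => (v.re : ℂ) + y * Complex.I := by
      ext y; apply Complex.ext <;> simp [hL]
    rw [this]; fun_prop
  have hLV : IsOpen (L ⁻¹' V) := hVo.preimage hLc
  have hLW : IsOpen (L ⁻¹' W) := hWo.preimage hLc
  have hne : (L ⁻¹' V).Nonempty := ⟨v.im, hv⟩
  have hbdd : BddAbove (L ⁻¹' V) := by
    obtain ⟨R, hR⟩ := hVb.subset_closedBall 0
    refine ⟨R, fun y hy => ?_⟩
    have h1 : ‖L y‖ ≤ R := by simpa using hR hy
    exact (le_abs_self _).trans ((Complex.abs_im_le_norm (L y)).trans h1)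
  set s := sSup (L ⁻¹' V) with hs
  have hlub := isLUB_csSup hne hbdd
  have hsV : s ∉ L ⁻¹' V := fun hmem => by
    obtain ⟨ε, hε, hb⟩ := Metric.isOpen_iff.1 hLV s hmem
    have : s + ε / 2 ∈ L ⁻¹' V := hb (by
      rw [mem_ball, Real.dist_eq, add_sub_cancel_left, abs_of_pos (by linarith)]; linarith)
    linarith [hlub.1 this]
  have hsW : s ∉ L ⁻¹' W := fun hmem => by
    obtain ⟨ε, hε, hb⟩ := Metric.isOpen_iff.1 hLW s hmem
    obtain ⟨y, hy, h1, h2⟩ := hlub.exists_between (show s - ε < s by linarith)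
    refine disjoint_left.1 hdisj (hb ?_) hy
    rw [mem_ball, Real.dist_eq, abs_lt]; constructor <;> linarith
  have hcases : ∀ y, L y ∉ C → L y ∈ W ∨ L y ∈ V := fun y hy => by
    have : L y ∈ W ∪ V := hWV ▸ hy
    exact this
  have hsC : L s ∈ C := by
    by_contra h
    exact (hcases s h).elim hsW hsV
  obtain ⟨h, hh, hfree⟩ : ∃ h > 0, ∀ y, y ≠ s → |y - s| ≤ h → L y ∉ C := by
    have hinj : Function.Injective L := fun a b hab => congrArg Complex.im hab
    have hF : (L ⁻¹' C \ {s}).Finite :=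
      ((hfin.subset (by rintro _ ⟨y, hy, rfl⟩; exact ⟨hy, rfl⟩ :
        L '' (L ⁻¹' C) ⊆ C ∩ Complex.re ⁻¹' {v.re})).of_finite_image hinj.injOn).subset sdiff_subset
    have hnb : (L ⁻¹' C \ {s})ᶜ ∈ nhds s := hF.isClosed.isOpen_compl.mem_nhds fun h => h.2 rfl
    obtain ⟨ε, hε, hb⟩ := Metric.mem_nhds_iff.1 hnb
    refine ⟨ε / 2, by positivity, fun y hy hy2 hyC => ?_⟩
    refine hb (show y ∈ ball s ε by rw [mem_ball, Real.dist_eq]; linarith) ⟨hyC, hy⟩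
  refine ⟨L s, hsC, rfl, h, hh, fun t ht => ?_⟩
  have e1 : L s + t * Complex.I = L (s + t) := by apply Complex.ext <;> simp [hL]
  have e2 : L s + t * (-Complex.I) = L (s - t) := by
    apply Complex.ext <;> simp [hL]; ring
  rw [e1, e2]
  constructor
  · refine (hcases _ (hfree _ (by linarith [ht.1]) ?_)).resolve_right fun hm => ?_
    · rw [add_sub_cancel_left, abs_of_pos ht.1]; exact ht.2
    · linarith [hlub.1 (show s + t ∈ L ⁻¹' V from hm), ht.1]
  · refine (hcases _ (hfree _ (by linarith [ht.1]) ?_)).resolve_left fun hm => ?_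
    · rw [sub_sub_cancel_left, abs_neg, abs_of_pos ht.1]; exact ht.2
    obtain ⟨y, hy, h1, h2⟩ := hlub.exists_between (show s - h < s by linarith)
    have hys : y ≠ s := fun e => hsV (e ▸ hy)
    have hpre : IsPreconnected (Ico (s - h) s) := isPreconnected_Ico
    obtain ⟨x, -, hx1, hx2⟩ := hpre _ _ hLW hLV (fun x hx => hcases x (hfree x hx.2.ne (by
      rw [abs_le]; constructor <;> linarith [hx.1, hx.2])))
      ⟨s - t, ⟨by linarith [ht.2], by linarith [ht.1]⟩, hm⟩
      ⟨y, ⟨h1.le, lt_of_le_of_ne h2 hys⟩, hy⟩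
    exact disjoint_left.1 hdisj hx1 hx2

theorem exists_compact_crossing_set {C W V : Set ℂ} (hC : IsCompact C) (hCH : μH[1] C < ∞)
    (hWo : IsOpen W) (hVo : IsOpen V) (hWV : W ∪ V = Cᶜ) (hdisj : Disjoint W V)
    (hVb : Bornology.IsBounded V) (hVne : V.Nonempty) {N : Set ℝ} (hN : volume N = 0) :
    ∃ l ∈ V, ∃ h > 0, ∃ S ⊆ C, IsCompact S ∧ 0 < volume (Complex.re '' S) ∧
      ∀ ζ ∈ S, ζ.re ∉ N ∧ ∀ t ∈ Ioc (0 : ℝ) h,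
        ζ + t * Complex.I ∈ W ∧ ζ + t * (-Complex.I) ∈ connectedComponentIn Cᶜ l := by
  have hre : LipschitzWith 1 Complex.re := by
    refine LipschitzWith.of_dist_le_mul fun z w => ?_
    rw [NNReal.coe_one, one_mul, Real.dist_eq, dist_eq_norm, ← Complex.sub_re]
    exact Complex.abs_re_le_norm _
  have hCo : IsOpen Cᶜ := hC.isClosed.isOpen_compl
  let q := TopologicalSpace.denseSeq ℂ
  let S : ℕ × ℕ → Set ℂ := fun nk => {ζ | ζ ∈ C ∧ q nk.1 ∈ V ∧ ζ.re ∉ toMeasurable volume N ∧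
    (∀ t ∈ Ioc (0 : ℝ) (1 / (nk.2 + 1)), ζ + t * Complex.I ∈ W) ∧
    ∀ t ∈ Ioc (0 : ℝ) (1 / (nk.2 + 1)), ζ + t * (-Complex.I) ∈ connectedComponentIn Cᶜ (q nk.1)}
  have hcompV : ∀ l ∈ V, connectedComponentIn Cᶜ l ⊆ V := by
    intro l hl x hx
    have hlC : l ∈ Cᶜ := hWV ▸ Or.inr hl
    have hsub : connectedComponentIn Cᶜ l ⊆ W ∪ V := hWV ▸ connectedComponentIn_subset _ _
    refine (hsub hx).resolve_left fun hxW => ?_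
    obtain ⟨y, -, h1, h2⟩ := isPreconnected_connectedComponentIn W V hWo hVo hsub ⟨x, hx, hxW⟩
      ⟨l, mem_connectedComponentIn hlC, hl⟩
    exact disjoint_left.1 hdisj h1 h2
  have hcover : Complex.re '' V ⊆ (toMeasurable volume N ∪
      {t | (C ∩ Complex.re ⁻¹' {t}).Infinite}) ∪ ⋃ nk, Complex.re '' S nk := by
    rintro _ ⟨v, hv, rfl⟩
    by_cases hb : v.re ∈ toMeasurable volume N ∪ {t | (C ∩ Complex.re ⁻¹' {t}).Infinite}
    · exact Or.inl hb
    right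
    simp only [mem_union, mem_ofPred_eq, not_or, not_infinite] at hb
    obtain ⟨ζ, hζ, hζv, h, hh, hcr⟩ := exists_crossing hWo hVo hWV hdisj hVb hv hb.2
    set w := ζ + (h : ℝ) * (-Complex.I) with hw
    have hwV : w ∈ V := (hcr h ⟨hh, le_rfl⟩).2
    have hwC : w ∈ Cᶜ := hWV ▸ Or.inr hwV
    have hDo : IsOpen (connectedComponentIn Cᶜ w) := hCo.connectedComponentIn
    obtain ⟨n, hn⟩ := (TopologicalSpace.denseRange_denseSeq ℂ).exists_mem_open hDo
      ⟨w, mem_connectedComponentIn hwC⟩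
    obtain ⟨k, hk⟩ := exists_nat_one_div_lt hh
    refine mem_iUnion.2 ⟨(n, k), ζ, ⟨hζ, hcompV w hwV hn, hζv ▸ hb.1, fun t ht =>
      (hcr t ⟨ht.1, ht.2.trans hk.le⟩).1, fun t ht => ?_⟩, hζv⟩
    rw [← connectedComponentIn_eq hn]
    have hpre : IsPreconnected ((fun t : ℝ => ζ + t * (-Complex.I)) '' Ioc 0 h) :=
      isPreconnected_Ioc.image _ (by fun_prop)
    refine hpre.subset_connectedComponentIn ⟨h, ⟨hh, le_rfl⟩, rfl⟩ ?_
      ⟨t, ⟨ht.1, ht.2.trans hk.le⟩, rfl⟩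
    rintro _ ⟨t, ht, rfl⟩
    exact hWV ▸ Or.inr (hcr t ht).2
  have hpos : 0 < volume (Complex.re '' V) := by
    obtain ⟨v, hv⟩ := hVne
    obtain ⟨ε, hε, hb⟩ := Metric.isOpen_iff.1 hVo v hv
    refine lt_of_lt_of_le (?_ : 0 < volume (ball v.re ε)) (measure_mono fun x hx => ?_)
    · rw [Real.volume_ball]; simpa using hε
    · refine ⟨⟨x, v.im⟩, hb ?_, rfl⟩
      rw [mem_ball, Complex.dist_eq_re_im]
      simpa [Real.sqrt_sq_eq_abs, Real.dist_eq] using hx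
  obtain ⟨nk, hnk⟩ : ∃ nk, 0 < volume (Complex.re '' S nk) := by
    by_contra! hall
    refine hpos.ne' (measure_mono_null hcover ?_)
    exact measure_union_null (measure_union_null (by rw [measure_toMeasurable, hN])
      (volume_setOf_infinite_fibre hre hC.isClosed.measurableSet hCH))
      (measure_iUnion_null fun nk => le_antisymm (hall nk) bot_le)
  have hSm : MeasurableSet (S nk) := by
    refine hC.isClosed.measurableSet.inter (MeasurableSet.inter (MeasurableSet.const _) ?_)
    refine MeasurableSet.inter ?_ (MeasurableSet.inter
      (measurableSet_setOf_forall_add_mem hWo _ _)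
      (measurableSet_setOf_forall_add_mem hCo.connectedComponentIn _ _))
    exact (Complex.measurable_re (measurableSet_toMeasurable _ _)).compl
  have hSC : S nk ⊆ C := fun ζ hζ => hζ.1
  have : IsFiniteMeasure (μH[1].restrict C : Measure ℂ) := ⟨by simpa using hCH⟩
  obtain ⟨K, hKS, hK, hlt⟩ := hSm.exists_isCompact_sdiff_lt
    (μ := (μH[1].restrict C : Measure ℂ)) (measure_ne_top _ _) hnk.ne'
  have hl : q nk.1 ∈ V := by
    by_contra hq
    have : S nk = ∅ := by ext ζ; simp [S, hq]
    rw [this] at hnk; simp at hnk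
  refine ⟨q nk.1, hl, 1 / (nk.2 + 1), by positivity, K, hKS.trans hSC, hK, ?_, fun ζ hζ =>
    ⟨fun h => (hKS hζ).2.2.1 (subset_toMeasurable _ _ h), fun t ht =>
      ⟨(hKS hζ).2.2.2.1 t ht, (hKS hζ).2.2.2.2 t ht⟩⟩⟩
  rw [pos_iff_ne_zero]
  intro h0
  rw [Measure.restrict_apply (hSm.diff hK.isClosed.measurableSet),
    inter_eq_left.2 (sdiff_subset.trans hSC)] at hlt
  refine absurd hlt (not_lt.2 ?_)
  calc volume (Complex.re '' S nk) ≤ volume (Complex.re '' K ∪ Complex.re '' (S nk \ K)) := by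
        rw [← image_union, union_sdiff_cancel hKS]
    _ ≤ volume (Complex.re '' K) + volume (Complex.re '' (S nk \ K)) := measure_union_le _ _
    _ ≤ 0 + μH[1] (S nk \ K) := add_le_add h0.le (volume_image_le_hausdorffMeasure hre _)
    _ = _ := zero_add _

end HullDim

namespace HullDim
open Set Metric
open scoped ENNReal

/-- One-dimensional crossing lemma: every point of `C` in the segment has `w` just above it and
`o` just below it. -/
theorem mem_and_notMem_of_crossings {C w o S : Set ℝ} (hC : IsClosed C)
    (ho : ∀ a b, a ≤ b → Disjoint (Icc a b) C → (a ∈ o ↔ b ∈ o))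
    (hw : ∀ a b, a ≤ b → Disjoint (Icc a b) C → (a ∈ w → b ∈ w))
    (hwo : Disjoint w o) (hoC : Disjoint o C) {h : ℝ} (hh : 0 < h)
    (hS : ∀ s ∈ S, ∀ t ∈ Ioc 0 h, s + t ∈ w ∧ s - t ∈ o) (hSC : S ⊆ C) {y₀ y₁ : ℝ}
    (hy : y₀ ≤ y₁) (hy₀ : y₀ ∉ C) (hCS : C ∩ Icc y₀ y₁ ⊆ S) :
    (y₁ ∈ o → y₀ ∈ o) ∧ ((S ∩ Icc y₀ y₁).Nonempty → y₀ ∈ o ∧ y₁ ∉ o) := by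
  rcases (C ∩ Icc y₀ y₁).eq_empty_or_nonempty with he | hne
  · refine ⟨fun h1 => (ho y₀ y₁ hy ?_).2 h1, fun ⟨s, hs, hs'⟩ => ?_⟩
    · rw [disjoint_iff_inter_eq_empty, inter_comm]; exact he
    · exact absurd he (Nonempty.ne_empty ⟨s, hSC hs, hs'⟩)
  have hcomp : IsCompact (C ∩ Icc y₀ y₁) := isCompact_Icc.inter_left hC
  have hmin := hcomp.sInf_mem hne
  have hmax := hcomp.sSup_mem hne
  set s := sInf (C ∩ Icc y₀ y₁)
  set s' := sSup (C ∩ Icc y₀ y₁)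
  have hs : y₀ < s := lt_of_le_of_ne hmin.2.1 fun e => hy₀ (e ▸ hmin.1)
  have h0 : y₀ ∈ o := by
    have hpos : 0 < min h (s - y₀) := lt_min hh (by linarith)
    refine (ho y₀ (s - min h (s - y₀)) (by linarith [min_le_right h (s - y₀)]) ?_).2
      (hS s (hCS hmin) _ ⟨hpos, min_le_left _ _⟩).2
    refine disjoint_left.2 fun y hy1 hy2 => ?_
    have : s ≤ y := csInf_le hcomp.bddBelow ⟨hy2, hy1.1, by linarith [hy1.2, hmin.2.2]⟩
    linarith [hy1.2]
  have h1 : y₁ ∉ o := by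
    by_cases hy1C : y₁ ∈ C
    · exact fun h => disjoint_left.1 hoC h hy1C
    have hs' : s' < y₁ := lt_of_le_of_ne hmax.2.2 fun e => hy1C (e ▸ hmax.1)
    have hpos : 0 < min h (y₁ - s') := lt_min hh (by linarith)
    refine disjoint_left.1 hwo (hw (s' + min h (y₁ - s')) y₁
      (by linarith [min_le_right h (y₁ - s')]) ?_
      (hS s' (hCS hmax) _ ⟨hpos, min_le_left _ _⟩).1)
    refine disjoint_left.2 fun y hy1 hy2 => ?_
    have : y ≤ s' := le_csSup hcomp.bddAbove ⟨hy2, by linarith [hy1.1, hmax.2.1], hy1.2⟩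
    linarith [hy1.1]
  exact ⟨fun _ => h0, fun _ => ⟨h0, h1⟩⟩

theorem vertical_isPreconnected (x a b : ℝ) :
    IsPreconnected ((fun y : ℝ => (⟨x, y⟩ : ℂ)) '' Icc a b) := by
  refine isPreconnected_Icc.image _ (Continuous.continuousOn ?_)
  have : (fun y : ℝ => (⟨x, y⟩ : ℂ)) = fun y : ℝ => (x : ℂ) + y * Complex.I := by
    ext y; exact Complex.mk_eq_add_mul_I x y
  rw [this]; fun_prop

theorem segment_crossings {C S W V : Set ℂ} {l : ℂ} (hC : IsClosed C)
    (hWo : IsOpen W) (hVo : IsOpen V) (hWV : W ∪ V = Cᶜ) (hdisj : Disjoint W V) (hl : l ∈ V)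
    {h : ℝ} (hh : 0 < h) (hSC : S ⊆ C)
    (hS : ∀ ζ ∈ S, ∀ t ∈ Ioc (0 : ℝ) h,
        ζ + t * Complex.I ∈ W ∧ ζ + t * (-Complex.I) ∈ connectedComponentIn Cᶜ l)
    {x y₀ y₁ : ℝ} (hy : y₀ ≤ y₁) (hy₀ : (⟨x, y₀⟩ : ℂ) ∉ C)
    (hCS : ∀ y ∈ Icc y₀ y₁, (⟨x, y⟩ : ℂ) ∈ C → (⟨x, y⟩ : ℂ) ∈ S) :
    ((⟨x, y₁⟩ : ℂ) ∈ connectedComponentIn Cᶜ l → (⟨x, y₀⟩ : ℂ) ∈ connectedComponentIn Cᶜ l) ∧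
    ((∃ y ∈ Icc y₀ y₁, (⟨x, y⟩ : ℂ) ∈ S) →
      (⟨x, y₀⟩ : ℂ) ∈ connectedComponentIn Cᶜ l ∧ (⟨x, y₁⟩ : ℂ) ∉ connectedComponentIn Cᶜ l) := by
  have hcont : Continuous fun y : ℝ => (⟨x, y⟩ : ℂ) := by
    have : (fun y : ℝ => (⟨x, y⟩ : ℂ)) = fun y : ℝ => (x : ℂ) + y * Complex.I := by
      ext y; exact Complex.mk_eq_add_mul_I x y
    rw [this]; fun_prop
  have hlC : l ∈ Cᶜ := hWV ▸ Or.inr hl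
  have hΩV : connectedComponentIn Cᶜ l ⊆ V := by
    intro z hz
    have hsub : connectedComponentIn Cᶜ l ⊆ W ∪ V := hWV ▸ connectedComponentIn_subset _ _
    refine (hsub hz).resolve_left fun hzW => ?_
    obtain ⟨y, -, h1, h2⟩ := isPreconnected_connectedComponentIn W V hWo hVo hsub ⟨z, hz, hzW⟩
      ⟨l, mem_connectedComponentIn hlC, hl⟩
    exact disjoint_left.1 hdisj h1 h2
  have hseg : ∀ a b, Disjoint (Icc a b) {y | (⟨x, y⟩ : ℂ) ∈ C} →
      (fun y : ℝ => (⟨x, y⟩ : ℂ)) '' Icc a b ⊆ Cᶜ := by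
    rintro a b hd _ ⟨y, hy, rfl⟩ hyC
    exact disjoint_left.1 hd hy hyC
  have ho : ∀ a b, Disjoint (Icc a b) {y | (⟨x, y⟩ : ℂ) ∈ C} → ∀ c ∈ Icc a b, ∀ d ∈ Icc a b,
      (⟨x, c⟩ : ℂ) ∈ connectedComponentIn Cᶜ l → (⟨x, d⟩ : ℂ) ∈ connectedComponentIn Cᶜ l := by
    intro a b hd c hc d hd' hcΩ
    rw [connectedComponentIn_eq hcΩ]
    exact (vertical_isPreconnected x a b).subset_connectedComponentIn (mem_image_of_mem _ hc)
      (hseg a b hd) (mem_image_of_mem _ hd')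
  have key := mem_and_notMem_of_crossings (C := {y | (⟨x, y⟩ : ℂ) ∈ C})
    (w := {y | (⟨x, y⟩ : ℂ) ∈ W}) (o := {y | (⟨x, y⟩ : ℂ) ∈ connectedComponentIn Cᶜ l})
    (S := {y | (⟨x, y⟩ : ℂ) ∈ S}) (hC.preimage hcont) ?_ ?_ ?_ ?_ hh ?_ (fun y hy => hSC hy) hy hy₀
    (fun y hy => hCS y hy.2 hy.1)
  · exact ⟨key.1, fun ⟨y, hy, hyS⟩ => key.2 ⟨y, hyS, hy⟩⟩
  · intro a b hab hd
    exact ⟨ho a b hd a (left_mem_Icc.2 hab) b (right_mem_Icc.2 hab),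
      ho a b hd b (right_mem_Icc.2 hab) a (left_mem_Icc.2 hab)⟩
  · intro a b hab hd haW
    have hsub := hseg a b hd
    rw [← hWV] at hsub
    refine (hsub (mem_image_of_mem _ (right_mem_Icc.2 hab))).resolve_right fun hV => ?_
    obtain ⟨y, -, h1, h2⟩ := vertical_isPreconnected x a b W V hWo hVo hsub
      ⟨_, mem_image_of_mem _ (left_mem_Icc.2 hab), haW⟩ ⟨_, mem_image_of_mem _ (right_mem_Icc.2 hab), hV⟩
    exact disjoint_left.1 hdisj h1 h2
  · exact disjoint_left.2 fun y h1 h2 => disjoint_left.1 hdisj h1 (hΩV h2)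
  · exact disjoint_left.2 fun y h1 h2 => connectedComponentIn_subset _ _ h1 h2
  · intro s hs t ht
    have := hS _ hs t ht
    have e1 : (⟨x, s + t⟩ : ℂ) = ⟨x, s⟩ + t * Complex.I := by apply Complex.ext <;> simp
    have e2 : (⟨x, s - t⟩ : ℂ) = ⟨x, s⟩ + t * (-Complex.I) := by
      apply Complex.ext <;> simp [sub_eq_add_neg]
    rw [← e1, ← e2] at this
    exact this

/-- The total length of lower edges inside the component minus that of the upper edges. -/
theorem le_sum_integral_edges {C S U W V : Set ℂ} {l : ℂ} (hC : IsClosed C)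
    (hWo : IsOpen W) (hVo : IsOpen V) (hWV : W ∪ V = Cᶜ) (hdisj : Disjoint W V) (hl : l ∈ V)
    {h : ℝ} (hh : 0 < h) (hSC : S ⊆ C) (hScomp : IsCompact S)
    (hS : ∀ ζ ∈ S, ∀ t ∈ Ioc (0 : ℝ) h,
        ζ + t * Complex.I ∈ W ∧ ζ + t * (-Complex.I) ∈ connectedComponentIn Cᶜ l)
    (hU : IsOpen U) {o δ : ℝ} (hδ : 0 < δ) {F : Finset (ℤ × ℤ)}
    (hFU : ∀ κ ∈ F, cell o δ κ.1 κ.2 ⊆ U)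
    (hFS : ∀ κ : ℤ × ℤ, (cell o δ κ.1 κ.2 ∩ S).Nonempty → κ ∈ F)
    (hgen : ∀ᵐ x : ℝ, ∀ k : ℤ, (⟨x, o + k * δ⟩ : ℂ) ∉ C)
    (hfin : μH[1] (C ∩ (U \ S)) < ∞) :
    volume.real (Complex.re '' S) - 2 * (μH[1] (C ∩ (U \ S))).toReal ≤
      ∑ κ ∈ F, ∫ x in (κ.1 * δ : ℝ)..((κ.1 + 1) * δ),
        ((connectedComponentIn Cᶜ l).indicator (fun _ => (1 : ℝ)) ⟨x, o + κ.2 * δ⟩ -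
          (connectedComponentIn Cᶜ l).indicator (fun _ => (1 : ℝ)) ⟨x, o + (κ.2 + 1) * δ⟩) := by
  classical
  set Ω := connectedComponentIn Cᶜ l with hΩ
  have hΩo : IsOpen Ω := hC.isOpen_compl.connectedComponentIn
  have hre : LipschitzWith 1 Complex.re := by
    refine LipschitzWith.of_dist_le_mul fun z w => ?_
    rw [NNReal.coe_one, one_mul, Real.dist_eq, dist_eq_norm, ← Complex.sub_re]
    exact Complex.abs_re_le_norm _
  obtain ⟨g, hgm, hg, hgint⟩ := exists_measurable_multiplicity_bound hre
    (hC.measurableSet.inter (hU.measurableSet.diff hScomp.measurableSet) :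
      MeasurableSet (C ∩ (U \ S)))
  have hgfin : ∀ᵐ x, g x < ∞ := ae_lt_top hgm (hgint.trans_lt hfin).ne
  have hgI : Integrable (fun x => (g x).toReal) :=
    integrable_toReal_of_lintegral_ne_top hgm.aemeasurable (hgint.trans_lt hfin).ne
  have hgI' : ∫ x, (g x).toReal ≤ (μH[1] (C ∩ (U \ S))).toReal := by
    rw [integral_toReal hgm.aemeasurable hgfin]
    exact ENNReal.toReal_mono hfin.ne hgint
  let ω : ℝ → ℝ → ℝ := fun y x => Ω.indicator (fun _ => (1 : ℝ)) ⟨x, y⟩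
  have hωm : ∀ y, Measurable (ω y) := by
    intro y
    have hc : Measurable fun x : ℝ => (⟨x, y⟩ : ℂ) := by
      have : (fun x : ℝ => (⟨x, y⟩ : ℂ)) = fun x : ℝ => (x : ℂ) + y * Complex.I := by
        ext x; exact Complex.mk_eq_add_mul_I x y
      rw [this]; fun_prop
    exact (measurable_const.indicator hΩo.measurableSet).comp hc
  have hω1 : ∀ y x, 0 ≤ ω y x ∧ ω y x ≤ 1 := fun y x =>
    ⟨indicator_nonneg (fun _ _ => zero_le_one) _, indicator_le_self' (fun _ _ => zero_le_one) _⟩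
  let Φ : ℤ × ℤ → ℝ → ℝ := fun κ => (Ioc (κ.1 * δ) ((κ.1 + 1) * δ)).indicator
    fun x => ω (o + κ.2 * δ) x - ω (o + (κ.2 + 1) * δ) x
  have hΦI : ∀ κ, Integrable (Φ κ) := by
    intro κ
    refine IntegrableOn.integrable_indicator ?_ measurableSet_Ioc
    refine Measure.integrableOn_of_bounded (M := 1) (by simp) 
      ((hωm _).sub (hωm _)).aestronglyMeasurable (ae_of_all _ fun x => ?_)
    rw [Real.norm_eq_abs, abs_le]
    constructor <;> linarith [hω1 (o + κ.2 * δ) x, hω1 (o + (κ.2 + 1) * δ) x]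
  have hsum : (∑ κ ∈ F, ∫ x in (κ.1 * δ : ℝ)..((κ.1 + 1) * δ),
      (ω (o + κ.2 * δ) x - ω (o + (κ.2 + 1) * δ) x)) = ∫ x, ∑ κ ∈ F, Φ κ x := by
    rw [integral_finsetSum _ fun κ _ => hΦI κ]
    refine Finset.sum_congr rfl fun κ _ => ?_
    rw [intervalIntegral.integral_of_le (by nlinarith), integral_indicator measurableSet_Ioc]
  have hSm : MeasurableSet (Complex.re '' S) := (hScomp.image Complex.continuous_re).measurableSet
  have hSfin : volume (Complex.re '' S) ≠ ∞ :=
    (hScomp.image Complex.continuous_re).measure_lt_top.ne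
  have hSI : Integrable ((Complex.re '' S).indicator fun _ => (1 : ℝ)) :=
    (integrableOn_const hSfin).integrable_indicator hSm
  have hae : ∀ᵐ x, (Complex.re '' S).indicator (fun _ => (1 : ℝ)) x - 2 * (g x).toReal ≤
      ∑ κ ∈ F, Φ κ x := by
    have hcount : ∀ᵐ x : ℝ, x ∉ range fun k : ℤ => (k * δ : ℝ) :=
      (countable_range _).ae_notMem volume
    filter_upwards [hgfin, hgen, hcount] with x hgx hgenx hcx
    let A : ℤ × ℤ → Prop := fun κ => x ∈ Ioc (κ.1 * δ) ((κ.1 + 1) * δ) ∧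
      ∃ y ∈ Icc (o + κ.2 * δ) (o + (κ.2 + 1) * δ), (⟨x, y⟩ : ℂ) ∈ C \ S
    let B : ℤ × ℤ → Prop := fun κ => x ∈ Ioc (κ.1 * δ) ((κ.1 + 1) * δ) ∧
      ∃ y ∈ Icc (o + κ.2 * δ) (o + (κ.2 + 1) * δ), (⟨x, y⟩ : ℂ) ∈ S
    have hterm : ∀ κ ∈ F, (if B κ then (1 : ℝ) else 0) - 2 * (if A κ then 1 else 0) ≤ Φ κ x := by
      intro κ _
      by_cases hx : x ∈ Ioc (κ.1 * δ) ((κ.1 + 1) * δ)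
      swap
      · have hA : ¬ A κ := fun hA => hx hA.1
        have hB : ¬ B κ := fun hB => hx hB.1
        simp only [Φ, hA, hB, if_false, indicator_of_notMem hx]; norm_num
      simp only [Φ, indicator_of_mem hx]
      have e0 := hω1 (o + κ.2 * δ) x
      have e1 := hω1 (o + (κ.2 + 1) * δ) x
      by_cases hA : A κ
      · rw [if_pos hA]
        split_ifs <;> linarith
      rw [if_neg hA]
      have key := segment_crossings hC hWo hVo hWV hdisj hl hh hSC hS
        (x := x) (y₀ := o + κ.2 * δ) (y₁ := o + (κ.2 + 1) * δ) (by linarith) (hgenx κ.2)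
        (fun y hy hyC => by_contra fun hyS => hA ⟨hx, y, hy, hyC, hyS⟩)
      by_cases hB : B κ
      · rw [if_pos hB]
        obtain ⟨k0, k1⟩ := key.2 hB.2
        have f0 : ω (o + κ.2 * δ) x = 1 := indicator_of_mem k0 _
        have f1 : ω (o + (κ.2 + 1) * δ) x = 0 := indicator_of_notMem k1 _
        linarith
      · rw [if_neg hB]
        by_cases h1 : (⟨x, o + (κ.2 + 1) * δ⟩ : ℂ) ∈ Ω
        · have f0 : ω (o + κ.2 * δ) x = 1 := indicator_of_mem (key.1 h1) _
          linarith
        · have f1 : ω (o + (κ.2 + 1) * δ) x = 0 := indicator_of_notMem h1 _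
          linarith
    refine le_trans ?_ (Finset.sum_le_sum hterm)
    rw [Finset.sum_sub_distrib, ← Finset.mul_sum]
    refine sub_le_sub ?_ (mul_le_mul_of_nonneg_left ?_ zero_le_two)
    · by_cases hxS : x ∈ Complex.re '' S
      · rw [indicator_of_mem hxS]
        obtain ⟨ζ, hζ, rfl⟩ := hxS
        have hmem := mem_cell_floor (o := o) hδ ζ
        set κ : ℤ × ℤ := (⌊ζ.re / δ⌋, ⌊(ζ.im - o) / δ⌋) with hκ
        have hκF : κ ∈ F := hFS κ ⟨ζ, hmem, hζ⟩
        rw [mem_cell] at hmem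
        have hB : B κ := by
          refine ⟨⟨lt_of_le_of_ne hmem.1.1 fun e => hcx ⟨κ.1, e⟩, hmem.1.2⟩, ζ.im, hmem.2, ?_⟩
          simpa using hζ
        calc (1 : ℝ) = if B κ then 1 else 0 := (if_pos hB).symm
          _ ≤ _ := Finset.single_le_sum (f := fun κ => if B κ then (1 : ℝ) else 0)
            (fun i _ => by split_ifs <;> norm_num) hκF
      · rw [indicator_of_notMem hxS]
        exact Finset.sum_nonneg fun i _ => by split_ifs <;> norm_num
    · rw [Finset.sum_boole]
      have hch : ∀ κ : ℤ × ℤ, ∃ y : ℝ, A κ →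
          y ∈ Icc (o + κ.2 * δ) (o + (κ.2 + 1) * δ) ∧ (⟨x, y⟩ : ℂ) ∈ C \ S := by
        intro κ
        by_cases hA : A κ
        · obtain ⟨-, y, hy⟩ := hA
          exact ⟨y, fun _ => hy⟩
        · exact ⟨0, fun h => absurd h hA⟩
      choose Y hY using hch
      let T : Finset ℂ := (F.filter A).image fun κ => ⟨x, Y κ⟩
      have hinj : Set.InjOn (fun κ => (⟨x, Y κ⟩ : ℂ)) (F.filter A : Finset (ℤ × ℤ)) := by
        have h1 : ∀ κ, A κ → κ = (⌈x / δ⌉ - 1, ⌊(Y κ - o) / δ⌋) := by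
          intro κ hA
          obtain ⟨⟨ha, hb⟩, hc⟩ := hY κ hA
          have hlt : Y κ < o + (κ.2 + 1) * δ := by
            refine lt_of_le_of_ne hb fun e => hgenx (κ.2 + 1) ?_
            push_cast; rw [← e]; exact hc.1
          refine Prod.ext ?_ ?_
          · have : ⌈x / δ⌉ = κ.1 + 1 := by
              rw [Int.ceil_eq_iff]
              push_cast
              exact ⟨by rw [lt_div_iff₀ hδ]; linarith [hA.1.1], by
                rw [div_le_iff₀ hδ]; exact hA.1.2⟩
            simp [this]
          · symm
            rw [Int.floor_eq_iff]
            exact ⟨by rw [le_div_iff₀ hδ]; linarith, by rw [div_lt_iff₀ hδ]; linarith⟩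
        intro κ hκ κ' hκ' he
        simp only [Complex.mk.injEq, true_and] at he
        rw [Finset.coe_filter] at hκ hκ'
        rw [h1 κ hκ.2, h1 κ' hκ'.2, he]
      have hT : (T.card : ℝ≥0∞) ≤ g x := by
        refine hg x T ?_ ?_
        · intro z hz
          simp only [T, Finset.coe_image, mem_image, Finset.mem_coe, Finset.mem_filter] at hz
          obtain ⟨κ, ⟨hκF, hA⟩, rfl⟩ := hz
          obtain ⟨hy, hc⟩ := hY κ hA
          exact ⟨hc.1, hFU κ hκF (mem_cell.2 ⟨⟨hA.1.1.le, hA.1.2⟩, hy⟩), hc.2⟩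
        · intro z hz
          simp only [T, Finset.mem_image] at hz
          obtain ⟨κ, -, rfl⟩ := hz
          rfl
      rw [Finset.card_image_of_injOn hinj] at hT
      have := ENNReal.toReal_mono hgx.ne hT
      simpa using this
  calc volume.real (Complex.re '' S) - 2 * (μH[1] (C ∩ (U \ S))).toReal
      ≤ (∫ x, (Complex.re '' S).indicator (fun _ => (1 : ℝ)) x) - 2 * ∫ x, (g x).toReal := by
        rw [integral_indicator hSm]
        simp only [integral_const, smul_eq_mul, mul_one]
        rw [measureReal_restrict_apply_univ]
        linarith
    _ = ∫ x, ((Complex.re '' S).indicator (fun _ => (1 : ℝ)) x - 2 * (g x).toReal) := by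
        rw [integral_sub hSI (hgI.const_mul 2), integral_const_mul]
    _ ≤ ∫ x, ∑ κ ∈ F, Φ κ x := integral_mono_ae (hSI.sub (hgI.const_mul 2))
        (integrable_finsetSum _ fun κ _ => hΦI κ) hae
    _ = _ := hsum.symm

end HullDim

namespace HullDim
open Set Metric
open scoped ENNReal

theorem exists_generic_offset {C : Set ℂ} (hfin : μH[1] C < ∞) (δ : ℝ) :
    ∃ o : ℝ, ∀ᵐ x : ℝ, ∀ k : ℤ, (⟨x, o + k * δ⟩ : ℂ) ∉ C := by
  let ν := (μH[1] : Measure ℂ).restrict C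
  have : IsFiniteMeasure ν := ⟨by simpa [ν] using hfin⟩
  have hcount : {y : ℝ | 0 < ν (Complex.im ⁻¹' {y})}.Countable :=
    Measure.countable_meas_pos_of_disjoint_iUnion (μ := ν)
      (fun y => Complex.measurable_im (measurableSet_singleton y))
      (fun y y' h => disjoint_left.2 fun z hz hz' => h (by
        rw [mem_preimage, mem_singleton_iff] at hz hz'; rw [← hz, ← hz']))
  have hbad : (⋃ k : ℤ, (fun y : ℝ => y - k * δ) '' {y : ℝ | 0 < ν (Complex.im ⁻¹' {y})}).Countable :=
    countable_iUnion fun k => hcount.image _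
  obtain ⟨o, ho⟩ := (not_forall (p := fun o : ℝ =>
    o ∈ ⋃ k : ℤ, (fun y : ℝ => y - k * δ) '' {y : ℝ | 0 < ν (Complex.im ⁻¹' {y})})).1 fun h =>
      Cardinal.not_countable_real ((eq_univ_of_forall h) ▸ hbad)
  have hre : LipschitzWith 1 Complex.re := by
    refine LipschitzWith.of_dist_le_mul fun z w => ?_
    rw [NNReal.coe_one, one_mul, Real.dist_eq, dist_eq_norm, ← Complex.sub_re]
    exact Complex.abs_re_le_norm _
  refine ⟨o, ae_all_iff.2 fun k => ?_⟩
  have h0 : ν (Complex.im ⁻¹' {o + k * δ}) = 0 := by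
    by_contra hne
    exact ho (mem_iUnion.2 ⟨k, o + k * δ, pos_iff_ne_zero.2 hne, by simp⟩)
  rw [Measure.restrict_apply (Complex.measurable_im (measurableSet_singleton _))] at h0
  have h1 := (volume_image_le_hausdorffMeasure hre (Complex.im ⁻¹' {o + k * δ} ∩ C)).trans h0.le
  refine measure_mono_null ?_ (le_antisymm h1 bot_le)
  intro x hx
  exact ⟨⟨x, o + k * δ⟩, ⟨rfl, not_not.1 hx⟩, rfl⟩

/-- The part of an edge, in a parametrization, lying in `Ω` outside `Q`. -/
noncomputable def leftover (Ω Q : Set ℂ) (γ : ℝ → ℂ) (a b : ℝ) : ℝ :=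
  ∫ x in a..b, (Ω \ Q).indicator (fun _ => (1 : ℝ)) (γ x)

theorem intervalIntegrable_indicator {Ω : Set ℂ} (hΩ : MeasurableSet Ω) {γ : ℝ → ℂ}
    (hγ : Continuous γ) (a b : ℝ) :
    IntervalIntegrable (fun x => Ω.indicator (fun _ => (1 : ℝ)) (γ x)) volume a b := by
  rw [intervalIntegrable_iff]
  refine Measure.integrableOn_of_bounded (M := 1) (by simp)
    ((measurable_const.indicator hΩ).comp hγ.measurable).aestronglyMeasurable
    (ae_of_all _ fun x => ?_)
  by_cases h : γ x ∈ Ω <;> simp [h]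

theorem norm_sum_sub_integral_le {Ω Q : Set ℂ} (hΩ : MeasurableSet Ω) (hQ : MeasurableSet Q)
    {f : ℂ → ℂ} (hf : Continuous f) {γ : ℝ → ℂ} (hγ : Continuous γ) {ε : ℝ} {X : ℕ → ℝ} {n : ℕ}
    (hX : ∀ i < n, X i ≤ X (i + 1)) {a : ℕ → ℂ}
    (h : ∀ i < n, ∀ x ∈ Icc (X i) (X (i + 1)),
      ‖a i * f (γ x) - (Ω.indicator (fun _ => (1 : ℝ)) (γ x) : ℝ)‖ ≤
        ε + 2 * (Ω \ Q).indicator (fun _ => (1 : ℝ)) (γ x)) :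
    ‖∑ i ∈ Finset.range n, a i * (∫ x in X i..X (i + 1), f (γ x)) -
      ((∫ x in X 0..X n, Ω.indicator (fun _ => (1 : ℝ)) (γ x) : ℝ) : ℂ)‖ ≤
      ε * (X n - X 0) + 2 * leftover Ω Q γ (X 0) (X n) := by
  have hi1 := fun a b => intervalIntegrable_indicator hΩ hγ a b
  have hi2 := fun a b => intervalIntegrable_indicator (hΩ.diff hQ) hγ a b
  rw [leftover, ← intervalIntegral.sum_integral_adjacent_intervals fun k _ => hi1 _ _,
    ← intervalIntegral.sum_integral_adjacent_intervals fun k _ => hi2 _ _,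
    ← Finset.sum_range_sub X, Complex.ofReal_sum, ← Finset.sum_sub_distrib, Finset.mul_sum,
    Finset.mul_sum, ← Finset.sum_add_distrib]
  refine norm_sum_le_of_le _ fun i hi => ?_
  rw [Finset.mem_range] at hi
  have hi3 : IntervalIntegrable
      (fun x => ((Ω.indicator (fun _ => (1 : ℝ)) (γ x) : ℝ) : ℂ)) volume (X i) (X (i + 1)) := by
    have := hi1 (X i) (X (i + 1))
    rw [intervalIntegrable_iff] at this ⊢
    exact this.ofReal
  have hi4 : IntervalIntegrable (fun x => a i * f (γ x)) volume (X i) (X (i + 1)) :=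
    (continuous_const.mul (hf.comp hγ)).intervalIntegrable _ _
  rw [← intervalIntegral.integral_ofReal, ← intervalIntegral.integral_const_mul,
    ← intervalIntegral.integral_sub hi4 hi3]
  have h_int : IntervalIntegrable
      (fun x => ε + 2 * (Ω \ Q).indicator (fun _ => (1 : ℝ)) (γ x)) volume (X i) (X (i + 1)) :=
    intervalIntegrable_const.add ((hi2 _ _).const_mul 2)
  refine (intervalIntegral.norm_integral_le_of_norm_le (hX i hi)
    (ae_of_all _ fun x hx => h i hi x (Ioc_subset_Icc_self hx)) h_int).trans_eq ?_
  rw [intervalIntegral.integral_add intervalIntegrable_const ((hi2 _ _).const_mul 2),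
    intervalIntegral.integral_const_mul, intervalIntegral.integral_const, smul_eq_mul, mul_comm ε]

theorem continuous_mk_left (y : ℝ) : Continuous fun x : ℝ => (⟨x, y⟩ : ℂ) := by
  have : (fun x : ℝ => (⟨x, y⟩ : ℂ)) = fun x : ℝ => (x : ℂ) + y * Complex.I := by
    ext x; exact Complex.mk_eq_add_mul_I x y
  rw [this]; fun_prop

theorem continuous_mk_right (x : ℝ) : Continuous fun y : ℝ => (⟨x, y⟩ : ℂ) := by
  have : (fun y : ℝ => (⟨x, y⟩ : ℂ)) = fun y : ℝ => (x : ℂ) + y * Complex.I := by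
    ext y; exact Complex.mk_eq_add_mul_I x y
  rw [this]; fun_prop

/-- Total leftover of the four edges of a square. -/
noncomputable def boundaryLeftover (Ω Q : Set ℂ) (o δ : ℝ) (p q : ℤ) : ℝ :=
  leftover Ω Q (fun x => ⟨x, o + q * δ⟩) (p * δ) ((p + 1) * δ) +
  leftover Ω Q (fun x => ⟨x, o + (q + 1) * δ⟩) (p * δ) ((p + 1) * δ) +
  leftover Ω Q (fun y => ⟨p * δ, y⟩) (o + q * δ) (o + (q + 1) * δ) +
  leftover Ω Q (fun y => ⟨(p + 1) * δ, y⟩) (o + q * δ) (o + (q + 1) * δ)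

theorem integral_edges_le {Ω Q : Set ℂ} (hΩ : MeasurableSet Ω) (hQm : MeasurableSet Q)
    {f : ℂ → ℂ} (hf : Differentiable ℂ f) {o δ ε : ℝ} (hδ : 0 < δ) (hε : 0 ≤ ε) {w : ℤ × ℤ → ℝ}
    (hw : ∀ κ, 0 ≤ w κ)
    (hadj : ∀ p q p' q' : ℤ, cell o δ p q ⊆ Ω → ¬ cell o δ p' q' ⊆ Ω → ∀ z ∈ cell o δ p q,
      z ∈ cell o δ p' q' → ‖f z‖ ≤ w (p', q'))
    (hf1 : ∀ p q : ℤ, cell o δ p q ⊆ Ω → ∀ z ∈ cell o δ p q, ‖f z‖ ≤ 1)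
    (hQf : ∀ z ∈ Q, ‖f z - 1‖ ≤ ε)
    (hQ : ∀ p q : ℤ, ∀ z ∈ cell o δ p q, z ∈ Q → cell o δ p q ⊆ Ω)
    (m : ℕ) {δ₀ : ℝ} (hδ₀ : δ₀ = (m + 1) * δ) (p q : ℤ) :
    ∫ x in (p * δ₀ : ℝ)..((p + 1) * δ₀), (Ω.indicator (fun _ => (1 : ℝ)) ⟨x, o + q * δ₀⟩ -
        Ω.indicator (fun _ => (1 : ℝ)) ⟨x, o + (q + 1) * δ₀⟩) ≤
      4 * (δ * ∑ i ∈ Finset.range (m + 1), ∑ j ∈ Finset.range (m + 1),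
        w (p * (m + 1) + i, q * (m + 1) + j)) +
      4 * (ε * δ₀) + 2 * boundaryLeftover Ω Q o δ₀ p q := by
  classical
  let P : ℕ → ℤ := fun i => p * (m + 1) + i
  let R : ℕ → ℤ := fun j => q * (m + 1) + j
  let X : ℕ → ℝ := fun i => (p * (m + 1) + i) * δ
  let Y : ℕ → ℝ := fun j => o + (q * (m + 1) + j) * δ
  have hX0 : ∀ i, X i = P i * δ := fun i => by simp [X, P]
  have hX1 : ∀ i, X (i + 1) = (P i + 1) * δ := fun i => by simp only [X, P]; push_cast; ring
  have hY0 : ∀ i, Y i = o + R i * δ := fun i => by simp [Y, R]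
  have hY1 : ∀ i, Y (i + 1) = o + (R i + 1) * δ := fun i => by simp only [Y, R]; push_cast; ring
  have hXs : ∀ i, X (i + 1) - X i = δ := fun i => by rw [hX1, hX0]; ring
  have hYs : ∀ i, Y (i + 1) - Y i = δ := fun i => by rw [hY1, hY0]; ring
  have hXz : X 0 = p * δ₀ := by simp only [X, hδ₀]; push_cast; ring
  have hXm : X (m + 1) = (p + 1) * δ₀ := by simp only [X, hδ₀]; push_cast; ring
  have hYz : Y 0 = o + q * δ₀ := by simp only [Y, hδ₀]; push_cast; ring
  have hYm : Y (m + 1) = o + (q + 1) * δ₀ := by simp only [Y, hδ₀]; push_cast; ring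
  have hXle : ∀ i, X i ≤ X (i + 1) := fun i => by linarith [hXs i]
  have hYle : ∀ i, Y i ≤ Y (i + 1) := fun i => by linarith [hYs i]
  have hmem : ∀ i j x y, x ∈ Icc (X i) (X (i + 1)) → y ∈ Icc (Y j) (Y (j + 1)) →
      (⟨x, y⟩ : ℂ) ∈ cell o δ (P i) (R j) := by
    intro i j x y hx hy
    rw [hX1, hX0] at hx
    rw [hY1, hY0] at hy
    exact mem_cell.2 ⟨hx, hy⟩
  let a : ℕ → ℕ → ℂ := fun i j => if cell o δ (P i) (R j) ⊆ Ω then 1 else 0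
  let h : ℕ → ℕ → ℂ := fun i j => ∫ x in X i..X (i + 1), f ⟨x, Y j⟩
  let v : ℕ → ℕ → ℂ := fun i j => ∫ y in Y j..Y (j + 1), f ⟨X i, y⟩
  have hpt : ∀ i j, ∀ z ∈ cell o δ (P i) (R j),
      ‖a i j * f z - (Ω.indicator (fun _ => (1 : ℝ)) z : ℝ)‖ ≤
        ε + 2 * (Ω \ Q).indicator (fun _ => (1 : ℝ)) z := by
    intro i j z hz
    by_cases hc : cell o δ (P i) (R j) ⊆ Ω
    · simp only [a, if_pos hc, one_mul, indicator_of_mem (hc hz)]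
      by_cases hzQ : z ∈ Q
      · rw [indicator_of_notMem (fun h => h.2 hzQ)]
        simpa using hQf z hzQ
      · rw [indicator_of_mem (show z ∈ Ω \ Q from ⟨hc hz, hzQ⟩)]
        have := norm_sub_le (f z) ((1 : ℝ) : ℂ)
        have h1 := hf1 _ _ hc z hz
        simp only [Complex.ofReal_one, norm_one] at this ⊢
        linarith
    · simp only [a, if_neg hc, zero_mul, zero_sub, norm_neg]
      have hzQ : z ∉ Q := fun hzQ => hc (hQ _ _ z hz hzQ)
      by_cases hzΩ : z ∈ Ω
      · rw [indicator_of_mem hzΩ, indicator_of_mem (show z ∈ Ω \ Q from ⟨hzΩ, hzQ⟩)]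
        simp; linarith
      · rw [indicator_of_notMem hzΩ, indicator_of_notMem (fun h => hzΩ h.1)]
        simpa using hε
  have hne : ∀ i j i' j', a i j ≠ a i' j' → ∀ z ∈ cell o δ (P i) (R j), z ∈ cell o δ (P i') (R j') →
      ‖f z‖ ≤ w (P i, R j) + w (P i', R j') := by
    intro i j i' j' hne z hz hz'
    by_cases h1 : cell o δ (P i) (R j) ⊆ Ω <;> by_cases h2 : cell o δ (P i') (R j') ⊆ Ω
    · simp [a, h1, h2] at hne
    · linarith [hadj _ _ _ _ h1 h2 z hz hz', hw (P i, R j)]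
    · linarith [hadj _ _ _ _ h2 h1 z hz' hz, hw (P i', R j')]
    · simp [a, h1, h2] at hne
  have key := norm_boundary_sum_le (a := a) (h := h) (v := v) (w := fun i j => w (P i, R j)) (m := m)
    hδ.le (fun i j => hw _) (fun i j => by simp only [a]; split_ifs <;> simp) ?_ ?_ ?_
  rotate_left
  · intro i j
    have := Complex.integral_boundary_rect_eq_zero_of_differentiableOn f ⟨X i, Y j⟩
      ⟨X (i + 1), Y (j + 1)⟩ hf.differentiableOn
    simp only [smul_eq_mul, ← Complex.mk_eq_add_mul_I] at this
    rw [← this]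
    simp only [h, v]
    ring
  · intro i j _ _ haj
    have := intervalIntegral.norm_integral_le_of_norm_le_const (a := X i) (b := X (i + 1))
      (f := fun x => f ⟨x, Y (j + 1)⟩) (C := w (P i, R j) + w (P i, R (j + 1))) ?_
    · rw [hXs, abs_of_pos hδ, mul_comm] at this
      exact this
    · intro x hx
      rw [uIoc_of_le (hXle i)] at hx
      exact hne _ _ _ _ haj _ (hmem _ _ _ _ (Ioc_subset_Icc_self hx) ⟨hYle j, le_rfl⟩)
        (hmem _ _ _ _ (Ioc_subset_Icc_self hx) ⟨le_rfl, hYle _⟩)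
  · intro i j _ _ haj
    have := intervalIntegral.norm_integral_le_of_norm_le_const (a := Y j) (b := Y (j + 1))
      (f := fun y => f ⟨X (i + 1), y⟩) (C := w (P i, R j) + w (P (i + 1), R j)) ?_
    · rw [hYs, abs_of_pos hδ, mul_comm] at this
      exact this
    · intro y hy
      rw [uIoc_of_le (hYle j)] at hy
      exact hne _ _ _ _ haj _ (hmem _ _ _ _ ⟨hXle i, le_rfl⟩ (Ioc_subset_Icc_self hy))
        (hmem _ _ _ _ ⟨le_rfl, hXle _⟩ (Ioc_subset_Icc_self hy))
  have hb := norm_sum_sub_integral_le hΩ hQm hf.continuous (continuous_mk_left (Y 0)) (ε := ε)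
    (X := X) (n := m + 1) (fun i _ => hXle i) (a := fun i => a i 0)
    (fun i _ x hx => hpt i 0 _ (hmem _ _ _ _ hx ⟨le_rfl, hYle 0⟩))
  have ht := norm_sum_sub_integral_le hΩ hQm hf.continuous (continuous_mk_left (Y (m + 1))) (ε := ε)
    (X := X) (n := m + 1) (fun i _ => hXle i) (a := fun i => a i m)
    (fun i _ x hx => hpt i m _ (hmem _ _ _ _ hx ⟨hYle m, le_rfl⟩))
  have hl := norm_sum_sub_integral_le hΩ hQm hf.continuous (continuous_mk_right (X 0)) (ε := ε)
    (X := Y) (n := m + 1) (fun i _ => hYle i) (a := fun j => a 0 j)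
    (fun j _ y hy => hpt 0 j _ (hmem _ _ _ _ ⟨le_rfl, hXle 0⟩ hy))
  have hr := norm_sum_sub_integral_le hΩ hQm hf.continuous (continuous_mk_right (X (m + 1))) (ε := ε)
    (X := Y) (n := m + 1) (fun i _ => hYle i) (a := fun j => a m j)
    (fun j _ y hy => hpt m j _ (hmem _ _ _ _ ⟨hXle m, le_rfl⟩ hy))
  rw [Finset.sum_sub_distrib, Finset.sum_sub_distrib] at key
  rw [intervalIntegral.integral_sub (intervalIntegrable_indicator hΩ (continuous_mk_left _) _ _)
    (intervalIntegrable_indicator hΩ (continuous_mk_left _) _ _)]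
  rw [boundaryLeftover]
  rw [hXz, hXm] at hb ht
  rw [hYz, hYm] at hl hr
  rw [hYz] at hb
  rw [hYm] at ht
  rw [hXz] at hl
  rw [hXm] at hr
  have kre := (Complex.re_le_norm _).trans key
  have bre := (abs_le.1 ((Complex.abs_re_le_norm _).trans hb)).1
  have tre := (abs_le.1 ((Complex.abs_re_le_norm _).trans ht)).2
  have lim' := (abs_le.1 ((Complex.abs_im_le_norm _).trans hl)).1
  have rim := (abs_le.1 ((Complex.abs_im_le_norm _).trans hr)).2
  simp only [Complex.add_re, Complex.sub_re, Complex.mul_re, Complex.I_re, Complex.I_im,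
    Complex.sub_im, Complex.ofReal_re, Complex.ofReal_im, zero_mul, one_mul, zero_sub, sub_zero]
    at kre bre tre lim' rim
  simp only [h, v, hYz, hYm, hXz, hXm, P, R] at kre bre tre lim' rim ⊢
  linarith

end HullDim

namespace HullDim
open Set Metric
open scoped ENNReal

theorem fine_cell_subset {o δ δ₀ : ℝ} {m : ℕ} (hδ : 0 < δ) (hδ₀ : δ₀ = (m + 1) * δ) {p q : ℤ} {i j : ℕ}
    (hi : i < m + 1) (hj : j < m + 1) :
    cell o δ (p * (m + 1) + i) (q * (m + 1) + j) ⊆ cell o δ₀ p q := by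
  intro z hz
  rw [mem_cell] at hz ⊢
  have hi' : (i : ℝ) + 1 ≤ m + 1 := by exact_mod_cast hi
  have hj' : (j : ℝ) + 1 ≤ m + 1 := by exact_mod_cast hj
  have hi0 : (0 : ℝ) ≤ i := i.cast_nonneg
  have hj0 : (0 : ℝ) ≤ j := j.cast_nonneg
  push_cast at hz
  subst hδ₀
  obtain ⟨⟨h1, h2⟩, h3, h4⟩ := hz
  refine ⟨⟨?_, ?_⟩, ?_, ?_⟩
  · nlinarith
  · nlinarith
  · nlinarith
  · nlinarith

theorem sum_fine_cells_le {C S U N : Set ℂ} (hC : IsPreconnected C)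
    (hUm : MeasurableSet U)
    (hSm : MeasurableSet S) (hCfin : μH[1] C < ∞) {o δ δ₀ e : ℝ} {m : ℕ} (hδ : 0 < δ)
    (hδ₀ : δ₀ = (m + 1) * δ) (he : 0 ≤ e)
    (hfar : ∀ c ∈ C, ∃ c' ∈ C, δ ≤ dist c' c) {F : Finset (ℤ × ℤ)}
    (hFU : ∀ κ ∈ F, ∀ z ∈ cell o δ₀ κ.1 κ.2, ball z δ ⊆ U)
    (hN : ∀ z, (ball z (3 * δ) ∩ S).Nonempty → z ∈ N) {w : ℤ × ℤ → ℝ}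
    (hw : ∀ κ : ℤ × ℤ, (cell o δ κ.1 κ.2 ∩ C).Nonempty → cell o δ κ.1 κ.2 ⊆ N → w κ ≤ e)
    (hw1 : ∀ κ : ℤ × ℤ, (cell o δ κ.1 κ.2 ∩ C).Nonempty → w κ ≤ 1 + e)
    (hw0 : ∀ κ : ℤ × ℤ, ¬ (cell o δ κ.1 κ.2 ∩ C).Nonempty → w κ ≤ 0) :
    δ * ∑ κ ∈ F, ∑ i ∈ Finset.range (m + 1), ∑ j ∈ Finset.range (m + 1),
        w (κ.1 * (m + 1) + i, κ.2 * (m + 1) + j) ≤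
      9 * (e * (μH[1] C).toReal) + 9 * (μH[1] (C ∩ (U \ S))).toReal := by
  classical
  let φ : (ℤ × ℤ) × (ℕ × ℕ) → ℤ × ℤ := fun k => (k.1.1 * (m + 1) + k.2.1, k.1.2 * (m + 1) + k.2.2)
  let K := F ×ˢ (Finset.range (m + 1) ×ˢ Finset.range (m + 1))
  have hK : ∀ k ∈ K, k.1 ∈ F ∧ k.2.1 < m + 1 ∧ k.2.2 < m + 1 := by
    intro k hk
    simpa [K] using hk
  have hinj : Set.InjOn φ K := by
    have hdiv : ∀ (p : ℤ) (i : ℕ), i < m + 1 → (p * (m + 1) + i) / (m + 1) = p := by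
      intro p i hi
      rw [add_comm, Int.add_mul_ediv_right _ _ (by omega : (m : ℤ) + 1 ≠ 0),
        Int.ediv_eq_zero_of_lt (by omega) (by omega), zero_add]
    rintro ⟨⟨p, q⟩, i, j⟩ hk ⟨⟨p', q'⟩, i', j'⟩ hk' h
    obtain ⟨-, hi, hj⟩ := hK _ hk
    obtain ⟨-, hi', hj'⟩ := hK _ hk'
    simp only [φ, Prod.mk.injEq] at h hi hj hi' hj'
    have e1 : p = p' := by rw [← hdiv p i hi, h.1, hdiv p' i' hi']
    have e2 : q = q' := by rw [← hdiv q j hj, h.2, hdiv q' j' hj']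
    subst e1 e2
    have e3 : i = i' := by have := h.1; omega
    have e4 : j = j' := by have := h.2; omega
    rw [e3, e4]
  have hsum : ∑ κ ∈ F, ∑ i ∈ Finset.range (m + 1), ∑ j ∈ Finset.range (m + 1),
      w (κ.1 * (m + 1) + i, κ.2 * (m + 1) + j) = ∑ k ∈ K, w (φ k) := by
    rw [Finset.sum_product]
    refine Finset.sum_congr rfl fun κ _ => ?_
    rw [Finset.sum_product]
  let A : ℤ × ℤ → Prop := fun κ => (cell o δ κ.1 κ.2 ∩ C).Nonempty
  let B : ℤ × ℤ → Prop := fun κ => A κ ∧ ¬ cell o δ κ.1 κ.2 ⊆ N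
  have hcard : ∀ (p : ℤ × ℤ → Prop) (V : Set ℂ), MeasurableSet V → (∀ k ∈ K, p (φ k) →
      ∃ c ∈ cell o δ (φ k).1 (φ k).2, c ∈ C ∧ ball c δ ⊆ V) →
      (((K.filter fun k => p (φ k)).card : ℕ) : ℝ) * δ ≤ 9 * (μH[1] (C ∩ V)).toReal := by
    intro p V hV h
    have hνfin : ((μH[1] : Measure ℂ).restrict C) V ≠ ∞ := by
      rw [Measure.restrict_apply hV]
      exact ((measure_mono inter_subset_right).trans_lt hCfin).ne
    have := card_mul_le_of_forall_cell (o := o) hδ (ν := (μH[1] : Measure ℂ).restrict C) hV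
      ((K.filter fun k => p (φ k)).image φ) ?_
    · rw [Finset.card_image_of_injOn (hinj.mono fun k hk => (Finset.mem_filter.1 hk).1)] at this
      have h2 := ENNReal.toReal_mono (ENNReal.mul_ne_top (by norm_num) hνfin) this
      rw [Measure.restrict_apply hV, inter_comm] at h2
      simpa [ENNReal.toReal_mul, ENNReal.toReal_ofReal hδ.le] using h2
    · intro κ hκ
      obtain ⟨k, hk, rfl⟩ := Finset.mem_image.1 hκ
      obtain ⟨hk, hp⟩ := Finset.mem_filter.1 hk
      obtain ⟨c, hc, hcC, hcV⟩ := h k hk hp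
      obtain ⟨c', hc', hd⟩ := hfar c hcC
      refine ⟨c, hc, hcV, ?_⟩
      rw [Measure.restrict_apply isOpen_ball.measurableSet, inter_comm]
      exact le_hausdorffMeasure_inter_ball hC hcC hc' hd
  have h1 := hcard A univ MeasurableSet.univ fun k _ ⟨c, hc, hcC⟩ => ⟨c, hc, hcC, subset_univ _⟩
  have h2 := hcard B (U \ S) (hUm.diff hSm) fun k hk ⟨⟨c, hc, hcC⟩, hNk⟩ => by
    refine ⟨c, hc, hcC, fun z hz => ⟨?_, fun hzS => ?_⟩⟩
    · obtain ⟨hF, hi, hj⟩ := hK k hk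
      exact hFU _ hF c (fine_cell_subset hδ hδ₀ hi hj hc) hz
    · refine hNk fun y hy => hN y ⟨z, ?_, hzS⟩
      rw [mem_ball] at hz ⊢
      linarith [dist_triangle z c y, dist_le_of_mem_cell hc hy]
  rw [inter_univ] at h1
  have hterm : ∀ k ∈ K, w (φ k) ≤ e * (if A (φ k) then 1 else 0) + (if B (φ k) then 1 else 0) := by
    intro k _
    by_cases hA : A (φ k)
    · by_cases hB : B (φ k)
      · rw [if_pos hA, if_pos hB]; linarith [hw1 _ hA]
      · rw [if_pos hA, if_neg hB]
        have := hw _ hA (by_contra fun h => hB ⟨hA, h⟩)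
        linarith
    · have hB : ¬ B (φ k) := fun h => hA h.1
      rw [if_neg hA, if_neg hB]
      linarith [hw0 _ hA]
  rw [hsum]
  calc δ * ∑ k ∈ K, w (φ k)
      ≤ δ * ∑ k ∈ K, (e * (if A (φ k) then 1 else 0) + (if B (φ k) then 1 else 0)) :=
        mul_le_mul_of_nonneg_left (Finset.sum_le_sum hterm) hδ.le
    _ = e * (((K.filter fun k => A (φ k)).card : ℕ) * δ) + ((K.filter fun k => B (φ k)).card : ℕ) * δ := by
        rw [Finset.sum_add_distrib, ← Finset.mul_sum, Finset.sum_boole, Finset.sum_boole]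
        ring
    _ ≤ e * (9 * (μH[1] C).toReal) + 9 * (μH[1] (C ∩ (U \ S))).toReal :=
        add_le_add (mul_le_mul_of_nonneg_left h1 he) (le_trans (le_of_eq (by congr)) h2)
    _ = _ := by ring

end HullDim

namespace HullDim
open Set Metric Polynomial
open scoped ENNReal

theorem tendsto_leftover {Ω : Set ℂ} (hΩ : IsOpen Ω) (hne : Ωᶜ.Nonempty) {γ : ℝ → ℂ}
    (hγ : Continuous γ) (a b : ℝ) :
    Filter.Tendsto (fun n : ℕ => leftover Ω {z | 1 / ((n : ℝ) + 1) ≤ infDist z Ωᶜ} γ a b)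
      Filter.atTop (nhds 0) := by
  have hQ : ∀ n : ℕ, MeasurableSet {z : ℂ | 1 / ((n : ℝ) + 1) ≤ infDist z Ωᶜ} := fun n =>
    (isClosed_le continuous_const (continuous_infDist_pt _)).measurableSet
  have := intervalIntegral.tendsto_integral_filter_of_dominated_convergence (μ := volume)
    (a := a) (b := b) (l := Filter.atTop) (bound := fun _ => 1) (f := fun _ => (0 : ℝ))
    (F := fun (n : ℕ) x => (Ω \ {z : ℂ | 1 / ((n : ℝ) + 1) ≤ infDist z Ωᶜ}).indicator
      (fun _ => (1 : ℝ)) (γ x)) ?_ ?_ intervalIntegrable_const ?_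
  · simpa [leftover] using this
  · refine Filter.Eventually.of_forall fun n => ?_
    exact ((measurable_const.indicator (hΩ.measurableSet.diff (hQ n))).comp
      hγ.measurable).aestronglyMeasurable
  · refine Filter.Eventually.of_forall fun n => ae_of_all _ fun x _ => ?_
    rw [Real.norm_eq_abs, abs_of_nonneg (indicator_nonneg (fun _ _ => zero_le_one) _)]
    exact indicator_le_self' (fun _ _ => zero_le_one) _
  · refine ae_of_all _ fun x _ => ?_
    refine tendsto_const_nhds.congr' ?_
    by_cases hx : γ x ∈ Ω
    · have hpos : 0 < infDist (γ x) Ωᶜ :=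
        (hΩ.isClosed_compl.notMem_iff_infDist_pos hne).1 (not_not.2 hx)
      filter_upwards [(tendsto_one_div_add_atTop_nhds_zero_nat (𝕜 := ℝ)).eventually_lt_const hpos]
        with n hn
      exact (indicator_of_notMem (fun h => h.2 hn.le) _).symm
    · refine Filter.Eventually.of_forall fun n => ?_
      exact (indicator_of_notMem (fun h => hx h.1) _).symm

theorem exists_compact_sum_boundaryLeftover_le {Ω : Set ℂ} (hΩ : IsOpen Ω) (hne : Ωᶜ.Nonempty)
    (hb : Bornology.IsBounded Ω) (o δ : ℝ) (F : Finset (ℤ × ℤ)) {η : ℝ} (hη : 0 < η) :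
    ∃ Q ⊆ Ω, IsCompact Q ∧ ∑ κ ∈ F, boundaryLeftover Ω Q o δ κ.1 κ.2 ≤ η := by
  have ht : Filter.Tendsto (fun n : ℕ => ∑ κ ∈ F,
      boundaryLeftover Ω {z | 1 / ((n : ℝ) + 1) ≤ infDist z Ωᶜ} o δ κ.1 κ.2) Filter.atTop
      (nhds (∑ _κ ∈ F, (0 + 0 + 0 + 0))) := by
    refine tendsto_finsetSum _ fun κ _ => ?_
    exact (((tendsto_leftover hΩ hne (continuous_mk_left _) _ _).add
      (tendsto_leftover hΩ hne (continuous_mk_left _) _ _)).add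
      (tendsto_leftover hΩ hne (continuous_mk_right _) _ _)).add
      (tendsto_leftover hΩ hne (continuous_mk_right _) _ _)
  simp only [add_zero, Finset.sum_const_zero] at ht
  obtain ⟨n, hn⟩ := (ht.eventually_le_const hη).exists
  have hsub : {z | 1 / ((n : ℝ) + 1) ≤ infDist z Ωᶜ} ⊆ Ω := by
    intro z hz
    by_contra hzΩ
    have h0 : infDist z Ωᶜ = 0 := infDist_zero_of_mem hzΩ
    have : 0 < 1 / ((n : ℝ) + 1) := by positivity
    have h1 : 1 / ((n : ℝ) + 1) ≤ infDist z Ωᶜ := hz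
    linarith
  exact ⟨_, hsub, isCompact_of_isClosed_isBounded
    (isClosed_le continuous_const (continuous_infDist_pt _)) (hb.subset hsub), hn⟩

theorem exists_open_decay {G : Set (ℂ × ℂ)} {S : Set ℂ} (hS : IsCompact S) {A : ℝ} {K : ℕ}
    (h : ∀ ζ ∈ S, ∃ r > 0, ∀ Q, IsCompact Q → Q ⊆ ball ζ r → Disjoint Q (Prod.fst '' G) →
      Decay G cau Q A K) :
    ∃ V, IsOpen V ∧ S ⊆ V ∧ ∀ Q, IsCompact Q → Q ⊆ V → Disjoint Q (Prod.fst '' G) →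
      Decay G cau Q A K := by
  refine hS.induction_on (p := fun S => ∃ V, IsOpen V ∧ S ⊆ V ∧ ∀ Q, IsCompact Q → Q ⊆ V →
    Disjoint Q (Prod.fst '' G) → Decay G cau Q A K) ?_ ?_ ?_ ?_
  · refine ⟨∅, isOpen_empty, le_rfl, fun Q _ hQ _ => ⟨0, fun n _ d _ π _ z hz => absurd (hQ hz) ?_⟩⟩
    exact notMem_empty z
  · rintro s t hst ⟨V, hV, htV, hQ⟩
    exact ⟨V, hV, hst.trans htV, hQ⟩
  · rintro s t ⟨V, hV, hsV, hQ⟩ ⟨V', hV', htV', hQ'⟩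
    refine ⟨V ∪ V', hV.union hV', union_subset_union hsV htV', fun Q hQc hQV hd => ?_⟩
    obtain ⟨K₁, K₂, h1, h2, h3, h4, rfl⟩ := hQc.binary_compact_cover hV hV' hQV
    exact (hQ K₁ h1 h3 (hd.mono_left subset_union_left)).union
      (hQ' K₂ h2 h4 (hd.mono_left subset_union_right))
  · intro ζ hζ
    obtain ⟨r, hr, hQ⟩ := h ζ hζ
    exact ⟨ball ζ r, mem_nhdsWithin_of_mem_nhds (ball_mem_nhds ζ hr), ball ζ r, isOpen_ball, le_rfl,
      hQ⟩

theorem exists_polynomial_eq_bigH (n : ℕ) (d : Data) (π : ℂ[X]) :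
    ∃ P Q : ℂ[X], ∀ z, (∀ l, d.z l ≠ z) → Q.eval z ≠ 0 ∧
      P.eval z = bigH (Fin n) d.w π (cau d z) * Q.eval z := by
  classical
  refine ⟨∑ f : Fin n → Fin d.k, C (disc (d.w ∘ f) * ∏ i, (π.eval (d.w (f i)) * d.b (f i))) *
    ∏ i, ∏ l ∈ Finset.univ.erase (f i), (C (d.z l) - X), ∏ _i : Fin n, ∏ l, (C (d.z l) - X),
    fun z hz => ⟨?_, ?_⟩⟩
  · simp only [eval_prod, eval_sub, eval_C, eval_X]
    exact Finset.prod_ne_zero_iff.2 fun i _ => Finset.prod_ne_zero_iff.2 fun l _ =>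
      sub_ne_zero.2 (hz l)
  · rw [bigH, Finset.sum_mul, eval_finsetSum]
    refine Finset.sum_congr rfl fun f _ => ?_
    simp only [eval_mul, eval_C, eval_prod, eval_sub, eval_X]
    rw [mul_assoc, mul_assoc, ← Finset.prod_mul_distrib, ← Finset.prod_mul_distrib]
    congr 1
    refine Finset.prod_congr rfl fun i _ => ?_
    rw [← Finset.mul_prod_erase Finset.univ _ (Finset.mem_univ (f i)), cau]
    have : d.z (f i) - z ≠ 0 := sub_ne_zero.2 (hz _)
    field_simp

end HullDim

namespace HullDim
open Set Metric Polynomial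
open scoped ENNReal

theorem exists_decay_fails {G : Set (ℂ × ℂ)} {l : ℂ} (hlG : l ∉ Prod.fst '' G) (hl : l ∉ good G)
    {ρ : ℝ} (hρ : 0 < ρ) : ∃ A ≥ 0, ∃ K : ℕ, ∀ n₀ : ℕ, ∃ n ≥ n₀, ∃ d : Data, d.IsRep G n ∧
      ∃ π, IsWeight (K * n) π ∧ ∃ z ∈ ball l ρ,
        Real.exp (-A * n ^ 2) < ‖bigH (Fin n) d.w π (cau d z)‖ := by
  have h : ∃ A K, ¬ Decay G cau (ball l ρ) A K := by
    by_contra! h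
    exact hl ⟨hlG, ρ, hρ, h⟩
  obtain ⟨A, K, h⟩ := h
  refine ⟨max A 0, le_max_right _ _, K, ?_⟩
  by_contra! hc
  obtain ⟨n₀, hc⟩ := hc
  refine h ⟨n₀, fun n hn d hd π hπ z hz => (hc n hn d hd π hπ z hz).trans ?_⟩
  refine Real.exp_le_exp.2 ?_
  have := le_max_left A 0
  gcongr

theorem exists_entire_of_polynomial {J Q₀ Q₁ : Set ℂ} {z₀ : ℂ} {B s τ : ℝ} (hs : 0 < s)
    (hB : 0 ≤ B) (hJ : IsCompact J) (hz₀ : z₀ ∈ interior J) (hQ₁ : Q₁ ⊆ J)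
    (hharnack : ∀ f : ℂ → ℂ, Differentiable ℂ f → (∀ z ∈ Q₁, ‖f z‖ ≤ 1) →
      ∀ z ∈ Q₀, ‖1 - f z‖ ≤ B * ‖1 - f z₀‖)
    {g : ℂ[X]} (hg : ∀ z ∈ frontier J, 0 ≤ (g.eval z).re) (hg₀ : (g.eval z₀).re ≤ τ) :
    ∃ f : ℂ → ℂ, Differentiable ℂ f ∧ (∀ z, ‖f z‖ = Real.exp (-s * (g.eval z).re)) ∧
      (∀ z ∈ J, ‖f z‖ ≤ 1) ∧ ∀ z ∈ Q₀, ‖f z - 1‖ ≤ B * (s * τ) := by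
  have hpos : ∀ z ∈ J, 0 ≤ (g.eval z).re := by
    intro z hz
    by_cases hzi : z ∈ interior J
    · exact le_re_eval_of_forall_frontier hJ hzi g hg
    · exact hg z ⟨subset_closure hz, hzi⟩
  let f : ℂ → ℂ := fun z => Complex.exp (-(s : ℂ) * (g.eval z - ((g.eval z₀).im : ℂ) * Complex.I))
  have hf : Differentiable ℂ f :=
    Complex.differentiable_exp.comp ((g.differentiable.sub_const _).const_mul _)
  have hnorm : ∀ z, ‖f z‖ = Real.exp (-s * (g.eval z).re) := fun z => by
    simp [f, Complex.norm_exp]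
  have hle : ∀ z ∈ J, ‖f z‖ ≤ 1 := fun z hz => by
    rw [hnorm, Real.exp_le_one_iff]
    have := mul_nonneg hs.le (hpos z hz)
    linarith
  refine ⟨f, hf, hnorm, hle, fun z hz => ?_⟩
  rw [norm_sub_rev]
  refine (hharnack f hf (fun w hw => hle w (hQ₁ hw)) z hz).trans ?_
  refine mul_le_mul_of_nonneg_left ?_ hB
  have e : f z₀ = (Real.exp (-(s * (g.eval z₀).re)) : ℝ) := by
    simp only [f, Complex.ofReal_exp]
    congr 1
    apply Complex.ext <;> simp
  have h0 := mul_nonneg hs.le (hpos z₀ (interior_subset hz₀))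
  rw [e, ← Complex.ofReal_one, ← Complex.ofReal_sub, Complex.norm_real, Real.norm_eq_abs,
    abs_of_nonneg (sub_nonneg.2 (Real.exp_le_one_iff.2 (by linarith)))]
  have h1 := Real.add_one_le_exp (-(s * (g.eval z₀).re))
  have h2 := mul_le_mul_of_nonneg_left hg₀ hs.le
  linarith

/-- Near the part `S` of the boundary where the discriminant transforms decay, some entire
function bounded by one on `Ω` and close to one on `Q₀` is small. -/
theorem exists_entire_small_near {G : Set (ℂ × ℂ)} (hGc : IsCompact G)
    (hGb : ∀ p ∈ G, ‖p.2‖ ≤ 1 / 2) {Ω : Set ℂ} (hΩo : IsOpen Ω) (hΩc : IsPreconnected Ω)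
    (hΩcc : IsPreconnected Ωᶜ) (hΩne : Ωᶜ.Nonempty) (hΩ1 : Ω ⊆ closedBall 0 1)
    (hΩG : Disjoint Ω (Prod.fst '' G)) {l : ℂ} (hl : l ∈ Ω) (hlg : l ∉ good G) {Q₀ : Set ℂ}
    (hQ₀ : IsCompact Q₀) (hQ₀Ω : Q₀ ⊆ Ω) {S : Set ℂ} (hS : IsCompact S)
    (hdecay : ∀ A K, ∃ V, IsOpen V ∧ S ⊆ V ∧ ∀ Q, IsCompact Q → Q ⊆ V →
      Disjoint Q (Prod.fst '' G) → Decay G cau Q A K) {ε s : ℝ} (hε : 0 < ε) (hs : 0 < s) :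
    ∃ ρ > 0, ∃ δ₁ > 0, ∀ δ, 0 < δ → δ < δ₁ → ∀ o : ℝ, ∃ f : ℂ → ℂ, Differentiable ℂ f ∧
      (∀ z ∈ gridUnion o δ Ω, ‖f z‖ ≤ 1) ∧ (∀ z ∈ Q₀, ‖f z - 1‖ ≤ ε) ∧
      ∀ z ∈ frontier (gridUnion o δ Ω), z ∈ cthickening ρ S → ‖f z‖ ≤ Real.exp (-s) := by
  classical
  obtain ⟨ρ, hρ, B, hB, Q₁, hQ₁c, hQ₁Ω, hharnack⟩ := harnack_chain hΩo hΩc hl hQ₀ hQ₀Ω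
  obtain ⟨r, hr, hrΩ⟩ := Metric.nhds_basis_closedBall.mem_iff.1 (hΩo.mem_nhds hl)
  obtain ⟨A₁, hA₁, K, hfail⟩ := exists_decay_fails (fun h => disjoint_left.1 hΩG hl h) hlg
    (lt_min hρ hr)
  obtain ⟨δ', hδ', hthick⟩ := (hQ₁c.union (isCompact_closedBall l r)).exists_cthickening_subset_open
    hΩo (union_subset hQ₁Ω hrΩ)
  have ha₀ : 0 < 2 * s * (B + 1) * (1 + A₁) / ε := by positivity
  set a₀ := 2 * s * (B + 1) * (1 + A₁) / ε with ha₀def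
  obtain ⟨V, hVo, hSV, hV⟩ := hdecay (a₀ - 1) K
  obtain ⟨ρ', hρ', hρ'V⟩ := hS.exists_cthickening_subset_open hVo hSV
  refine ⟨ρ', hρ', δ' / 3, by positivity, fun δ hδ hδ₁ o => ?_⟩
  set J := gridUnion o δ Ω with hJdef
  have hball : ∀ z ∈ Q₁ ∪ closedBall l r, closedBall z (3 * δ) ⊆ Ω := fun z hz =>
    (closedBall_subset_closedBall (by linarith)).trans
      ((closedBall_subset_cthickening hz δ').trans hthick)
  have hΩb : Bornology.IsBounded Ω := isBounded_closedBall.subset hΩ1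
  have hJ : IsCompact J := isCompact_gridUnion hδ hΩb
  have hJΩ : J ⊆ Ω := gridUnion_subset
  have hYJ : frontier J ⊆ J := hJ.isClosed.frontier_subset
  have hYc : IsCompact (frontier J) := hJ.of_isClosed_subset isClosed_frontier hYJ
  have hJG : Disjoint J (Prod.fst '' G) := hΩG.mono_left hJΩ
  obtain ⟨n₁, hn₁⟩ := hV (frontier J ∩ cthickening ρ' S) (hYc.inter_right isClosed_cthickening)
    (inter_subset_right.trans hρ'V) (hJG.mono_left (inter_subset_left.trans hYJ))
  obtain ⟨T, hT, hTb⟩ := exists_sum_norm_cau_le hGc hYc (hJG.mono_left hYJ)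
  obtain ⟨n, hn, d, hd, π, hπ, z₀, hz₀, hbig⟩ := hfail (max n₁ (max 1 ⌈Real.log T⌉₊))
  have hnn₁ : n₁ ≤ n := (le_max_left _ _).trans hn
  have hn1 : 1 ≤ n := (le_max_left _ _).trans ((le_max_right _ _).trans hn)
  have hnT : Real.log T ≤ n := (Nat.le_ceil _).trans
    (by exact_mod_cast (le_max_right _ _).trans ((le_max_right _ _).trans hn))
  have hnpos : (0 : ℝ) < n := by exact_mod_cast hn1
  have hz₀r : z₀ ∈ closedBall l r := ball_subset_closedBall (ball_subset_ball (min_le_right _ _) hz₀)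
  have hz₀J : z₀ ∈ interior J := mem_interior_gridUnion hδ (hball z₀ (Or.inr hz₀r))
  obtain ⟨P, Q, hPQ⟩ := exists_polynomial_eq_bigH n d π
  have hoff : ∀ z ∈ J, ∀ i, d.z i ≠ z := fun z hz i h =>
    disjoint_left.1 hJG hz (h ▸ mem_image_of_mem _ (hd.1 i))
  have hdw : ∀ i, ‖d.w i‖ ≤ 1 / 2 := fun i => hGb _ (hd.1 i)
  have hup : ∀ z ∈ frontier J, ‖P.eval z‖ ≤ Real.exp (-(a₀ * n ^ 2) *
      (cthickening ρ' S).indicator (fun _ => 1) z + n ^ 2) * ‖Q.eval z‖ := by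
    intro z hz
    obtain ⟨-, hPz⟩ := hPQ z (hoff z (hYJ hz))
    rw [hPz, norm_mul]
    refine mul_le_mul_of_nonneg_right ?_ (norm_nonneg _)
    by_cases hzS : z ∈ cthickening ρ' S
    · rw [indicator_of_mem hzS]
      refine (hn₁ n hnn₁ d hd π hπ z ⟨hz, hzS⟩).trans (Real.exp_le_exp.2 (le_of_eq ?_))
      ring
    · rw [indicator_of_notMem hzS]
      refine (norm_bigH_le hdw hπ _).trans ?_
      rw [Fintype.card_fin]
      refine (pow_le_pow_left₀ (Finset.sum_nonneg fun _ _ => norm_nonneg _)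
        (hTb n d hd z hz) n).trans ?_
      rw [← Real.exp_log (by linarith : 0 < T), ← Real.exp_nat_mul]
      refine Real.exp_le_exp.2 ?_
      nlinarith
  have hlow : Real.exp (-(A₁ * n ^ 2)) * ‖Q.eval z₀‖ ≤ ‖P.eval z₀‖ := by
    obtain ⟨-, hPz⟩ := hPQ z₀ (hoff z₀ (interior_subset hz₀J))
    rw [hPz, norm_mul]
    refine mul_le_mul_of_nonneg_right ?_ (norm_nonneg _)
    rw [← neg_mul]
    exact hbig.le
  obtain ⟨g, hgχ, hg₀⟩ := exists_poly_of_rational_bound (J := J) (c := z₀) (P := P) (Q := Q) hJ hz₀J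
    (isPreconnected_compl_gridUnion hδ hΩcc hΩne) (hJΩ.trans hΩ1)
    (χ := (cthickening ρ' S).indicator fun _ => 1) (a := a₀ * n ^ 2) (b := n ^ 2) (k := A₁ * n ^ 2)
    (fun z _ => ⟨indicator_nonneg (fun _ _ => zero_le_one) _,
      indicator_le_self' (fun _ _ => zero_le_one) _⟩)
    (fun z hz => (hPQ z (hoff z hz)).1) (by positivity) hup hlow
    (ε := ε / (2 * s * (B + 1))) (by positivity)
  have hgτ : (g.eval z₀).re ≤ ε / (s * (B + 1)) := by
    refine hg₀.trans (le_of_eq ?_)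
    rw [ha₀def]
    field_simp
    ring
  obtain ⟨f, hf, hfn, hf1, hfQ⟩ := exists_entire_of_polynomial (Q₀ := Q₀) hs hB hJ hz₀J
    (fun z hz => interior_subset (mem_interior_gridUnion hδ (hball z (Or.inl hz))))
    (fun f hf hf1 z hz => hharnack f hf hf1 z₀ (ball_subset_ball (min_le_left _ _) hz₀) z hz)
    (fun z hz => (indicator_nonneg (fun _ _ => zero_le_one) _).trans (hgχ z hz)) hgτ
  refine ⟨f, hf, hf1, fun z hz => (hfQ z hz).trans ?_, fun z hz hzS => ?_⟩
  · have : B * (s * (ε / (s * (B + 1)))) = ε * (B / (B + 1)) := by field_simp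
    rw [this]
    refine mul_le_of_le_one_right hε.le ((div_le_one (by positivity)).2 (by linarith))
  · rw [hfn, Real.exp_le_exp]
    have := hgχ z hz
    rw [indicator_of_mem hzS] at this
    nlinarith

end HullDim

namespace HullDim
open Set Metric
open scoped ENNReal

theorem exists_open_superset_hausdorff_lt {C S : Set ℂ} (hC : MeasurableSet C) (hfin : μH[1] C < ∞)
    (hS : IsCompact S) {η : ℝ} (hη : 0 < η) :
    ∃ U, IsOpen U ∧ S ⊆ U ∧ μH[1] (C ∩ (U \ S)) < ∞ ∧ (μH[1] (C ∩ (U \ S))).toReal ≤ η := by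
  have : IsFiniteMeasure ((μH[1] : Measure ℂ).restrict C) := ⟨by simpa using hfin⟩
  obtain ⟨U, hSU, hU, hlt⟩ := S.exists_isOpen_lt_add (μ := (μH[1] : Measure ℂ).restrict C)
    (measure_ne_top _ _) (ENNReal.ofReal_pos.2 hη).ne'
  have h1 : (μH[1] : Measure ℂ).restrict C (U \ S) ≤ ENNReal.ofReal η := by
    rw [measure_sdiff hSU hS.measurableSet.nullMeasurableSet (measure_ne_top _ _)]
    exact tsub_le_iff_left.2 hlt.le
  rw [Measure.restrict_apply' hC, inter_comm] at h1
  exact ⟨U, hU, hSU, h1.trans_lt ENNReal.ofReal_lt_top, ENNReal.toReal_le_of_le_ofReal hη.le h1⟩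

theorem exists_exp_neg_mul_le (L : ℝ) {η : ℝ} (hη : 0 < η) : ∃ s > 0, Real.exp (-s) * L ≤ η := by
  have ht : Filter.Tendsto (fun s : ℝ => Real.exp (-s) * L) Filter.atTop (nhds (0 * L)) :=
    Real.tendsto_exp_neg_atTop_nhds_zero.mul_const L
  rw [zero_mul] at ht
  obtain ⟨s, h1, h2⟩ := ((ht.eventually_le_const hη).and (Filter.eventually_gt_atTop 0)).exists
  exact ⟨s, h2, h1⟩

theorem cell_meets_of_not_subset_connectedComponentIn {C : Set ℂ} {l z : ℂ} {o δ : ℝ} {p q : ℤ}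
    (hz : z ∈ connectedComponentIn Cᶜ l) (hzc : z ∈ cell o δ p q)
    (hn : ¬ cell o δ p q ⊆ connectedComponentIn Cᶜ l) : (cell o δ p q ∩ C).Nonempty := by
  by_contra h
  refine hn ?_
  rw [connectedComponentIn_eq hz]
  refine isPreconnected_cell.subset_connectedComponentIn hzc fun w hw hwC => h ⟨w, hw, hwC⟩

theorem not_exists_crossing_set {C S W V : Set ℂ} {l : ℂ} (hC : IsCompact C)
    (hconn : IsConnected C) (hCfin : μH[1] C < ∞)
    (hWo : IsOpen W) (hVo : IsOpen V) (hWV : W ∪ V = Cᶜ) (hdisj : Disjoint W V) (hl : l ∈ V)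
    (hVb : Bornology.IsBounded (connectedComponentIn Cᶜ l))
    {h : ℝ} (hh : 0 < h) (hSC : S ⊆ C) (hScomp : IsCompact S) (hSpos : 0 < volume (Complex.re '' S))
    (hS : ∀ ζ ∈ S, ∀ t ∈ Ioc (0 : ℝ) h,
        ζ + t * Complex.I ∈ W ∧ ζ + t * (-Complex.I) ∈ connectedComponentIn Cᶜ l)
    (hfun : ∀ Q₀, IsCompact Q₀ → Q₀ ⊆ connectedComponentIn Cᶜ l → ∀ ε > (0 : ℝ), ∀ s > (0 : ℝ),
      ∃ ρ > 0, ∃ δ₁ > 0, ∀ δ, 0 < δ → δ < δ₁ → ∀ o : ℝ, ∃ f : ℂ → ℂ, Differentiable ℂ f ∧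
      (∀ z ∈ gridUnion o δ (connectedComponentIn Cᶜ l), ‖f z‖ ≤ 1) ∧ (∀ z ∈ Q₀, ‖f z - 1‖ ≤ ε) ∧
      ∀ z ∈ frontier (gridUnion o δ (connectedComponentIn Cᶜ l)), z ∈ cthickening ρ S →
        ‖f z‖ ≤ Real.exp (-s)) : False := by
  classical
  set Ω := connectedComponentIn Cᶜ l with hΩ
  have hΩo : IsOpen Ω := hC.isClosed.isOpen_compl.connectedComponentIn
  have hΩne : Ωᶜ.Nonempty := by
    obtain ⟨c, hc⟩ := hconn.nonempty
    exact ⟨c, fun h => connectedComponentIn_subset _ _ h hc⟩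
  set σ := volume.real (Complex.re '' S) with hσ
  have hσ0 : 0 < σ := ENNReal.toReal_pos hSpos.ne'
    (hScomp.image Complex.continuous_re).measure_lt_top.ne
  obtain ⟨U, hU, hSU, hUfin, hUη⟩ := exists_open_superset_hausdorff_lt hC.isClosed.measurableSet
    hCfin hScomp (η := σ / 100) (by positivity)
  obtain ⟨r₀, hr₀, hr₀U⟩ := hScomp.exists_cthickening_subset_open hU hSU
  obtain ⟨c₁, hc₁, c₂, hc₂, hc₁₂⟩ : ∃ c₁ ∈ C, ∃ c₂ ∈ C, c₁ ≠ c₂ := by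
    by_contra! hsub
    have : (Complex.re '' S).Subsingleton := by
      rintro _ ⟨a, ha, rfl⟩ _ ⟨b, hb, rfl⟩
      rw [hsub a (hSC ha) b (hSC hb)]
    exact hSpos.ne' (this.measure_zero volume)
  set δ₀ := r₀ / 4 with hδ₀
  have hδ₀0 : 0 < δ₀ := by positivity
  obtain ⟨o, hgen⟩ := exists_generic_offset hCfin δ₀
  have hcellthick : ∀ p q, (cell o δ₀ p q ∩ S).Nonempty → ∀ z ∈ cell o δ₀ p q, ∀ w, dist w z ≤ δ₀ →
      w ∈ cthickening r₀ S := by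
    rintro p q ⟨x, hx, hxS⟩ z hz w hw
    refine mem_cthickening_of_dist_le w x _ _ hxS ?_
    have h1 := dist_le_of_mem_cell hz hx
    have h2 := dist_triangle w z x
    linarith
  have hFfin : {κ : ℤ × ℤ | (cell o δ₀ κ.1 κ.2 ∩ S).Nonempty}.Finite :=
    (finite_cells_subset (o := o) hδ₀0 (hScomp.isBounded.cthickening (δ := r₀))).subset
      fun κ hκ z hz => hcellthick κ.1 κ.2 hκ z hz z (by simpa using hδ₀0.le)
  set F := hFfin.toFinset with hF
  have hmemF : ∀ κ, κ ∈ F ↔ (cell o δ₀ κ.1 κ.2 ∩ S).Nonempty := by simp [hF]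
  obtain ⟨s, hs, hsL⟩ := exists_exp_neg_mul_le (μH[1] C).toReal (η := σ / 100) (by positivity)
  obtain ⟨Q₀, hQ₀Ω, hQ₀, hleft⟩ := exists_compact_sum_boundaryLeftover_le hΩo hΩne hVb o δ₀ F
    (η := σ / 100) (by positivity)
  set ε := σ / 100 / (4 * δ₀ * (F.card + 1)) with hε
  have hε0 : 0 < ε := by positivity
  obtain ⟨ρ, hρ, δ₁, hδ₁, hfun⟩ := hfun Q₀ hQ₀ hQ₀Ω ε hε0 s hs
  obtain ⟨r₁, hr₁, hr₁Ω⟩ := hQ₀.exists_cthickening_subset_open hΩo hQ₀Ω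
  have hdist : 0 < dist c₁ c₂ := dist_pos.2 hc₁₂
  set μ := min (min δ₁ (ρ / 3)) (min (r₁ / 2) (dist c₁ c₂ / 2)) with hμ
  have hμ0 : 0 < μ := by positivity
  obtain ⟨m, hm⟩ := exists_nat_one_div_lt (K := ℝ) (ε := μ / δ₀) (by positivity)
  set δ := δ₀ / (m + 1) with hδ
  have hδ0 : 0 < δ := by positivity
  have hδμ : δ < μ := by
    rw [lt_div_iff₀ hδ₀0] at hm
    calc δ = 1 / (m + 1) * δ₀ := by rw [hδ]; ring
      _ < μ := hm
  have hδ₀m : δ₀ = (m + 1) * δ := by rw [hδ]; field_simp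
  have hδle : δ ≤ δ₀ := by
    rw [hδ₀m]
    have : (0 : ℝ) ≤ m := m.cast_nonneg
    nlinarith
  have hb1 : δ < δ₁ := hδμ.trans_le ((min_le_left _ _).trans (min_le_left _ _))
  have hb2 : δ < ρ / 3 := hδμ.trans_le ((min_le_left _ _).trans (min_le_right _ _))
  have hb3 : δ < r₁ / 2 := hδμ.trans_le ((min_le_right _ _).trans (min_le_left _ _))
  have hb4 : δ < dist c₁ c₂ / 2 := hδμ.trans_le ((min_le_right _ _).trans (min_le_right _ _))
  obtain ⟨f, hf, hf1, hfQ, hfs⟩ := hfun δ hδ0 hb1 o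
  let w : ℤ × ℤ → ℝ := fun κ => if (cell o δ κ.1 κ.2 ∩ C).Nonempty then
    Real.exp (-s) + (if cell o δ κ.1 κ.2 ⊆ cthickening ρ S then 0 else 1) else 0
  have hw : ∀ κ, 0 ≤ w κ := fun κ => by
    have := Real.exp_pos (-s)
    simp only [w]
    split_ifs <;> linarith
  have hadj : ∀ p q p' q' : ℤ, cell o δ p q ⊆ Ω → ¬ cell o δ p' q' ⊆ Ω → ∀ z ∈ cell o δ p q,
      z ∈ cell o δ p' q' → ‖f z‖ ≤ w (p', q') := by
    intro p q p' q' hpq hpq' z hz hz'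
    have hmeet := cell_meets_of_not_subset_connectedComponentIn (hpq hz) hz' hpq'
    simp only [w]
    rw [if_pos hmeet]
    split_ifs with hc
    · rw [add_zero]
      exact hfs z (mem_frontier_gridUnion hδ0 hpq hpq' hz hz') (hc hz')
    · have := hf1 z (cell_subset_gridUnion hpq hz)
      have := Real.exp_pos (-s)
      linarith
  have hQ : ∀ p q : ℤ, ∀ z ∈ cell o δ p q, z ∈ Q₀ → cell o δ p q ⊆ Ω := by
    intro p q z hz hzQ x hx
    refine hr₁Ω (mem_cthickening_of_dist_le x z _ _ hzQ ?_)
    have := dist_le_of_mem_cell hx hz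
    linarith
  have hfar : ∀ c ∈ C, ∃ c' ∈ C, δ ≤ dist c' c := by
    intro c _
    by_contra! hc
    have h1 := hc c₁ hc₁
    have h2 := hc c₂ hc₂
    have h3 := dist_triangle_right c₁ c₂ c
    linarith
  have key := sum_fine_cells_le (C := C) (S := S) (U := U) (N := cthickening ρ S)
    hconn.isPreconnected hU.measurableSet hScomp.measurableSet
    hCfin (o := o) (e := Real.exp (-s)) hδ0 hδ₀m (Real.exp_pos _).le hfar (F := F)
    (fun κ hκ z hz x hx => hr₀U (hcellthick κ.1 κ.2 ((hmemF κ).1 hκ) z hz x (hx.le.trans hδle)))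
    (by
      rintro z ⟨x, hx, hxS⟩
      refine mem_cthickening_of_dist_le z x _ _ hxS ?_
      rw [mem_ball, dist_comm] at hx
      linarith) (w := w)
    (fun κ h1 h2 => by simp only [w]; rw [if_pos h1, if_pos h2, add_zero])
    (fun κ h1 => by
      simp only [w]
      rw [if_pos h1]
      split_ifs <;> linarith)
    (fun κ h1 => by simp only [w]; rw [if_neg h1])
  have low := le_sum_integral_edges hC.isClosed hWo hVo hWV hdisj hl hh hSC hScomp hS hU hδ₀0
    (F := F) (o := o)
    (fun κ hκ z hz => hr₀U (hcellthick κ.1 κ.2 ((hmemF κ).1 hκ) z hz z (by simpa using hδ₀0.le)))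
    (fun κ hκ => (hmemF κ).2 hκ) hgen hUfin
  have up := Finset.sum_le_sum fun κ (_ : κ ∈ F) => integral_edges_le hΩo.measurableSet
    hQ₀.isClosed.measurableSet hf hδ0 hε0.le hw hadj
    (fun p q hpq z hz => hf1 z (cell_subset_gridUnion hpq hz)) hfQ hQ m hδ₀m κ.1 κ.2
  rw [Finset.sum_add_distrib, Finset.sum_add_distrib, Finset.sum_const, nsmul_eq_mul,
    ← Finset.mul_sum F _ 4, ← Finset.mul_sum F _ δ, ← Finset.mul_sum F _ 2] at up
  have hεF : F.card * (4 * (ε * δ₀)) ≤ σ / 100 := by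
    have hcard : (0 : ℝ) < F.card + 1 := Nat.cast_add_one_pos _
    have : ε * (4 * δ₀ * (F.card + 1)) = σ / 100 := div_mul_cancel₀ _ (mul_pos (mul_pos four_pos hδ₀0) hcard).ne'
    nlinarith [mul_pos hε0 hδ₀0]
  have := low.trans up
  linarith

end HullDim

namespace HullDim
open Set Metric
open scoped ENNReal

theorem lipschitzWith_re_fst : LipschitzWith 1 fun p : ℂ × ℂ => p.1.re :=
  LipschitzWith.of_dist_le_mul fun p q => by
    rw [NNReal.coe_one, one_mul, Real.dist_eq, ← Complex.sub_re]
    refine (Complex.abs_re_le_norm _).trans ?_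
    rw [← dist_eq_norm]
    exact le_max_left _ _

theorem hausdorffMeasure_fst_image_lt_top {G : Set (ℂ × ℂ)} (hG : μH[1] G < ∞) :
    μH[1] (Prod.fst '' G) < ∞ := by
  have := (LipschitzWith.prod_fst (α := ℂ) (β := ℂ)).hausdorffMeasure_image_le zero_le_one G
  simp only [ENNReal.coe_one, ENNReal.one_rpow, one_mul] at this
  exact this.trans_lt hG

theorem good_eq_compl {G : Set (ℂ × ℂ)} (hGc : IsCompact G) (hGconn : IsConnected G)
    (hGfin : μH[1] G < ∞) (hG1 : ∀ p ∈ G, ‖p.1‖ ≤ 1 / 2 ∧ ‖p.2‖ ≤ 1 / 2) :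
    good G = (Prod.fst '' G)ᶜ := by
  have hG2 : ∀ p ∈ G, ‖p.2‖ ≤ 1 / 2 := fun p hp => (hG1 p hp).2
  set C := Prod.fst '' G with hCdef
  have hC : IsCompact C := hGc.image continuous_fst
  have hconn : IsConnected C := hGconn.image _ continuous_fst.continuousOn
  have hCfin : μH[1] C < ∞ := hausdorffMeasure_fst_image_lt_top hGfin
  have hgC : good G ⊆ Cᶜ := fun z hz => hz.1
  by_contra hne
  have hspread : ∀ T, IsPreconnected T → Disjoint T C → (∃ z ∈ T, z ∉ good G) →
      Disjoint T (good G) := by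
    rintro T hT hTC ⟨z, hz, hzg⟩
    by_contra hd
    exact hzg (subset_good_of_isPreconnected hGc hG2 hT hTC (not_disjoint_iff_nonempty_inter.1 hd)
      hz)
  set V := Cᶜ \ good G with hV
  have hVo : IsOpen V := by
    rw [Metric.isOpen_iff]
    rintro z ⟨hzC, hzg⟩
    obtain ⟨r, hr, hb⟩ := Metric.isOpen_iff.1 hC.isClosed.isOpen_compl z hzC
    refine ⟨r, hr, fun x hx => ⟨hb hx, ?_⟩⟩
    exact disjoint_left.1 (hspread (ball z r) (convex_ball z r).isPreconnected
      (disjoint_left.2 fun x hx => hb hx)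
      ⟨z, mem_ball_self hr, hzg⟩) hx
  have hV1 : V ⊆ closedBall 0 1 := by
    rintro z ⟨hzC, hzg⟩
    by_contra h1
    rw [mem_closedBall_zero_iff, not_le] at h1
    refine hzg ⟨hzC, ‖z‖ - 1, by linarith, fun A K => (decay_base hG1 A K).mono fun x hx => ?_⟩
    rw [mem_ball, dist_eq_norm] at hx
    have := norm_sub_norm_le z x
    rw [norm_sub_rev] at hx
    simp only [mem_ofPred_eq]
    linarith
  have hVne : V.Nonempty := by
    rw [hV, sdiff_nonempty]
    exact fun h => hne (hgC.antisymm h)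
  have hN := volume_setOf_infinite_fibre lipschitzWith_re_fst hGc.isClosed.measurableSet hGfin
  have hWV : good G ∪ V = Cᶜ := union_sdiff_cancel hgC
  have hdisj : Disjoint (good G) V := disjoint_sdiff_right
  obtain ⟨l, hl, h, hh, S, hSC, hScomp, hSpos, hS⟩ := exists_compact_crossing_set hC hCfin
    (isOpen_good hGc) hVo hWV hdisj (isBounded_closedBall.subset hV1) hVne hN
  have hlΩ : l ∈ connectedComponentIn Cᶜ l := mem_connectedComponentIn hl.1
  have hΩC : Disjoint (connectedComponentIn Cᶜ l) C :=
    disjoint_left.2 fun z hz => connectedComponentIn_subset _ _ hz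
  have hΩ1 : connectedComponentIn Cᶜ l ⊆ closedBall 0 1 := fun z hz =>
    hV1 ⟨connectedComponentIn_subset _ _ hz, disjoint_left.1
      (hspread _ isPreconnected_connectedComponentIn hΩC ⟨l, hlΩ, hl.2⟩) hz⟩
  refine not_exists_crossing_set hC hconn hCfin (isOpen_good hGc) hVo hWV hdisj hl
    (isBounded_closedBall.subset hΩ1) hh hSC hScomp hSpos (fun ζ hζ => (hS ζ hζ).2) ?_
  intro Q₀ hQ₀ hQ₀Ω ε hε s hs
  refine exists_entire_small_near hGc hG2 hC.isClosed.isOpen_compl.connectedComponentIn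
    isPreconnected_connectedComponentIn (isPreconnected_compl_connectedComponentIn hC.isClosed hconn)
    (hconn.nonempty.mono fun c hc hcΩ => disjoint_left.1 hΩC hcΩ hc) hΩ1 hΩC hlΩ hl.2 hQ₀ hQ₀Ω
    hScomp (fun A K => exists_open_decay hScomp fun ζ hζ => ?_) hε hs
  refine exists_decay_near hGc hG2 (hSC hζ) ?_ hh (fun y hy => ((hS ζ hζ).2 y hy).1) A K
  have hfin : (G ∩ (fun p : ℂ × ℂ => p.1.re) ⁻¹' {ζ.re}).Finite := not_infinite.1 (hS ζ hζ).1
  exact (hfin.image Prod.snd).subset fun w hw => ⟨(ζ, w), ⟨hw, rfl⟩, rfl⟩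

end HullDim

namespace HullDim
open Set Metric
open scoped ENNReal

theorem isCompact_convexHull_of_finiteDimensional {E : Type*} [NormedAddCommGroup E]
    [NormedSpace ℝ E] [FiniteDimensional ℝ E] {K : Set E} (hK : IsCompact K) :
    IsCompact (convexHull ℝ K) := by
  classical
  rcases K.eq_empty_or_nonempty with rfl | ⟨k₀, hk₀⟩
  · simp
  set D := Module.finrank ℝ E + 1
  have himg : convexHull ℝ K = (fun x : (Fin D → ℝ) × (Fin D → E) => ∑ i, x.1 i • x.2 i) ''
      (stdSimplex ℝ (Fin D) ×ˢ Set.pi univ fun _ => K) := by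
    refine Subset.antisymm ?_ ?_
    · intro x hx
      obtain ⟨ι, _, z, w, hz, hind, hw, hw1, rfl⟩ := eq_pos_convex_span_of_mem_convexHull hx
      have hcard : Fintype.card ι ≤ Fintype.card (Fin D) := by
        rw [Fintype.card_fin]
        exact hind.card_le_finrank_succ.trans (Nat.succ_le_succ (Submodule.finrank_le _))
      obtain ⟨e⟩ := Function.Embedding.nonempty_of_card_le hcard
      have hext : ∀ i ∉ range e, Function.extend e w 0 i = 0 := fun i hi =>
        Function.extend_apply' _ _ _ fun ⟨j, hj⟩ => hi ⟨j, hj⟩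
      refine ⟨⟨Function.extend e w 0, Function.extend e z fun _ => k₀⟩, ⟨⟨fun i => ?_, ?_⟩, ?_⟩, ?_⟩
      · by_cases hi : i ∈ range e
        · obtain ⟨j, rfl⟩ := hi
          exact (hw j).le.trans_eq (e.injective.extend_apply w 0 j).symm
        · exact (hext i hi).ge
      · rw [← hw1]
        exact (Fintype.sum_of_injective e e.injective w _ hext fun i =>
          (e.injective.extend_apply _ _ _).symm).symm
      · intro i _
        by_cases hi : i ∈ range e
        · obtain ⟨j, rfl⟩ := hi
          simp only [e.injective.extend_apply]
          exact hz ⟨j, rfl⟩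
        · simpa only [Function.extend_apply' _ _ _ (show ¬ ∃ j, e j = i from hi)] using hk₀
      · refine (Fintype.sum_of_injective e e.injective (fun i => w i • z i) _ (fun i hi => ?_)
          fun i => ?_).symm
        · simp only [hext i hi, zero_smul]
        · simp only [e.injective.extend_apply]
    · rintro _ ⟨⟨w, z⟩, ⟨⟨hw, hw1⟩, hz⟩, rfl⟩
      exact (convex_convexHull ℝ K).sum_mem (fun i _ => hw i) hw1 fun i _ =>
        subset_convexHull ℝ K (hz i (mem_univ i))
  rw [himg]
  exact ((isCompact_stdSimplex ℝ _).prod (isCompact_univ_pi fun _ => hK)).image (by fun_prop)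

/-- All monomials of bidegree at most `(N, N)` at a point of `ℂ × ℂ`. -/
def monomials (N : ℕ) (p : ℂ × ℂ) : Fin (N + 1) × Fin (N + 1) → ℂ :=
  fun i => p.1 ^ (i.1 : ℕ) * p.2 ^ (i.2 : ℕ)

/-- The polynomially convex hull of a subset of `ℂ × ℂ`. -/
def hull₂ (G : Set (ℂ × ℂ)) : Set (ℂ × ℂ) :=
  {p | ∀ (N : ℕ) (a : Fin (N + 1) × Fin (N + 1) → ℂ) (M : ℝ),
    (∀ q ∈ G, ‖∑ i, a i * monomials N q i‖ ≤ M) → ‖∑ i, a i * monomials N p i‖ ≤ M}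

theorem continuous_monomials (N : ℕ) : Continuous (monomials N) := by
  unfold monomials
  fun_prop

theorem norm_fst_le_of_mem_hull₂ {G : Set (ℂ × ℂ)} {M : ℝ} (h : ∀ q ∈ G, ‖q.1‖ ≤ M) {p : ℂ × ℂ}
    (hp : p ∈ hull₂ G) : ‖p.1‖ ≤ M := by
  have := hp 1 (Pi.single (1, 0) 1) M
  simpa [Pi.single_apply, monomials] using this (by simpa [Pi.single_apply, monomials] using h)

theorem norm_snd_le_of_mem_hull₂ {G : Set (ℂ × ℂ)} {M : ℝ} (h : ∀ q ∈ G, ‖q.2‖ ≤ M) {p : ℂ × ℂ}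
    (hp : p ∈ hull₂ G) : ‖p.2‖ ≤ M := by
  have := hp 1 (Pi.single (0, 1) 1) M
  simpa [Pi.single_apply, monomials] using this (by simpa [Pi.single_apply, monomials] using h)

theorem monomials_mem_convexHull {G : Set (ℂ × ℂ)} (hG : IsCompact G) {p : ℂ × ℂ}
    (hp : p ∈ hull₂ G) (N : ℕ) : monomials N p ∈ convexHull ℝ (monomials N '' G) := by
  by_contra hn
  obtain ⟨f, u, hfu, hu⟩ := RCLike.geometric_hahn_banach_point_closed (𝕜 := ℂ)
    (convex_convexHull ℝ _) (isCompact_convexHull_of_finiteDimensional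
      (hG.image (continuous_monomials N))).isClosed hn
  simp only [RCLike.re_eq_complex_re] at hfu hu
  obtain ⟨M, hM⟩ := hG.exists_bound_of_continuousOn
    (f.continuous.comp (continuous_monomials N)).continuousOn
  simp only [Function.comp_apply] at hM
  have hf : ∀ v, f v = ∑ i, f (Pi.single i 1) * v i := fun v => by
    have := LinearMap.pi_apply_eq_sum_univ f.toLinearMap v
    simp only [smul_eq_mul] at this
    refine this.trans (Finset.sum_congr rfl fun i _ => ?_)
    rw [mul_comm]
    have e : (Pi.single i 1 : Fin (N + 1) × Fin (N + 1) → ℂ) = fun j => if i = j then 1 else 0 := by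
      funext j
      simp [Pi.single_apply, eq_comm]
    rw [e]
    rfl
  set t := (f (monomials N p)).re with ht
  set R := |t| + M ^ 2 / (2 * (u - t)) + 1 with hR
  have hut : 0 < u - t := sub_pos.2 hfu
  have hRt : t < R := by
    have h1 := le_abs_self t
    have h2 : 0 ≤ M ^ 2 / (2 * (u - t)) := by positivity
    linarith
  have hRM : M ^ 2 < 2 * R * (u - t) := by
    have h1 : M ^ 2 / (2 * (u - t)) < R := by
      have := abs_nonneg t
      linarith
    rw [div_lt_iff₀ (by positivity)] at h1
    linarith
  let a : Fin (N + 1) × Fin (N + 1) → ℂ :=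
    Pi.single (0, 0) (R : ℂ) - fun i => f (Pi.single i 1)
  have heval : ∀ q, ∑ i, a i * monomials N q i = R - f (monomials N q) := fun q => by
    rw [hf (monomials N q)]
    simp only [a, Pi.sub_apply, sub_mul, Finset.sum_sub_distrib]
    congr 1
    rw [Finset.sum_eq_single (0, 0)]
    · simp [monomials]
    · intro i _ hi
      rw [Pi.single_eq_of_ne hi, zero_mul]
    · simp
  have hbound : ∀ q ∈ G, ‖(R : ℂ) - f (monomials N q)‖ ≤ √(R ^ 2 - 2 * R * u + M ^ 2) := by
    intro q hq
    refine Real.le_sqrt_of_sq_le ?_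
    have h1 := hu _ (subset_convexHull ℝ _ (mem_image_of_mem _ hq))
    have h2 := pow_le_pow_left₀ (norm_nonneg _) (hM q hq) 2
    have hR0 : 0 < R := by
      have h2 : 0 ≤ M ^ 2 / (2 * (u - t)) := by positivity
      have := abs_nonneg t
      linarith
    rw [Complex.sq_norm, Complex.normSq_apply] at h2 ⊢
    simp only [Complex.sub_re, Complex.ofReal_re, Complex.sub_im, Complex.ofReal_im]
    nlinarith
  have hfin := hp N a _ fun q hq => by
    rw [heval]
    exact hbound q hq
  rw [heval] at hfin
  have h3 : R - t ≤ √(R ^ 2 - 2 * R * u + M ^ 2) := by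
    refine le_trans ?_ hfin
    refine le_trans (le_of_eq ?_) (Complex.re_le_norm _)
    simp [ht]
  have h4 := Real.le_sqrt' (sub_pos.2 hRt) |>.1 h3
  nlinarith [sq_nonneg t]

end HullDim

namespace HullDim
open Set Metric Polynomial
open scoped ENNReal

theorem exists_disc_eq_mul_det_sq (n : ℕ) :
    ∃ s : ℂ, ∀ u : Fin n → ℂ, disc u = s * (Matrix.vandermonde u).det ^ 2 := by
  classical
  refine ⟨∏ i : Fin n, ∏ _j ∈ Finset.Ioi i, (-1), fun u => ?_⟩
  have h1 : ∏ i : Fin n, ∏ j ∈ Finset.Ioi i, (u i - u j) =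
      (∏ i : Fin n, ∏ _j ∈ Finset.Ioi i, (-1)) * (Matrix.vandermonde u).det := by
    rw [Matrix.det_vandermonde, ← Finset.prod_mul_distrib]
    refine Finset.prod_congr rfl fun i _ => ?_
    rw [← Finset.prod_mul_distrib]
    exact Finset.prod_congr rfl fun j _ => by ring
  have h2 : ∏ i : Fin n, ∏ j ∈ Finset.Iio i, (u i - u j) = (Matrix.vandermonde u).det := by
    rw [Matrix.det_vandermonde]
    exact Finset.prod_comm' fun i j => by simp
  rw [pow_two, ← mul_assoc, ← h1, ← h2, ← Finset.prod_mul_distrib]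
  unfold disc
  refine Finset.prod_congr rfl fun i _ => ?_
  have hd : Disjoint (Finset.Ioi i) (Finset.Iio i) := Finset.disjoint_left.2 fun j hj hj' => by
    simp only [Finset.mem_Ioi, Finset.mem_Iio] at hj hj'
    exact lt_asymm hj hj'
  have h3 : (Finset.univ : Finset (Fin n)).erase i =
      (Finset.Ioi i).disjUnion (Finset.Iio i) hd := by
    ext j
    simp only [Finset.mem_erase, Finset.mem_univ, and_true, Finset.mem_disjUnion, Finset.mem_Ioi,
      Finset.mem_Iio]
    exact ne_comm.trans lt_or_lt_iff_ne.symm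
  rw [← Finset.prod_disjUnion hd, ← h3, ← Finset.mul_prod_erase _ _ (Finset.mem_univ i), if_pos rfl,
    one_mul]
  refine Finset.prod_congr rfl fun j hj => ?_
  rw [if_neg (Finset.ne_of_mem_erase hj).symm]

theorem bigH_one_eq_sum_perm {n : ℕ} {s : ℂ}
    (hs : ∀ u : Fin n → ℂ, disc u = s * (Matrix.vandermonde u).det ^ 2)
    {ι : Type*} [Fintype ι] (w c : ι → ℂ) :
    bigH (Fin n) w 1 c = s * ∑ σ : Equiv.Perm (Fin n), ∑ τ : Equiv.Perm (Fin n),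
      ((Equiv.Perm.sign σ : ℤ) : ℂ) * ((Equiv.Perm.sign τ : ℤ) : ℂ) *
        ∏ i, ∑ l, c l * w l ^ ((σ i : ℕ) + (τ i : ℕ)) := by
  classical
  have e : ∀ f : Fin n → ι, disc (w ∘ f) * ∏ i, ((1 : ℂ[X]).eval (w (f i)) * c (f i)) =
      ∑ σ : Equiv.Perm (Fin n), ∑ τ : Equiv.Perm (Fin n),
      s * (((Equiv.Perm.sign σ : ℤ) : ℂ) * ((Equiv.Perm.sign τ : ℤ) : ℂ) *
        ∏ i, c (f i) * w (f i) ^ ((σ i : ℕ) + (τ i : ℕ))) := by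
    intro f
    rw [hs, ← Matrix.det_transpose, Matrix.det_apply', pow_two, Finset.sum_mul_sum,
      Finset.mul_sum, Finset.sum_mul]
    refine Finset.sum_congr rfl fun σ _ => ?_
    rw [Finset.mul_sum, Finset.sum_mul]
    refine Finset.sum_congr rfl fun τ _ => ?_
    simp only [Matrix.transpose_apply, Matrix.vandermonde_apply, Function.comp_apply, eval_one,
      one_mul, Finset.prod_mul_distrib, pow_add]
    ring
  unfold bigH
  rw [Finset.sum_congr rfl fun f _ => e f, Finset.sum_comm, Finset.mul_sum]
  refine Finset.sum_congr rfl fun σ _ => ?_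
  rw [Finset.sum_comm, Finset.mul_sum]
  refine Finset.sum_congr rfl fun τ _ => ?_
  rw [← Finset.mul_sum, ← Finset.mul_sum, Finset.prod_univ_sum, Fintype.piFinset_univ]

theorem bigH_one_eq_of_moments {n : ℕ} {ι ι' : Type*} [Fintype ι] [Fintype ι'] {w : ι → ℂ}
    {w' : ι' → ℂ} {c : ι → ℂ} {c' : ι' → ℂ}
    (h : ∀ j ≤ 2 * n, ∑ l, c l * w l ^ j = ∑ l, c' l * w' l ^ j) :
    bigH (Fin n) w 1 c = bigH (Fin n) w' 1 c' := by
  obtain ⟨s, hs⟩ := exists_disc_eq_mul_det_sq n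
  rw [bigH_one_eq_sum_perm hs, bigH_one_eq_sum_perm hs]
  congr 1
  refine Finset.sum_congr rfl fun σ _ => Finset.sum_congr rfl fun τ _ => ?_
  congr 1
  refine Finset.prod_congr rfl fun i _ => h _ ?_
  have := (σ i).2
  have := (τ i).2
  omega

theorem disc_eq_zero_of_not_injective {n : ℕ} {u : Fin n → ℂ} (hu : ¬ Function.Injective u) :
    disc u = 0 := by
  classical
  simp only [Function.Injective, not_forall] at hu
  obtain ⟨i, j, hij, hne⟩ := hu
  unfold disc
  refine Finset.prod_eq_zero (Finset.mem_univ i) (Finset.prod_eq_zero (Finset.mem_univ j) ?_)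
  rw [if_neg hne, hij, sub_self]

theorem bigH_one_uniform (n : ℕ) (u : Fin n → ℂ) :
    bigH (Fin n) u 1 (fun _ => (n : ℂ)⁻¹) = (n.factorial / n ^ n : ℂ) * disc u := by
  classical
  unfold bigH
  simp only [eval_one, one_mul, Finset.prod_const, Finset.card_univ, Fintype.card_fin]
  have := Fintype.sum_of_injective (fun σ : Equiv.Perm (Fin n) => (σ : Fin n → Fin n))
    DFunLike.coe_injective (fun _ => disc u * (n : ℂ)⁻¹ ^ n)
    (fun f => disc (u ∘ f) * (n : ℂ)⁻¹ ^ n) (fun f hf => ?_) (fun σ => ?_)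
  · rw [← this, Finset.sum_const, Finset.card_univ, Fintype.card_perm, Fintype.card_fin,
      nsmul_eq_mul, inv_pow, div_eq_mul_inv]
    ring
  · rw [disc_eq_zero_of_not_injective, zero_mul]
    intro hinj
    exact hf ⟨Equiv.ofBijective f (Finite.injective_iff_bijective.1 hinj.of_comp), rfl⟩
  · simp only [disc_comp_equiv]

theorem exists_isRep_bigH_eq {G : Set (ℂ × ℂ)} (hG : IsCompact G)
    (hG1 : ∀ p ∈ G, ‖p.1‖ ≤ 1 / 2) {z : ℂ} (hz : z ∉ Prod.fst '' G) {n : ℕ} (hn : 1 ≤ n)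
    {u : Fin n → ℂ} (hu : ∀ i, (z, u i) ∈ hull₂ G) :
    ∃ d : Data, d.IsRep G n ∧
      bigH (Fin n) d.w 1 (cau d z) = (n.factorial / n ^ n : ℂ) * disc u := by
  classical
  have hz1 : ‖z‖ ≤ 1 / 2 := norm_fst_le_of_mem_hull₂ hG1 (hu ⟨0, hn⟩)
  have hn0 : (n : ℝ) ≠ 0 := by positivity
  have hn0' : (n : ℂ) ≠ 0 := by exact_mod_cast hn0
  have hmem : ∑ i, (n : ℝ)⁻¹ • monomials (n ^ 3 + 1) (z, u i) ∈
      convexHull ℝ (monomials (n ^ 3 + 1) '' G) :=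
    (convex_convexHull ℝ _).sum_mem (fun i _ => by positivity) (by simp [hn0])
      fun i _ => monomials_mem_convexHull hG (hu i) _
  obtain ⟨ι, _, c, v, hc, hc1, hv, hsum⟩ := mem_convexHull_iff_exists_fintype.1 hmem
  choose y hyG hy using hv
  let e := Fintype.equivFin ι
  have hmom : ∀ a ≤ n ^ 3 + 1, ∀ b ≤ n ^ 3 + 1,
      ∑ l, (c l : ℂ) * ((y l).1 ^ a * (y l).2 ^ b) = ∑ i, (n : ℂ)⁻¹ * (z ^ a * u i ^ b) := by
    intro a ha b hb
    have := congrFun hsum (⟨a, by omega⟩, ⟨b, by omega⟩)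
    simp only [Finset.sum_apply, Pi.smul_apply, ← hy, monomials, Complex.real_smul] at this
    simpa using this
  let d : Data := ⟨Fintype.card ι, fun l => c (e.symm l) * ((y (e.symm l)).1 - z),
    fun l => (y (e.symm l)).1, fun l => (y (e.symm l)).2⟩
  have hzl : ∀ l, d.z l - z ≠ 0 := fun l h => hz ⟨_, hyG (e.symm l), sub_eq_zero.1 h⟩
  have hcau : cau d z = fun l => (c (e.symm l) : ℂ) := funext fun l =>
    mul_div_cancel_right₀ _ (hzl l)
  refine ⟨d, ⟨fun l => hyG _, ?_, fun a ha b hb => ?_⟩, ?_⟩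
  · rw [e.symm.sum_comp fun l => ‖(c l : ℂ) * ((y l).1 - z)‖, ← hc1]
    refine Finset.sum_le_sum fun l _ => ?_
    rw [norm_mul, Complex.norm_real, Real.norm_of_nonneg (hc l)]
    refine mul_le_of_le_one_right (hc l) ((norm_sub_le _ _).trans ?_)
    have := hG1 _ (hyG l)
    linarith
  · rw [e.symm.sum_comp fun l => (c l : ℂ) * ((y l).1 - z) * (y l).1 ^ a * (y l).2 ^ b]
    have h1 := hmom (a + 1) (by omega) b (by omega)
    have h2 := hmom a (by omega) b (by omega)
    calc ∑ l, (c l : ℂ) * ((y l).1 - z) * (y l).1 ^ a * (y l).2 ^ b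
        = ∑ l, (c l : ℂ) * ((y l).1 ^ (a + 1) * (y l).2 ^ b) -
          z * ∑ l, (c l : ℂ) * ((y l).1 ^ a * (y l).2 ^ b) := by
          rw [Finset.mul_sum, ← Finset.sum_sub_distrib]
          exact Finset.sum_congr rfl fun l _ => by ring
      _ = 0 := by
          rw [h1, h2, Finset.mul_sum, ← Finset.sum_sub_distrib]
          exact Finset.sum_eq_zero fun l _ => by ring
  · rw [← bigH_one_uniform, hcau]
    refine bigH_one_eq_of_moments fun j hj => ?_
    rw [e.symm.sum_comp fun l => (c l : ℂ) * (y l).2 ^ j]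
    have hj' : j ≤ n ^ 3 + 1 := by
      have : 2 * n ≤ n ^ 3 + 1 := by
        rcases n with _ | _ | n
        · omega
        · omega
        · nlinarith [sq_nonneg n, pow_succ (n + 2) 2, pow_succ (n + 2) 1]
      omega
    simpa using hmom 0 (by omega) j hj'

end HullDim

namespace HullDim
open Set Metric Polynomial
open scoped ENNReal

theorem lintegral_neg_log_lt_top :
    ∫⁻ x in Icc (-1 : ℝ) 1, ENNReal.ofReal (-Real.log x) < ∞ := by
  have h := (intervalIntegral.intervalIntegrable_log' (a := -1) (b := 1)).1.neg
  rw [← setLIntegral_congr (Ioc_ae_eq_Icc (α := ℝ) (a := -1) (b := 1) (μ := volume))]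
  refine lt_of_le_of_lt (lintegral_mono fun x => ?_) h.hasFiniteIntegral
  rw [← ofReal_norm]
  exact ENNReal.ofReal_le_ofReal (le_abs_self _)

theorem lintegral_neg_log_sub_le {t : ℝ} (ht : t ∈ Icc (-(1 / 2) : ℝ) (1 / 2)) :
    ∫⁻ x in Icc (-(1 / 2) : ℝ) (1 / 2), ENNReal.ofReal (-Real.log (x - t)) ≤
      ∫⁻ x in Icc (-1 : ℝ) 1, ENNReal.ofReal (-Real.log x) := by
  rw [← lintegral_indicator measurableSet_Icc, ← lintegral_indicator measurableSet_Icc,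
    ← lintegral_sub_right_eq_self ((Icc (-1 : ℝ) 1).indicator _) t]
  refine lintegral_mono fun x => ?_
  by_cases hx : x ∈ Icc (-(1 / 2) : ℝ) (1 / 2)
  · rw [indicator_of_mem hx, indicator_of_mem]
    constructor <;> linarith [hx.1, hx.2, ht.1, ht.2]
  · rw [indicator_of_notMem hx]
    exact zero_le

theorem exists_mem_sum_neg_log_lt {T : Set ℝ} (hT : T ⊆ Icc (-(1 / 2)) (1 / 2)) {M : ℝ}
    (hM : ∫⁻ x in Icc (-1 : ℝ) 1, ENNReal.ofReal (-Real.log x) < ENNReal.ofReal M * volume T)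
    {n : ℕ} {t : Fin n → ℝ} (ht : ∀ i, t i ∈ T) :
    ∃ x ∈ T, (∀ i, x ≠ t i) ∧ ∑ i, -Real.log (x - t i) < (n + 1) * M := by
  set I := ∫⁻ x in Icc (-1 : ℝ) 1, ENNReal.ofReal (-Real.log x)
  set f : ℝ → ℝ≥0∞ := fun x => ∑ i, ENNReal.ofReal (-Real.log (x - t i)) with hf
  have hfm : Measurable f := by
    rw [hf]
    fun_prop
  have h_int : ∫⁻ x in Icc (-(1 / 2) : ℝ) (1 / 2), f x ≤ n * I := by
    rw [hf, lintegral_finsetSum _ fun i _ => by fun_prop]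
    refine (Finset.sum_le_sum fun i _ => lintegral_neg_log_sub_le (hT (ht i))).trans ?_
    simp [I]
  have hmk := (mul_meas_ge_le_lintegral (μ := volume.restrict (Icc (-(1 / 2) : ℝ) (1 / 2))) hfm
    (ENNReal.ofReal ((n + 1) * M))).trans h_int
  rw [Measure.restrict_apply (measurableSet_le measurable_const hfm)] at hmk
  by_contra! hcon
  have hsub : T ⊆ ({x | ENNReal.ofReal ((n + 1) * M) ≤ f x} ∩ Icc (-(1 / 2) : ℝ) (1 / 2)) ∪
      range t := by
    intro x hx
    by_cases h : ∃ i, x = t i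
    · obtain ⟨i, rfl⟩ := h
      exact Or.inr ⟨i, rfl⟩
    · refine Or.inl ⟨?_, hT hx⟩
      have := ENNReal.ofReal_le_ofReal (hcon x hx (not_exists.1 h))
      rwa [ENNReal.ofReal_sum_of_nonneg] at this
      intro i _
      rw [neg_nonneg]
      have h1 := hT hx
      have h2 := hT (ht i)
      refine Real.log_abs (x - t i) ▸ Real.log_nonpos (abs_nonneg _) ?_
      rw [abs_le]
      constructor <;> linarith [h1.1, h1.2, h2.1, h2.2]
  have hvol : volume T ≤
      volume ({x | ENNReal.ofReal ((n + 1) * M) ≤ f x} ∩ Icc (-(1 / 2) : ℝ) (1 / 2)) := by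
    refine (measure_mono hsub).trans ((measure_union_le _ _).trans ?_)
    rw [(finite_range t).measure_zero, add_zero]
  have h3 : (n + 1 : ℝ≥0∞) * (ENNReal.ofReal M * volume T) ≤ (n + 1) * I := by
    calc (n + 1 : ℝ≥0∞) * (ENNReal.ofReal M * volume T)
        = ENNReal.ofReal ((n + 1) * M) * volume T := by
          rw [ENNReal.ofReal_mul (by positivity), ← mul_assoc]
          congr 2
          rw [ENNReal.ofReal_add (by positivity) zero_le_one, ENNReal.ofReal_natCast,
            ENNReal.ofReal_one]
      _ ≤ n * I := (mul_le_mul_right hvol _).trans hmk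
      _ ≤ (n + 1) * I := by gcongr; exact le_self_add
  have h4 : (n + 1 : ℝ≥0∞) ≠ ∞ := by finiteness
  exact absurd ((ENNReal.mul_le_mul_iff_right (by simp) h4).1 h3) (not_le.2 hM)

theorem exists_exp_le_norm_disc {S : Set ℂ} (hS : ∀ w ∈ S, ‖w‖ ≤ 1 / 2)
    (hvol : 0 < volume (Complex.re '' S)) :
    ∃ M : ℝ, ∀ n : ℕ, ∃ u : Fin n → ℂ, (∀ i, u i ∈ S) ∧ Real.exp (-(M * n ^ 2)) ≤ ‖disc u‖ := by
  have hT : Complex.re '' S ⊆ Icc (-(1 / 2)) (1 / 2) := by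
    rintro _ ⟨w, hw, rfl⟩
    exact abs_le.1 ((Complex.abs_re_le_norm w).trans (hS w hw))
  obtain ⟨M, hM⟩ := ENNReal.exists_nat_mul_gt hvol.ne' lintegral_neg_log_lt_top.ne
  rw [← ENNReal.ofReal_natCast] at hM
  refine ⟨2 * M, fun n => ?_⟩
  induction n with
  | zero => exact ⟨Fin.elim0, fun i => i.elim0, by simp [disc]⟩
  | succ n ih =>
    obtain ⟨u, huS, hu⟩ := ih
    obtain ⟨_, ⟨w, hw, rfl⟩, hne, hlt⟩ := exists_mem_sum_neg_log_lt hT hM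
      (fun i => mem_image_of_mem _ (huS i))
    have e : Unit ⊕ Fin n ≃ Fin (n + 1) := Fintype.equivFinOfCardEq (by simp; omega)
    refine ⟨Sum.elim (fun _ => w) u ∘ e.symm, fun i => ?_, ?_⟩
    · rcases h : e.symm i with a | a
      · simpa [h] using hw
      · simpa [h] using huS a
    · have hprod : Real.exp (-((n + 1) * M)) ≤ ∏ j, ‖w - u j‖ := by
        calc Real.exp (-((n + 1) * M)) ≤ Real.exp (∑ j, Real.log (w.re - (u j).re)) := by
              rw [Finset.sum_neg_distrib] at hlt
              exact Real.exp_le_exp.2 (by linarith)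
          _ = ∏ j, |w.re - (u j).re| := by
              rw [Real.exp_sum]
              exact Finset.prod_congr rfl fun j _ => Real.exp_log_eq_abs (sub_ne_zero.2 (hne j))
          _ ≤ _ := Finset.prod_le_prod (fun _ _ => abs_nonneg _) fun j _ => by
              rw [← Complex.sub_re]
              exact Complex.abs_re_le_norm _
      have hd : disc (fun _ : Unit => w) = 1 := by simp [disc]
      rw [disc_comp_equiv, disc_sumElim, hd, one_mul, norm_mul]
      simp only [Finset.univ_unique, Finset.prod_singleton, norm_prod, norm_neg, norm_pow,
        Finset.prod_pow]
      calc Real.exp (-(2 * M * ((n + 1 : ℕ) : ℝ) ^ 2))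
          ≤ Real.exp (-(2 * M * n ^ 2)) * Real.exp (-((n + 1) * M)) ^ 2 := by
            rw [← Real.exp_nat_mul, ← Real.exp_add]
            refine Real.exp_le_exp.2 ?_
            push_cast
            have : (0 : ℝ) ≤ M * n := by positivity
            nlinarith
        _ ≤ _ := by gcongr

/-- Over a point off the first projection of a continuum of finite length in `ℂ²`, the fibre of
the hull has a null real part. -/
theorem volume_re_fibre_hull₂ {G : Set (ℂ × ℂ)} (hGc : IsCompact G) (hGconn : IsConnected G)
    (hGfin : μH[1] G < ∞) (hG1 : ∀ p ∈ G, ‖p.1‖ ≤ 1 / 2 ∧ ‖p.2‖ ≤ 1 / 2) {z : ℂ}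
    (hz : z ∉ Prod.fst '' G) :
    volume (Complex.re '' {w | (z, w) ∈ hull₂ G}) = 0 := by
  by_contra hne
  obtain ⟨M, hM⟩ := exists_exp_le_norm_disc
    (fun w hw => norm_snd_le_of_mem_hull₂ (fun p hp => (hG1 p hp).2) hw) (pos_iff_ne_zero.2 hne)
  have hgood : z ∈ good G := by rwa [good_eq_compl hGc hGconn hGfin hG1]
  obtain ⟨_, ρ, hρ, hdec⟩ := hgood
  obtain ⟨n₀, hn₀⟩ := hdec (M + 2) 0
  set n := n₀ + 1
  have hn : 1 ≤ n := by omega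
  obtain ⟨u, hu, hexp⟩ := hM n
  obtain ⟨d, hd, hH⟩ := exists_isRep_bigH_eq hGc (fun p hp => (hG1 p hp).1) hz hn hu
  have hb := hn₀ n (by omega) d hd 1 ⟨by simp, by simp⟩ z (mem_ball_self hρ)
  have hfac : Real.exp (-n) ≤ (n.factorial : ℝ) / n ^ n := by
    have h := Real.pow_div_factorial_le_exp (n : ℝ) (by positivity) n
    rw [Real.exp_neg, ← inv_div]
    exact inv_anti₀ (by positivity) h
  have hn1 : (1 : ℝ) ≤ n := by exact_mod_cast hn
  have : Real.exp (-n) * Real.exp (-(M * n ^ 2)) ≤ Real.exp (-(M + 2) * n ^ 2) := by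
    refine le_trans ?_ (hH ▸ hb)
    rw [norm_mul, norm_div, norm_pow, Complex.norm_natCast, Complex.norm_natCast]
    gcongr
  rw [← Real.exp_add, Real.exp_le_exp] at this
  nlinarith

end HullDim

namespace HullDim
open Set Metric
open scoped ENNReal

theorem subsingleton_image_of_volume_eq_zero {α : Type*} [TopologicalSpace α] {Y : Set α}
    (hY : IsPreconnected Y) {f : α → ℝ} (hf : Continuous f) (h0 : volume (f '' Y) = 0) {x y : α}
    (hx : x ∈ Y) (hy : y ∈ Y) : f x = f y := by
  have hc := (hY.image f hf.continuousOn).ordConnected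
  by_contra hne
  rcases lt_or_gt_of_ne hne with h | h
  · have := measure_mono_null (hc.out ⟨x, hx, rfl⟩ ⟨y, hy, rfl⟩) h0
    rw [Real.volume_Icc, ENNReal.ofReal_eq_zero] at this
    linarith
  · have := measure_mono_null (hc.out ⟨y, hy, rfl⟩ ⟨x, hx, rfl⟩) h0
    rw [Real.volume_Icc, ENNReal.ofReal_eq_zero] at this
    linarith

theorem dimH_le_one_of_hausdorffMeasure_lt_top {V : Type*} [MetricSpace V]
    [MeasurableSpace V] [BorelSpace V] {E : Set V} (hE : μH[1] E < ∞) : dimH E ≤ 1 := by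
  have := dimH_le_of_hausdorffMeasure_ne_top (d := 1) (s := E) (by simpa using hE.ne)
  simpa using this

theorem volume_image_eq_zero_of_hausdorffMeasure_lt_top {V : Type*} [MetricSpace V]
    [MeasurableSpace V] [BorelSpace V] {E : Set V} (hE : μH[1] E < ∞)
    {f : V → ℝ × ℝ} {C : NNReal} (hf : LipschitzWith C f) : volume (f '' E) = 0 := by
  have h1 : dimH (f '' E) ≤ 1 :=
    (hf.dimH_image_le E).trans (dimH_le_one_of_hausdorffMeasure_lt_top hE)
  have h2 := hausdorffMeasure_of_dimH_lt (d := 2) (h1.trans_lt (by norm_num))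
  simpa [hausdorffMeasure_prod_real] using h2

theorem lipschitzWith_re_prod {V : Type*} [NormedAddCommGroup V] [NormedSpace ℂ V] (p q : V →L[ℂ] ℂ) :
    ∃ C : NNReal, LipschitzWith C fun x => ((p x).re, (q x).re) :=
  ⟨_, (((Complex.reCLM.comp (p.restrictScalars ℝ)).prod
    (Complex.reCLM.comp (q.restrictScalars ℝ))).lipschitz)⟩

section

variable {V : Type*} [NormedAddCommGroup V] [NormedSpace ℂ V] [MeasurableSpace V] [BorelSpace V]

/-- The fibrewise nullity of `volume_re_fibre_hull₂` for all pairs of linear functionals. -/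
def NullFibres (X E : Set V) : Prop :=
  ∀ p q : V →L[ℂ] ℂ, ∀ z ∉ p '' E, volume (Complex.re '' (q '' (X ∩ p ⁻¹' {z}))) = 0

theorem NullFibres.volume_image {X E : Set V} (h : NullFibres X E) (hX : IsCompact X)
    (hE : μH[1] E < ∞) (p q : V →L[ℂ] ℂ) :
    volume ((fun x => (((p x).re, (p x).im), (q x).re)) '' X) = 0 := by
  have hm : MeasurableSet ((fun x => (((p x).re, (p x).im), (q x).re)) '' X) :=
    (hX.image (by fun_prop)).measurableSet
  rw [Measure.volume_eq_prod, Measure.measure_prod_null hm]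
  obtain ⟨C, hC⟩ := lipschitzWith_re_prod p (-Complex.I • p)
  have hnull := volume_image_eq_zero_of_hausdorffMeasure_lt_top hE hC
  filter_upwards [measure_eq_zero_iff_ae_notMem.1 hnull] with tu htu
  refine measure_mono_null ?_ (h p q ⟨tu.1, tu.2⟩ ?_)
  · rintro s ⟨x, hx, hxs⟩
    simp only [Prod.mk.injEq] at hxs
    refine ⟨_, ⟨x, ⟨hx, ?_⟩, rfl⟩, hxs.2⟩
    exact Complex.ext (by rw [← hxs.1]) (by rw [← hxs.1])
  · rintro ⟨x, hx, hxt⟩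
    refine htu ⟨x, hx, ?_⟩
    ext <;> simp [hxt]

theorem NullFibres.ae_volume_im {X E : Set V} (h : NullFibres X E) (hX : IsCompact X)
    (hE : μH[1] E < ∞) (p q : V →L[ℂ] ℂ) :
    ∀ᵐ ts : ℝ × ℝ, volume ((fun x => (p x).im) ''
      (X ∩ {x | (p x).re = ts.1 ∧ (q x).re = ts.2})) = 0 := by
  have h0 := h.volume_image hX hE p q
  set φ : (ℝ × ℝ) × ℝ → (ℝ × ℝ) × ℝ := fun a => ((a.1.1, a.2), a.1.2)
  have hφ : MeasurePreserving φ volume volume := by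
    have e1 := volume_preserving_prodAssoc (α₁ := ℝ) (β₁ := ℝ) (γ₁ := ℝ)
    have e2 := (MeasurePreserving.id (volume : Measure ℝ)).prod
      (Measure.measurePreserving_swap (μ := (volume : Measure ℝ)) (ν := (volume : Measure ℝ)))
    exact (e1.symm.comp e2).comp e1
  have hm : MeasurableSet ((fun x => (((p x).re, (p x).im), (q x).re)) '' X) :=
    (hX.image (by fun_prop)).measurableSet
  have h1 := hφ.measure_preimage hm.nullMeasurableSet
  rw [h0, Measure.volume_eq_prod, Measure.measure_prod_null (hφ.measurable hm)] at h1
  filter_upwards [h1] with ts hts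
  refine measure_mono_null ?_ hts
  rintro _ ⟨x, ⟨hx, hx1, hx2⟩, rfl⟩
  exact ⟨x, hx, by simp [φ, hx1, hx2]⟩

theorem exists_add_mul_notMem [SecondCountableTopology V] {E : Set V} (hE : μH[1] E < ∞) (p q : V →L[ℂ] ℂ) {a b : ℂ}
    (hab : ∀ x ∈ E, p x = a → q x ≠ b) : ∃ c : ℂ, ∀ x ∈ E, p x + c * q x ≠ a + c * b := by
  set E' := E ∩ {x | q x ≠ b}
  have hlip : ∀ x ∈ E', ∃ C : NNReal, ∃ t ∈ nhdsWithin x E',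
      LipschitzOnWith C (fun x => -(p x - a) / (q x - b)) t := by
    intro x hx
    have hd : ContDiffAt ℂ 1 (fun x => -(p x - a) / (q x - b)) x :=
      (by fun_prop : ContDiffAt ℂ 1 (fun x => -(p x - a)) x).div (by fun_prop)
        (sub_ne_zero.2 hx.2)
    obtain ⟨C, t, ht, hC⟩ := hd.exists_lipschitzOnWith
    exact ⟨C, t, mem_nhdsWithin_of_mem_nhds ht, hC⟩
  have hdim : dimH ((fun x => -(p x - a) / (q x - b)) '' E') < Module.finrank ℝ ℂ := by
    refine (dimH_image_le_of_locally_lipschitzOn hlip).trans_lt ?_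
    refine ((dimH_mono inter_subset_left).trans
      (dimH_le_one_of_hausdorffMeasure_lt_top hE)).trans_lt ?_
    rw [Complex.finrank_real_complex]
    norm_num
  obtain ⟨c, hc⟩ := (dense_compl_of_dimH_lt_finrank hdim).nonempty
  refine ⟨c, fun x hx hxe => ?_⟩
  by_cases hq : q x = b
  · exact hab x hx (by simpa [hq] using hxe) hq
  · refine hc ⟨x, ⟨hx, hq⟩, ?_⟩
    rw [div_eq_iff (sub_ne_zero.2 hq)]
    linear_combination -hxe

/-- Almost every slice of `X` by two real hyperplanes is totally disconnected. -/
theorem NullFibres.ae_isTotallyDisconnected [SecondCountableTopology V] {X E : Set V} (h : NullFibres X E)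
    (hX : IsCompact X) (hE : μH[1] E < ∞) (p q : V →L[ℂ] ℂ) :
    ∀ᵐ ts : ℝ × ℝ, IsTotallyDisconnected (X ∩ {x | (p x).re = ts.1 ∧ (q x).re = ts.2}) := by
  obtain ⟨C, hC⟩ := lipschitzWith_re_prod p q
  have hnull := volume_image_eq_zero_of_hausdorffMeasure_lt_top hE hC
  have hswap := (Measure.measurePreserving_swap (μ := (volume : Measure ℝ))
    (ν := (volume : Measure ℝ))).quasiMeasurePreserving.ae (h.ae_volume_im hX hE q p)
  filter_upwards [measure_eq_zero_iff_ae_notMem.1 hnull, h.ae_volume_im hX hE p q, hswap]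
    with ts hts hp hq Y hYX hY x hx y hy
  have hpc : ∀ y ∈ Y, p y = p x := fun y hy => Complex.ext
    ((hYX hy).2.1.trans (hYX hx).2.1.symm) (subsingleton_image_of_volume_eq_zero hY
      (f := fun x => (p x).im) (by fun_prop) (measure_mono_null (image_mono hYX) hp) hy hx)
  have hqc : ∀ y ∈ Y, q y = q x := fun y hy => Complex.ext
    ((hYX hy).2.2.trans (hYX hx).2.2.symm) (subsingleton_image_of_volume_eq_zero hY
      (f := fun x => (q x).im) (by fun_prop) (measure_mono_null (image_mono fun z hz => by
        exact ⟨(hYX hz).1, (hYX hz).2.2, (hYX hz).2.1⟩) hq) hy hx)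
  obtain ⟨c, hc⟩ := exists_add_mul_notMem hE p q (a := p x) (b := q x) fun w hw hpw hqw =>
    hts ⟨w, hw, Prod.ext (by simp [hpw, (hYX hx).2.1]) (by simp [hqw, (hYX hx).2.2])⟩
  have hre : ∀ l : V →L[ℂ] ℂ, (l x).re = (l y).re := fun l =>
    subsingleton_image_of_volume_eq_zero hY (f := fun x => (l x).re) (by fun_prop)
      (measure_mono_null (image_subset_iff.2 fun w hw => by
        exact ⟨_, ⟨w, ⟨(hYX hw).1, by simp [hpc w hw, hqc w hw]⟩, rfl⟩, rfl⟩)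
        (h (p + c • q) l (p x + c * q x) fun ⟨w, hw, hwe⟩ => hc w hw hwe)) hx hy
  by_contra hne
  obtain ⟨l, hl⟩ := SeparatingDual.exists_separating_of_ne (R := ℂ) hne
  refine hl (Complex.ext (hre l) ?_)
  simpa using hre (-Complex.I • l)

end

end HullDim

namespace HullDim
open Set Metric
open scoped ENNReal

variable {n : ℕ}

theorem norm_eval_le_of_mem_polyHull {K L : Set (EuclideanSpace ℂ (Fin n))} (hKL : K ⊆ L)
    (hL : L.Nonempty) {z : EuclideanSpace ℂ (Fin n)} (hz : z ∈ polyHull K)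
    {p : MvPolynomial (Fin n) ℂ} {M : ℝ}
    (h : ∀ w ∈ L, ‖MvPolynomial.eval (fun i => w i) p‖ ≤ M) :
    ‖MvPolynomial.eval (fun i => z i) p‖ ≤ M := by
  obtain ⟨w₀, hw₀⟩ := hL
  refine (hz p).trans (Real.sSup_le ?_ ((norm_nonneg _).trans (h w₀ hw₀)))
  rintro _ ⟨w, hw, rfl⟩
  exact h w (hKL hw)

theorem isCompact_polyHull {K L : Set (EuclideanSpace ℂ (Fin n))} (hKL : K ⊆ L)
    (hL : L.Nonempty) (hLc : IsCompact L) : IsCompact (polyHull K) := by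
  refine isCompact_of_isClosed_isBounded ?_ ?_
  · have : polyHull K = ⋂ p : MvPolynomial (Fin n) ℂ,
        {z | ‖MvPolynomial.eval (fun i => z i) p‖ ≤
          sSup ((fun w => ‖MvPolynomial.eval (fun i => w i) p‖) '' K)} := by
      ext z
      simp [polyHull]
    rw [this]
    refine isClosed_iInter fun p => isClosed_le ?_ continuous_const
    exact ((MvPolynomial.continuous_eval p).comp (by fun_prop)).norm
  · obtain ⟨M, hM⟩ := hLc.isBounded.exists_norm_le
    have hco : ∀ z ∈ polyHull K, ∀ i, ‖z i‖ ≤ M := fun z hz i => by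
      simpa using norm_eval_le_of_mem_polyHull hKL hL hz (p := MvPolynomial.X i) (M := M)
        fun w hw => by simpa using (PiLp.norm_apply_le w i).trans (hM w hw)
    refine ((PiLp.antilipschitzWith_ofLp 2 fun _ : Fin n => ℂ).isBounded_preimage
      (isBounded_closedBall (x := 0) (r := max M 0))).subset fun z hz => ?_
    rw [mem_preimage, mem_closedBall_zero_iff, pi_norm_le_iff_of_nonneg (le_max_right _ _)]
    exact fun i => (hco z hz i).trans (le_max_left _ _)

/-- A linear functional on `ℂⁿ` as a polynomial. -/
noncomputable def linearPoly (p : EuclideanSpace ℂ (Fin n) →L[ℂ] ℂ) : MvPolynomial (Fin n) ℂ :=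
  ∑ j, MvPolynomial.C (p (EuclideanSpace.single j 1)) * MvPolynomial.X j

theorem eval_linearPoly (p : EuclideanSpace ℂ (Fin n) →L[ℂ] ℂ) (x : EuclideanSpace ℂ (Fin n)) :
    MvPolynomial.eval (fun i => x i) (linearPoly p) = p x := by
  have hx : x = ∑ j, x j • EuclideanSpace.single j (1 : ℂ) := by
    ext i
    simp [Finset.sum_apply, Pi.single_apply]
  conv_rhs => rw [hx, map_sum]
  simp [linearPoly, mul_comm]

theorem mem_hull₂_of_mem_polyHull {K L : Set (EuclideanSpace ℂ (Fin n))} (hKL : K ⊆ L)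
    (hL : L.Nonempty) (p q : EuclideanSpace ℂ (Fin n) →L[ℂ] ℂ) {z : EuclideanSpace ℂ (Fin n)}
    (hz : z ∈ polyHull K) : (p z, q z) ∈ hull₂ ((fun x => (p x, q x)) '' L) := by
  intro N a M hM
  have hev : ∀ x : EuclideanSpace ℂ (Fin n), ∑ i, a i * monomials N (p x, q x) i =
      MvPolynomial.eval (fun i => x i)
        (∑ i, MvPolynomial.C (a i) * (linearPoly p ^ (i.1 : ℕ) * linearPoly q ^ (i.2 : ℕ))) := by
    intro x
    simp [eval_linearPoly, monomials]
  rw [hev]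
  refine norm_eval_le_of_mem_polyHull hKL hL hz fun w hw => ?_
  rw [← hev]
  exact hM _ ⟨w, hw, rfl⟩

theorem nullFibres_polyHull {K L : Set (EuclideanSpace ℂ (Fin n))} (hKL : K ⊆ L)
    (hLc : IsCompact L) (hL : IsConnected L) (hlen : μH[1] L < ∞) :
    NullFibres (polyHull K) L := by
  intro p q z hz
  have hpq : Continuous fun x => (p x, q x) := by fun_prop
  obtain ⟨A, hA⟩ := (hLc.image hpq).isBounded.exists_norm_le
  set s : ℝ := (2 * (|A| + 1))⁻¹ with hs
  have hs0 : 0 < s := by positivity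
  have hsA : s * A ≤ 1 / 2 := by
    rw [hs, inv_mul_le_iff₀ (by positivity)]
    linarith [le_abs_self A]
  set p' := (s : ℂ) • p
  set q' := (s : ℂ) • q
  have hcont : Continuous fun x => (p' x, q' x) := by fun_prop
  have hlip : LipschitzWith _ fun x => (p' x, q' x) := (p'.prod q').lipschitz
  have h0 := volume_re_fibre_hull₂ (hLc.image hcont) (hL.image _ hcont.continuousOn)
    (lt_of_le_of_lt (hlip.hausdorffMeasure_image_le zero_le_one L)
      (ENNReal.mul_lt_top (by simp) hlen)) (z := s * z) ?_ ?_
  · have hsub : Complex.re '' (q '' (polyHull K ∩ p ⁻¹' {z})) ⊆ (fun t => s * t) ⁻¹'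
        (Complex.re '' {w | ((s : ℂ) * z, w) ∈ hull₂ ((fun x => (p' x, q' x)) '' L)}) := by
      rintro _ ⟨_, ⟨x, ⟨hx, rfl⟩, rfl⟩, rfl⟩
      refine ⟨s * q x, ?_, by simp⟩
      exact mem_hull₂_of_mem_polyHull hKL hL.nonempty p' q' hx
    refine measure_mono_null hsub ?_
    rw [Real.volume_preimage_mul_left hs0.ne', h0, mul_zero]
  · rintro _ ⟨x, hx, rfl⟩
    have := hA _ ⟨x, hx, rfl⟩
    have h1 := (norm_fst_le (p x, q x)).trans this
    have h2 := (norm_snd_le (p x, q x)).trans this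
    simp only [p', q', smul_apply, smul_eq_mul, norm_mul, Complex.norm_real,
      Real.norm_of_nonneg hs0.le]
    exact ⟨(mul_le_mul_of_nonneg_left h1 hs0.le).trans hsA,
      (mul_le_mul_of_nonneg_left h2 hs0.le).trans hsA⟩
  · rintro ⟨_, ⟨x, hx, rfl⟩, hxz⟩
    refine hz ⟨x, hx, ?_⟩
    have hs' : (s : ℂ) ≠ 0 := by exact_mod_cast hs0.ne'
    exact mul_left_cancel₀ hs' hxz

end HullDim

namespace HullDim
open Set Metric
open scoped ENNReal

/-- `A` is covered by pairwise disjoint open sets of diameter less than `δ`. -/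
def SmallCover {V : Type*} [MetricSpace V] (δ : ℝ) (A : Set V) : Prop :=
  ∃ 𝒱 : Set (Set V), (∀ U ∈ 𝒱, IsOpen U) ∧ 𝒱.PairwiseDisjoint id ∧
    (∀ U ∈ 𝒱, ∀ x ∈ U, ∀ y ∈ U, dist x y < δ) ∧ A ⊆ ⋃₀ 𝒱

section SmallCover

variable {V : Type*} [MetricSpace V] {δ : ℝ}

theorem smallCover_empty : SmallCover δ (∅ : Set V) :=
  ⟨∅, by simp, by simp, by simp, by simp⟩

theorem smallCover_of_forall {ι : Type*} {A : Set V} (U : ι → Set V) (hU : ∀ i, IsOpen (U i))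
    (hd : ∀ i j, ∀ x ∈ U i, x ∈ U j → i = j) (hδ : ∀ i, ∀ x ∈ U i, ∀ y ∈ U i, dist x y < δ)
    (hA : ∀ x ∈ A, ∃ i, x ∈ U i) : SmallCover δ A := by
  refine ⟨range U, by rintro _ ⟨i, rfl⟩; exact hU i, ?_, by rintro _ ⟨i, rfl⟩; exact hδ i,
    fun x hx => ?_⟩
  · rintro _ ⟨i, rfl⟩ _ ⟨j, rfl⟩ hne
    refine disjoint_left.2 fun x hx hx' => hne ?_
    rw [hd i j x hx hx']
  · obtain ⟨i, hi⟩ := hA x hx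
    exact ⟨_, ⟨i, rfl⟩, hi⟩

/-- Clopen separation in a totally disconnected compact set. -/
theorem exists_isCompact_between {B C O : Set V} (hB : IsCompact B)
    (hBt : IsTotallyDisconnected B) (hC : IsCompact C) (hCB : C ⊆ B) (hO : IsOpen O)
    (hCO : C ⊆ O) : ∃ D, C ⊆ D ∧ D ⊆ B ∩ O ∧ IsCompact D ∧ IsCompact (B \ D) := by
  have : CompactSpace B := isCompact_iff_compactSpace.1 hB
  have : TotallyDisconnectedSpace B := totallyDisconnectedSpace_subtype_iff.2 hBt
  have hloc : ∀ x ∈ C, ∃ D : Set B, IsClopen D ∧ x ∈ Subtype.val '' D ∧ Subtype.val '' D ⊆ O := by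
    intro x hx
    obtain ⟨D, hD, hxD, hDO⟩ := compact_exists_isClopen_in_isOpen
      (hO.preimage (continuous_subtype_val (p := (· ∈ B)))) (x := ⟨x, hCB hx⟩) (hCO hx)
    exact ⟨D, hD, ⟨_, hxD, rfl⟩, image_subset_iff.2 hDO⟩
  choose! D hD hxD hDO using hloc
  have hC' : IsCompact (Subtype.val ⁻¹' C : Set B) :=
    (hC.isClosed.preimage continuous_subtype_val).isCompact
  obtain ⟨t, htC, ht⟩ := hC'.elim_nhds_subcover (fun x : B => D x) fun x hx => by
    obtain ⟨y, hy, hyx⟩ := hxD x hx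
    exact (hD x hx).isOpen.mem_nhds (Subtype.ext hyx ▸ hy)
  have hcl : IsClopen (⋃ x ∈ t, D (x : B)) :=
    t.finite_toSet.isClopen_biUnion fun x hx => hD x (htC x hx)
  refine ⟨Subtype.val '' (⋃ x ∈ t, D (x : B)), fun x hx => ⟨⟨x, hCB hx⟩, ht hx, rfl⟩, ?_,
    hcl.isClosed.isCompact.image continuous_subtype_val, ?_⟩
  · rintro _ ⟨y, hy, rfl⟩
    obtain ⟨x, hx, hyx⟩ := mem_iUnion₂.1 hy
    exact ⟨y.2, hDO x (htC x hx) ⟨y, hyx, rfl⟩⟩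
  · have h := hcl.compl.isClosed.isCompact.image continuous_subtype_val
    rwa [image_compl_eq_range_sdiff_image Subtype.val_injective, Subtype.range_val] at h

/-- Covers by small disjoint sets can be merged over disjoint compact sets. -/
theorem SmallCover.union_of_disjoint {A B : Set V} (hA : IsCompact A) (hB : IsCompact B)
    (hAB : Disjoint A B) (h : SmallCover δ A) (h' : SmallCover δ B) : SmallCover δ (A ∪ B) := by
  obtain ⟨𝒱, hVo, hVd, hVδ, hAV⟩ := h
  obtain ⟨𝒲, hWo, hWd, hWδ, hBW⟩ := h'
  obtain ⟨O₁, O₂, hO₁, hO₂, h1, h2, hO⟩ := SeparatedNhds.of_isCompact_isCompact hA hB hAB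
  rw [disjoint_left] at hO
  refine ⟨(· ∩ O₁) '' 𝒱 ∪ (· ∩ O₂) '' 𝒲, ?_, ?_, ?_, ?_⟩
  · rintro _ (⟨U, hU, rfl⟩ | ⟨U, hU, rfl⟩)
    exacts [(hVo U hU).inter hO₁, (hWo U hU).inter hO₂]
  · rintro _ (⟨U, hU, rfl⟩ | ⟨U, hU, rfl⟩) _ (⟨W, hW, rfl⟩ | ⟨W, hW, rfl⟩) hne <;>
      refine disjoint_left.2 fun x hx hx' => ?_
    · exact hne (by rw [hVd.elim_set hU hW x hx.1 hx'.1])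
    · exact hO hx.2 hx'.2
    · exact hO hx'.2 hx.2
    · exact hne (by rw [hWd.elim_set hU hW x hx.1 hx'.1])
  · rintro _ (⟨U, hU, rfl⟩ | ⟨U, hU, rfl⟩) x hx y hy
    exacts [hVδ U hU x hx.1 y hy.1, hWδ U hU x hx.1 y hy.1]
  · rintro x (hx | hx)
    · obtain ⟨U, hU, hxU⟩ := hAV hx
      exact ⟨_, Or.inl ⟨U, hU, rfl⟩, hxU, h1 hx⟩
    · obtain ⟨U, hU, hxU⟩ := hBW hx
      exact ⟨_, Or.inr ⟨U, hU, rfl⟩, hxU, h2 hx⟩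

theorem smallCover_of_subset_biUnion_ball (t : Finset V) :
    ∀ B : Set V, IsCompact B → IsTotallyDisconnected B → B ⊆ ⋃ x ∈ t, ball x (δ / 2) →
      SmallCover δ B := by
  classical
  induction t using Finset.induction_on with
  | empty =>
    intro B _ _ hBt
    have hB0 : B = ∅ := subset_empty_iff.1 (by simpa using hBt)
    rw [hB0]
    exact smallCover_empty
  | insert x t _ ih =>
    intro B hB hBt hsub
    have hopen : IsOpen (⋃ y ∈ t, ball y (δ / 2)) := isOpen_biUnion fun _ _ => isOpen_ball
    obtain ⟨D, hD1, hD2, hDc, hDc'⟩ := exists_isCompact_between hB hBt (hB.diff hopen)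
      sdiff_subset (isOpen_ball (x := x) (ε := δ / 2)) fun y hy => by
        have := hsub hy.1
        rw [Finset.set_biUnion_insert] at this
        exact this.resolve_right hy.2
    rw [← union_sdiff_cancel (hD2.trans inter_subset_left)]
    refine SmallCover.union_of_disjoint hDc hDc' disjoint_sdiff_self_right ?_
      (ih _ hDc' (fun s hs => hBt s (hs.trans sdiff_subset)) fun y hy => ?_)
    · refine ⟨{ball x (δ / 2)}, by simp, by simp, ?_, by simpa using hD2.trans inter_subset_right⟩
      rintro _ rfl y hy z hz
      linarith [dist_triangle_right y z x, mem_ball.1 hy, mem_ball.1 hz]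
    · by_contra hy'
      exact hy.2 (hD1 ⟨hy.1, hy'⟩)

theorem smallCover_of_isTotallyDisconnected (hδ : 0 < δ) {B : Set V} (hB : IsCompact B)
    (hBt : IsTotallyDisconnected B) : SmallCover δ B := by
  obtain ⟨t, _, ht⟩ := hB.elim_nhds_subcover (fun x => ball x (δ / 2))
    fun x _ => ball_mem_nhds x (half_pos hδ)
  exact smallCover_of_subset_biUnion_ball t B hB hBt ht

/-- Adding a totally disconnected compact set does not destroy a cover by disjoint sets. -/
theorem SmallCover.union (hδ : 0 < δ) {A B : Set V} (hA : IsCompact A) (hB : IsCompact B)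
    (hBt : IsTotallyDisconnected B) (h : SmallCover δ A) : SmallCover δ (A ∪ B) := by
  obtain ⟨𝒱, hVo, hVd, hVδ, hAV⟩ := h
  obtain ⟨D, hD1, hD2, hDc, hDc'⟩ := exists_isCompact_between hB hBt (hA.inter hB)
    inter_subset_right (isOpen_sUnion hVo) (inter_subset_left.trans hAV)
  have hdisj : Disjoint (A ∪ D) (B \ D) := by
    refine disjoint_left.2 fun x hx hx' => hx'.2 ?_
    rcases hx with hx | hx
    exacts [hD1 ⟨hx, hx'.1⟩, hx]
  have hAB : A ∪ B = (A ∪ D) ∪ (B \ D) := by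
    rw [union_assoc, union_sdiff_cancel (hD2.trans inter_subset_left)]
  rw [hAB]
  exact SmallCover.union_of_disjoint (hA.union hDc) hDc' hdisj
    ⟨𝒱, hVo, hVd, hVδ, union_subset hAV (hD2.trans inter_subset_right)⟩
    (smallCover_of_isTotallyDisconnected hδ hDc' fun s hs => hBt s (hs.trans sdiff_subset))

theorem smallCover_biUnion {κ : Type*} (hδ : 0 < δ) (s : Finset κ) (A : κ → Set V)
    (hA : ∀ i ∈ s, IsCompact (A i)) (hAt : ∀ i ∈ s, IsTotallyDisconnected (A i)) :
    SmallCover δ (⋃ i ∈ s, A i) := by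
  classical
  induction s using Finset.induction_on with
  | empty => simpa using smallCover_empty
  | insert i s _ ih =>
    rw [Finset.set_biUnion_insert, union_comm]
    exact (ih (fun j hj => hA j (Finset.mem_insert_of_mem hj))
      fun j hj => hAt j (Finset.mem_insert_of_mem hj)).union hδ
      (s.isCompact_biUnion fun j hj => hA j (Finset.mem_insert_of_mem hj))
      (hA i (Finset.mem_insert_self i s)) (hAt i (Finset.mem_insert_self i s))

end SmallCover

/-- Three families of small disjoint open sets bound the covering dimension by two. -/
theorem covDimLE_two_of_smallCover {V : Type*} [MetricSpace V] {X : Set V} (hX : IsCompact X)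
    (h : ∀ δ > 0, ∃ A : Fin 3 → Set V, (∀ i, SmallCover δ (A i)) ∧ X ⊆ ⋃ i, A i) :
    CovDimLE X 2 := by
  classical
  intro 𝒰 h𝒰
  have : CompactSpace X := isCompact_iff_compactSpace.1 hX
  obtain ⟨δ, hδ, hleb⟩ := lebesgue_number_lemma_of_metric_sUnion (isCompact_univ (X := X))
    h𝒰.1 fun x _ => by
      obtain ⟨U, hU, hx⟩ := h𝒰.2 x
      exact ⟨U, hU, hx⟩
  obtain ⟨A, hA, hXA⟩ := h δ hδ
  choose 𝒱 hVo hVd hVδ hAV using hA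
  refine ⟨{W | W.Nonempty ∧ ∃ i, ∃ U ∈ 𝒱 i, W = Subtype.val ⁻¹' U}, ⟨?_, fun x => ?_⟩, ?_, ?_⟩
  · rintro _ ⟨_, i, U, hU, rfl⟩
    exact (hVo i U hU).preimage continuous_subtype_val
  · obtain ⟨i, hi⟩ := mem_iUnion.1 (hXA x.2)
    obtain ⟨U, hU, hxU⟩ := hAV i hi
    exact ⟨_, ⟨⟨x, hxU⟩, i, U, hU, rfl⟩, hxU⟩
  · rintro _ ⟨⟨x, hx⟩, i, U, hU, rfl⟩
    obtain ⟨W, hW, hball⟩ := hleb x (mem_univ x)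
    exact ⟨W, hW, fun y hy => hball (hVδ i U hU y hy x hx)⟩
  · rintro T hT ⟨x, hx⟩
    have hT' : ∀ W ∈ T, ∃ i, ∃ U ∈ 𝒱 i, W = Subtype.val ⁻¹' U := fun W hW => (hT hW).2
    choose! c U hU hWU using hT'
    refine (Finset.card_le_card_of_injOn c (fun W hW => Finset.mem_univ (c W)) ?_).trans
      (by simp)
    intro W hW W' hW' hc
    have hxW : (x : V) ∈ U W := by
      have := hx W hW
      rwa [hWU W hW] at this
    have hxW' : (x : V) ∈ U W' := by
      have := hx W' hW'
      rwa [hWU W' hW'] at this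
    rw [hWU W hW, hWU W' hW', (hVd (c W)).elim_set (hU W hW) (hc ▸ hU W' hW') x hxW hxW']

end HullDim

namespace HullDim
open Set Metric
open scoped ENNReal

/-- An open cell of the grid `ℤ^ι - c` in the coordinates `g`. -/
def gridCell {V ι : Type*} (g : ι → V → ℝ) (c : ι → ℝ) (a : ι → ℤ) : Set V :=
  {x | ∀ j, (a j : ℝ) < g j x + c j ∧ g j x + c j < a j + 1}

theorem eq_of_mem_gridCell {V ι : Type*} {g : ι → V → ℝ} {c : ι → ℝ} {a b : ι → ℤ} {x : V} (ha : x ∈ gridCell g c a)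
    (hb : x ∈ gridCell g c b) : a = b := by
  funext j
  rw [← Int.floor_eq_iff.2 ⟨(ha j).1.le, (ha j).2⟩, Int.floor_eq_iff.2 ⟨(hb j).1.le, (hb j).2⟩]

theorem dist_lt_of_mem_gridCell {V ι : Type*} [MetricSpace V] {g : ι → V → ℝ} {δ : ℝ}
    (hδ : ∀ x y, (∀ i, |g i x - g i y| < 1) → dist x y < δ)
    {c : ι → ℝ} {a : ι → ℤ} {x y : V} (hx : x ∈ gridCell g c a) (hy : y ∈ gridCell g c a) :
    dist x y < δ :=
  hδ x y fun i => abs_lt.2 ⟨by linarith [(hx i).1, (hy i).2], by linarith [(hx i).2, (hy i).1]⟩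

theorem exists_mem_gridCell {V ι : Type*} {g : ι → V → ℝ} {c : ι → ℝ} {x : V}
    (hx : ∀ j, g j x + c j ∉ range ((↑) : ℤ → ℝ)) : ∃ a, x ∈ gridCell g c a :=
  ⟨fun j => ⌊g j x + c j⌋, fun j => ⟨lt_of_le_of_ne (Int.floor_le _) fun h => hx j ⟨_, h⟩,
    Int.lt_floor_add_one _⟩⟩

section Grid

variable {V ι : Type*} [MetricSpace V] [Fintype ι] {g : ι → V → ℝ} {δ : ℝ}

theorem isOpen_gridCell (hg : ∀ i, Continuous (g i)) (c : ι → ℝ) (a : ι → ℤ) :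
    IsOpen (gridCell g c a) := by
  simp only [gridCell, ofPred_forall]
  refine isOpen_iInter_of_finite fun j => ?_
  have hc : Continuous fun x => g j x + c j := (hg j).add continuous_const
  exact (isOpen_lt continuous_const hc).inter (isOpen_lt hc continuous_const)

theorem smallCover_off_grid (hg : ∀ i, Continuous (g i))
    (hδ : ∀ x y, (∀ i, |g i x - g i y| < 1) → dist x y < δ) :
    SmallCover δ {x | ∀ j, g j x ∉ range ((↑) : ℤ → ℝ)} :=
  smallCover_of_forall (gridCell g 0) (isOpen_gridCell hg 0)
    (fun _ _ _ => eq_of_mem_gridCell) (fun _ _ hx _ hy => dist_lt_of_mem_gridCell hδ hx hy)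
    fun x hx => exists_mem_gridCell fun j => by simpa using hx j

theorem smallCover_one_on_grid (hg : ∀ i, Continuous (g i))
    (hδ : ∀ x y, (∀ i, |g i x - g i y| < 1) → dist x y < δ) :
    SmallCover δ {x | ∃ i, g i x ∈ range ((↑) : ℤ → ℝ) ∧
      ∀ j, j ≠ i → g j x ∉ range ((↑) : ℤ → ℝ)} := by
  classical
  set Z := range ((↑) : ℤ → ℝ)
  have hZ : IsClosed Z := Int.isClosedEmbedding_coe_real.isClosed_range
  have hZne : Z.Nonempty := range_nonempty _
  let c : ι → ι → ℝ := fun i => Pi.single i (1 / 2)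
  let U : ι × (ι → ℤ) → Set V := fun p =>
    {x | ∀ j, j ≠ p.1 → infDist (g p.1 x) Z < infDist (g j x) Z} ∩ gridCell g (c p.1) p.2
  refine smallCover_of_forall U (fun p => ?_) ?_
    (fun p x hx y hy => dist_lt_of_mem_gridCell hδ hx.2 hy.2) ?_
  · refine IsOpen.inter ?_ (isOpen_gridCell hg _ _)
    simp only [ofPred_forall]
    refine isOpen_iInter_of_finite fun j => isOpen_iInter_of_finite fun _ => ?_
    exact isOpen_lt ((continuous_infDist_pt Z).comp (hg _)) ((continuous_infDist_pt Z).comp (hg _))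
  · rintro ⟨i, a⟩ ⟨k, b⟩ x ⟨hx, hxa⟩ ⟨hx', hxb⟩
    obtain rfl : i = k := by
      by_contra hne
      exact lt_asymm (hx k (Ne.symm hne)) (hx' i hne)
    exact Prod.ext rfl (eq_of_mem_gridCell hxa hxb)
  · rintro x ⟨i, hi, hx⟩
    obtain ⟨a, ha⟩ := exists_mem_gridCell (g := g) (c := c i) (x := x) fun j => by
      by_cases hj : j = i
      · subst hj
        obtain ⟨m, hm⟩ := hi
        rintro ⟨l, hl⟩
        rw [← hm, show c j j = 1 / 2 from Pi.single_eq_same _ _] at hl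
        have h2 : ((2 * l : ℤ) : ℝ) = ((2 * m + 1 : ℤ) : ℝ) := by
          push_cast
          linarith
        have := Int.cast_injective h2
        omega
      · rw [show c i j = 0 from Pi.single_eq_of_ne hj _, add_zero]
        exact hx j hj
    refine ⟨(i, a), fun j hj => ?_, ha⟩
    rw [show infDist (g i x) Z = 0 from infDist_zero_of_mem hi]
    exact (hZ.notMem_iff_infDist_pos hZne).1 (hx j hj)

theorem smallCover_two_on_grid {X : Set V} (hX : IsCompact X) (hδ : 0 < δ)
    (hg : ∀ i, Continuous (g i)) (htd : ∀ i k, i ≠ k → ∀ a b : ℤ,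
      IsTotallyDisconnected (X ∩ {x | g i x = a ∧ g k x = b})) :
    SmallCover δ {x | x ∈ X ∧ ∃ i k, i ≠ k ∧ g i x ∈ range ((↑) : ℤ → ℝ) ∧
      g k x ∈ range ((↑) : ℤ → ℝ)} := by
  classical
  have hbdd : ∀ i, ∃ N : ℤ, ∀ x ∈ X, |g i x| ≤ N := fun i => by
    obtain ⟨M, hM⟩ := (hX.image (hg i)).isBounded.exists_norm_le
    exact ⟨⌈M⌉, fun x hx => (hM _ ⟨x, hx, rfl⟩).trans (Int.le_ceil M)⟩
  choose N hN using hbdd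
  let s : Finset (ι × ι × ℤ × ℤ) := (Finset.univ ×ˢ Finset.univ ×ˢ
    (Finset.univ.biUnion fun i => Finset.Icc (-N i) (N i)) ×ˢ
    (Finset.univ.biUnion fun i => Finset.Icc (-N i) (N i))).filter fun p => p.1 ≠ p.2.1
  have hsc := smallCover_biUnion hδ s
    (fun p => X ∩ {x | g p.1 x = p.2.2.1 ∧ g p.2.1 x = p.2.2.2})
    (fun p _ => hX.inter_right ((isClosed_eq (hg _) continuous_const).inter
      (isClosed_eq (hg _) continuous_const)))
    fun p hp => htd _ _ (Finset.mem_filter.1 hp).2 _ _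
  obtain ⟨𝒱, h1, h2, h3, h4⟩ := hsc
  refine ⟨𝒱, h1, h2, h3, fun x ⟨hx, i, k, hik, ⟨a, ha⟩, ⟨b, hb⟩⟩ => h4 ?_⟩
  refine mem_iUnion₂.2 ⟨(i, k, a, b), ?_, hx, ha.symm, hb.symm⟩
  have ha' : a ∈ Finset.Icc (-N i) (N i) := by
    have := abs_le.1 (hN i x hx)
    rw [← ha] at this
    exact Finset.mem_Icc.2 ⟨by exact_mod_cast this.1, by exact_mod_cast this.2⟩
  have hb' : b ∈ Finset.Icc (-N k) (N k) := by
    have := abs_le.1 (hN k x hx)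
    rw [← hb] at this
    exact Finset.mem_Icc.2 ⟨by exact_mod_cast this.1, by exact_mod_cast this.2⟩
  simp only [s, Finset.mem_filter, Finset.mem_product, Finset.mem_univ, Finset.mem_biUnion,
    true_and]
  exact ⟨⟨⟨i, ha'⟩, ⟨k, hb'⟩⟩, hik⟩

theorem exists_smallCover_of_grid {X : Set V} (hX : IsCompact X) (hδ0 : 0 < δ)
    (hg : ∀ i, Continuous (g i)) (hδ : ∀ x y, (∀ i, |g i x - g i y| < 1) → dist x y < δ)
    (htd : ∀ i k, i ≠ k → ∀ a b : ℤ,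
      IsTotallyDisconnected (X ∩ {x | g i x = a ∧ g k x = b})) :
    ∃ A : Fin 3 → Set V, (∀ i, SmallCover δ (A i)) ∧ X ⊆ ⋃ i, A i := by
  refine ⟨![{x | x ∈ X ∧ ∃ i k, i ≠ k ∧ g i x ∈ range ((↑) : ℤ → ℝ) ∧
      g k x ∈ range ((↑) : ℤ → ℝ)},
    {x | ∃ i, g i x ∈ range ((↑) : ℤ → ℝ) ∧ ∀ j, j ≠ i → g j x ∉ range ((↑) : ℤ → ℝ)},
    {x | ∀ j, g j x ∉ range ((↑) : ℤ → ℝ)}], fun i => ?_, fun x hx => mem_iUnion.2 ?_⟩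
  · fin_cases i
    exacts [smallCover_two_on_grid hX hδ0 hg htd, smallCover_one_on_grid hg hδ,
      smallCover_off_grid hg hδ]
  · by_cases h : ∀ j, g j x ∉ range ((↑) : ℤ → ℝ)
    · exact ⟨2, h⟩
    · push Not at h
      obtain ⟨i, hi⟩ := h
      by_cases h' : ∀ j, j ≠ i → g j x ∉ range ((↑) : ℤ → ℝ)
      · exact ⟨1, i, hi, h'⟩
      · push Not at h'
        obtain ⟨k, hk, hk'⟩ := h'
        exact ⟨0, hx, i, k, hk.symm, hi, hk'⟩

end Grid

/-- Generic choice of finitely many reals subject to almost everywhere pairwise conditions. -/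
theorem exists_forall_pair_of_ae {ι : Type*} [Finite ι] {P : ι → ι → ℝ → ℝ → Prop}
    (hP : ∀ i k, ∀ᵐ t, ∀ᵐ s, P i k t s ∧ P k i s t) :
    ∃ τ : ι → ℝ, ∀ i k, i ≠ k → P i k (τ i) (τ k) := by
  classical
  cases nonempty_fintype ι
  suffices h : ∀ S : Finset ι, ∃ τ : ι → ℝ, (∀ i ∈ S, ∀ k, ∀ᵐ s, P i k (τ i) s ∧ P k i s (τ i)) ∧
      ∀ i ∈ S, ∀ k ∈ S, i ≠ k → P i k (τ i) (τ k) by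
    obtain ⟨τ, -, hτ⟩ := h Finset.univ
    exact ⟨τ, fun i k => hτ i (Finset.mem_univ i) k (Finset.mem_univ k)⟩
  intro S
  induction S using Finset.induction_on with
  | empty => exact ⟨0, by simp, by simp⟩
  | insert a S ha ih =>
    obtain ⟨τ, h1, h2⟩ := ih
    have hex : ∀ᵐ t : ℝ, (∀ k, ∀ᵐ s, P a k t s ∧ P k a s t) ∧
        ∀ i ∈ S, P i a (τ i) t ∧ P a i t (τ i) := by
      refine (ae_all_iff.2 (hP a)).and ?_
      exact (ae_ball_iff S.countable_toSet).2 fun i hi => h1 i hi a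
    obtain ⟨t, ht1, ht2⟩ := hex.exists
    have hne : ∀ i ∈ S, i ≠ a := fun i hi h => ha (h ▸ hi)
    have hup : ∀ i ∈ S, Function.update τ a t i = τ i := fun i hi =>
      Function.update_of_ne (hne i hi) _ _
    refine ⟨Function.update τ a t, fun i hi k => ?_, fun i hi k hk hik => ?_⟩
    · rcases Finset.mem_insert.1 hi with rfl | hi
      · simpa using ht1 k
      · rw [hup i hi]
        exact h1 i hi k
    · rcases Finset.mem_insert.1 hi with rfl | hi' <;>
        rcases Finset.mem_insert.1 hk with rfl | hk'
      · exact absurd rfl hik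
      · rw [hup k hk', Function.update_self]
        exact (ht2 k hk').2
      · rw [hup i hi', Function.update_self]
        exact (ht2 i hi').1
      · rw [hup i hi', hup k hk']
        exact h2 i hi' k hk' hik

end HullDim

namespace HullDim
open Set Metric
open scoped ENNReal

/-- The real and (up to sign) imaginary coordinates of `ℂⁿ` as real parts of linear functionals. -/
noncomputable def coordFunctional {n : ℕ} (i : Fin n × Bool) : EuclideanSpace ℂ (Fin n) →L[ℂ] ℂ :=
  (if i.2 then 1 else -Complex.I) • EuclideanSpace.proj i.1

theorem NullFibres.ae_forall_isTotallyDisconnected {V : Type*} [NormedAddCommGroup V]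
    [NormedSpace ℂ V] [MeasurableSpace V] [BorelSpace V] [SecondCountableTopology V] {X E : Set V}
    (h : NullFibres X E) (hX : IsCompact X) (hE : μH[1] E < ∞) (p q : V →L[ℂ] ℂ) (ε : ℝ) :
    ∀ᵐ t : ℝ, ∀ᵐ s : ℝ, ∀ a b : ℤ, IsTotallyDisconnected
      (X ∩ {x | (p x).re = t + ε * a ∧ (q x).re = s + ε * b}) := by
  refine Measure.ae_ae_of_ae_prod (μ := volume) (ν := volume)
    (p := fun ts : ℝ × ℝ => ∀ a b : ℤ, IsTotallyDisconnected
      (X ∩ {x | (p x).re = ts.1 + ε * a ∧ (q x).re = ts.2 + ε * b})) ?_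
  refine ae_all_iff.2 fun a => ae_all_iff.2 fun b => ?_
  exact (measurePreserving_add_right (volume : Measure (ℝ × ℝ))
    (ε * a, ε * b)).quasiMeasurePreserving.ae (h.ae_isTotallyDisconnected hX hE p q)

theorem covDimLE_two_of_nullFibres {n : ℕ} {X E : Set (EuclideanSpace ℂ (Fin n))}
    (h : NullFibres X E) (hX : IsCompact X) (hE : μH[1] E < ∞) : CovDimLE X 2 := by
  refine covDimLE_two_of_smallCover hX fun δ hδ => ?_
  have hanti := PiLp.antilipschitzWith_ofLp 2 fun _ : Fin n => ℂ
  set C : NNReal := (Fintype.card (Fin n) : NNReal) ^ (1 / (2 : ℝ≥0∞)).toReal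
  set ε : ℝ := δ / (2 * C + 1) with hε
  have hε0 : 0 < ε := by positivity
  let P : Fin n × Bool → Fin n × Bool → ℝ → ℝ → Prop := fun i k t s => ∀ a b : ℤ,
    IsTotallyDisconnected
      (X ∩ {x | (coordFunctional i x).re = t + ε * a ∧ (coordFunctional k x).re = s + ε * b})
  obtain ⟨τ, hτ⟩ := exists_forall_pair_of_ae (P := P) fun i k => by
    filter_upwards [h.ae_forall_isTotallyDisconnected hX hE (coordFunctional i)
      (coordFunctional k) ε] with t ht
    filter_upwards [ht] with s hs
    exact ⟨hs, fun a b => by simpa only [and_comm] using hs b a⟩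
  have heq : ∀ i (x : EuclideanSpace ℂ (Fin n)) (a : ℤ),
      ((coordFunctional i x).re - τ i) / ε = a ↔ (coordFunctional i x).re = τ i + ε * a := by
    intro i x a
    rw [div_eq_iff hε0.ne', sub_eq_iff_eq_add, add_comm, mul_comm]
  refine exists_smallCover_of_grid (g := fun i x => ((coordFunctional i x).re - τ i) / ε) hX hδ
    (fun i => by fun_prop) (fun x y hxy => ?_) fun i k hik a b => ?_
  · have hd : ∀ i, |(coordFunctional i (x - y)).re| ≤ ε := fun i => by
      have := hxy i
      rw [← sub_div, sub_sub_sub_cancel_right, abs_div, abs_of_pos hε0, div_lt_one hε0] at this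
      rw [map_sub, Complex.sub_re]
      exact this.le
    have hcoord : dist (WithLp.ofLp x) (WithLp.ofLp y) ≤ 2 * ε := by
      refine (dist_pi_le_iff (by positivity)).2 fun j => ?_
      rw [dist_eq_norm]
      have h1 : |(x j).re - (y j).re| ≤ ε := by simpa [coordFunctional] using hd (j, true)
      have h2 : |(x j).im - (y j).im| ≤ ε := by simpa [coordFunctional] using hd (j, false)
      have h3 := Complex.norm_le_abs_re_add_abs_im (x j - y j)
      simp only [Complex.sub_re, Complex.sub_im] at h3
      linarith
    calc dist x y ≤ C * dist (WithLp.ofLp x) (WithLp.ofLp y) := hanti.le_mul_dist x y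
      _ ≤ C * (2 * ε) := by gcongr
      _ < δ := by
        rw [hε, ← mul_assoc, mul_div_assoc', div_lt_iff₀ (by positivity)]
        nlinarith
  · simp only [heq]
    exact hτ i k hik a b

end HullDim

/-! **Statement 4.**
If `Γ ⊂ ℂⁿ` is a compact subset of a continuum (compact connected set) of finite
one-dimensional Hausdorff measure, then the covering dimension of the polynomially
convex hull `Γ̂` of `Γ` is at most `2`. -/

theorem covDim_polyHull_le_two
    {n : ℕ} (Γ : Set (EuclideanSpace ℂ (Fin n))) (hΓ : IsCompact Γ)
    (E : Set (EuclideanSpace ℂ (Fin n))) (hEc : IsCompact E) (hEconn : IsConnected E)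
    (hΓE : Γ ⊆ E) (hlen : μH[1] E < ⊤) :
    CovDimLE (polyHull Γ) 2 :=
  HullDim.covDimLE_two_of_nullFibres (HullDim.nullFibres_polyHull hΓE hEc hEconn hlen)
    (HullDim.isCompact_polyHull hΓE hEconn.nonempty hEc) hlen
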